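/- There is an absolute constant C > 0 such that for every finite set P of N ≥ 2 points in the hyperbolic plane ℍ², the number of distance quadruples satisfies |Q(P)| ≤ C · N³ · log N. -/

import Mathlib

open scoped UpperHalfPlane MatrixGroups

noncomputable section

/-- The set of distance quadruples of a finite set `P` in the hyperbolic plane:
quadruples `(p₁,p₂,p₃,p₄) ∈ P⁴` with `d(p₁,p₂) = d(p₃,p₄) ≠ 0`. -/
def distQuadruples (P : Finset ℍ) : Set (ℍ × ℍ × ℍ × ℍ) :=
  {x | x.1 ∈ P ∧ x.2.1 ∈ P ∧ x.2.2.1 ∈ P ∧ x.2.2.2 ∈ P ∧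
    dist x.1 x.2.1 = dist x.2.2.1 x.2.2.2 ∧ dist x.1 x.2.1 ≠ 0}

namespace GK
open MvPolynomial
abbrev E3 := Fin 3 → ℝ
abbrev Poly := MvPolynomial (Fin 3) ℝ
def restr (a v : E3) : Poly →ₐ[ℝ] Polynomial ℝ :=
  aeval (fun i => Polynomial.C (a i) + Polynomial.C (v i) * Polynomial.X)
lemma eval_restr (a v : E3) (F : Poly) (t : ℝ) :
    (restr a v F).eval t = eval (a + t • v) F := by
  induction F using MvPolynomial.induction_on with
  | C c => simp [restr]
  | add p q hp hq => simp [map_add, hp, hq]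
  | mul_X p i hp => rw [map_mul, Polynomial.eval_mul, hp]; simp [restr]; ring_nf; simp
lemma natDegree_restr_le (a v : E3) (F : Poly) : (restr a v F).natDegree ≤ F.totalDegree := by
  have := MvPolynomial.aeval_natDegree_le (R := ℝ) (m := F.totalDegree) (n := 1) F le_rfl
    (fun i => Polynomial.C (a i) + Polynomial.C (v i) * Polynomial.X) (fun i => by compute_degree)
  simpa [restr] using this
def lin (a v : E3) : Set E3 := {x | ∃ t : ℝ, x = a + t • v}
def IsLine (l : Set E3) : Prop := ∃ a v, v ≠ 0 ∧ l = lin a v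
def Van (F : Poly) (l : Set E3) : Prop := ∀ x ∈ l, eval x F = 0
lemma van_lin_iff (a v : E3) (F : Poly) : Van F (lin a v) ↔ restr a v F = 0 := by
  constructor
  · intro h
    apply Polynomial.funext
    intro t
    rw [eval_restr, h _ ⟨t, rfl⟩, Polynomial.eval_zero]
  · rintro h x ⟨t, rfl⟩
    rw [← eval_restr, h, Polynomial.eval_zero]
lemma van_mul {l : Set E3} (hl : IsLine l) (F G : Poly) : Van (F * G) l ↔ Van F l ∨ Van G l := by
  obtain ⟨a, v, -, rfl⟩ := hl
  simp [van_lin_iff]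
lemma van_prod {l : Set E3} (hl : IsLine l) {ι : Type*} (s : Finset ι) (f : ι → Poly) :
    Van (∏ i ∈ s, f i) l ↔ ∃ i ∈ s, Van (f i) l := by
  obtain ⟨a, v, -, rfl⟩ := hl
  simp [van_lin_iff, map_prod, Finset.prod_eq_zero_iff]
lemma lin_inj {a v : E3} (hv : v ≠ 0) : Function.Injective (fun t : ℝ => a + t • v) := by
  intro s t h
  have h' : s • v = t • v := by simpa using h
  exact smul_left_injective ℝ hv h'
lemma van_of_points {l : Set E3} (hl : IsLine l) (F : Poly) (T : Finset E3)
    (hT : ∀ x ∈ T, x ∈ l ∧ eval x F = 0) (h : F.totalDegree < T.card) : Van F l := by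
  classical
  obtain ⟨a, v, hv, rfl⟩ := hl
  rw [van_lin_iff]
  by_contra hne
  choose! f hf using fun x hx => (hT x hx).1
  have hinj : Set.InjOn f T := by
    intro x hx y hy hxy
    rw [hf x hx, hf y hy, hxy]
  have h1 : T.image f ⊆ (restr a v F).roots.toFinset := by
    intro t ht
    obtain ⟨x, hx, rfl⟩ := Finset.mem_image.1 ht
    simp only [Multiset.mem_toFinset, Polynomial.mem_roots hne, Polynomial.IsRoot, eval_restr]
    rw [← hf x hx]; exact (hT x hx).2
  have h2 := Finset.card_le_card h1
  rw [Finset.card_image_of_injOn hinj] at h2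
  have h3 := (restr a v F).roots.toFinset_card_le
  have h4 := Polynomial.card_roots' (restr a v F)
  have h5 := natDegree_restr_le a v F
  omega
lemma line_infinite {l : Set E3} (hl : IsLine l) : l.Infinite := by
  obtain ⟨a, v, hv, rfl⟩ := hl
  have : lin a v = Set.range (fun t : ℝ => a + t • v) := by
    ext x; simp [lin, eq_comm]
  rw [this]
  exact Set.infinite_range_of_injective (lin_inj hv)
lemma line_eq {l : Set E3} (hl : IsLine l) {x y : E3} (hx : x ∈ l) (hy : y ∈ l) (hxy : x ≠ y) :
    l = lin x (y - x) := by
  obtain ⟨a, v, hv, rfl⟩ := hl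
  obtain ⟨s, rfl⟩ := hx
  obtain ⟨t, rfl⟩ := hy
  have hst : t - s ≠ 0 := by
    intro h; apply hxy; rw [sub_eq_zero.1 h]
  ext z
  constructor
  · rintro ⟨r, rfl⟩
    refine ⟨(r - s) / (t - s), ?_⟩
    ext i; simp; field_simp; ring
  · rintro ⟨r, rfl⟩
    refine ⟨s + r * (t - s), ?_⟩
    ext i; simp; ring
lemma line_eq_of_two {l m : Set E3} (hl : IsLine l) (hm : IsLine m) {x y : E3} (hx : x ∈ l)
    (hy : y ∈ l) (hx' : x ∈ m) (hy' : y ∈ m) (hxy : x ≠ y) : l = m := by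
  rw [line_eq hl hx hy hxy, line_eq hm hx' hy' hxy]
lemma line_dir {l : Set E3} (hl : IsLine l) {x : E3} (hx : x ∈ l) : ∃ v, v ≠ 0 ∧ l = lin x v := by
  obtain ⟨y, hy, hxy⟩ := (line_infinite hl).exists_notMem_finset {x}
  refine ⟨y - x, ?_, line_eq hl hx hy ?_⟩
  · simpa [sub_eq_zero] using hxy
  · rintro rfl; simp at hxy
lemma mem_lin_self (a v : E3) : a ∈ lin a v := ⟨0, by simp⟩
lemma isLine_lin {a v : E3} (hv : v ≠ 0) : IsLine (lin a v) := ⟨a, v, hv, rfl⟩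
lemma totalDegree_pderiv_le (i : Fin 3) (F : Poly) :
    (pderiv i F).totalDegree ≤ F.totalDegree - 1 := by
  classical
  conv_lhs => rw [F.as_sum, map_sum]
  apply totalDegree_finsetSum_le
  intro s hs
  rw [pderiv_monomial]
  by_cases h0 : s i = 0
  · simp [h0]
  refine (totalDegree_monomial_le _ _).trans ?_
  change (s - Finsupp.single i 1).sum (fun _ e => e) ≤ _
  have h1 := le_totalDegree hs
  have h2 : (s - Finsupp.single i 1).sum (fun _ e => e) + 1 = s.sum (fun _ e => e) := by
    have : s = (s - Finsupp.single i 1) + Finsupp.single i 1 := by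
      ext j
      by_cases hj : j = i
      · subst hj; simp; omega
      · simp [Ne.symm hj]
    conv_rhs => rw [this, Finsupp.sum_add_index' (by simp) (by simp)]
    simp
  omega
def dd (v : E3) (F : Poly) : Poly := ∑ i, C (v i) * pderiv i F
lemma totalDegree_dd_le (v : E3) (F : Poly) : (dd v F).totalDegree ≤ F.totalDegree - 1 := by
  apply totalDegree_finsetSum_le
  intro i _
  refine (totalDegree_mul _ _).trans ?_
  simpa using totalDegree_pderiv_le i F
lemma dd_mul (v : E3) (F G : Poly) : dd v (F * G) = dd v F * G + F * dd v G := by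
  simp only [dd, pderiv_mul, Finset.sum_mul, Finset.mul_sum, ← Finset.sum_add_distrib]
  refine Finset.sum_congr rfl fun i _ => by ring
lemma dd_add (v : E3) (F G : Poly) : dd v (F + G) = dd v F + dd v G := by
  simp only [dd, map_add, mul_add, Finset.sum_add_distrib]
lemma derivative_restr (a v : E3) (F : Poly) :
    Polynomial.derivative (restr a v F) = restr a v (dd v F) := by
  induction F using MvPolynomial.induction_on with
  | C c => simp [restr, dd]
  | add p q hp hq => simp [map_add, hp, hq, dd_add]
  | mul_X p i hp =>
    rw [map_mul, Polynomial.derivative_mul, hp, dd_mul, map_add, map_mul, map_mul]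
    congr 2
    simp [restr, dd, pderiv_X, Pi.single_apply]
lemma van_dd {a v : E3} {F : Poly} (h : Van F (lin a v)) : Van (dd v F) (lin a v) := by
  rw [van_lin_iff] at *
  rw [← derivative_restr, h, Polynomial.derivative_zero]
def grad (F : Poly) (x : E3) : E3 := fun i => eval x (pderiv i F)
lemma eval_dd (v x : E3) (F : Poly) : eval x (dd v F) = ∑ i, v i * grad F x i := by
  simp [dd, grad]
abbrev PP (e : ℕ) : Submodule ℝ Poly := restrictTotalDegree (Fin 3) ℝ e
lemma finrank_PP (e : ℕ) : Module.finrank ℝ (PP e) = (e + 3).choose 3 := by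
  classical
  have h0 : {s : Fin 3 →₀ ℕ | (s.sum fun _ e => e) ≤ e} =
      ((Finset.range (e + 1)).biUnion fun n => (Finset.univ : Finset (Fin 3)).finsuppAntidiag n :
        Finset (Fin 3 →₀ ℕ)) := by
    ext s
    simp [Finset.mem_finsuppAntidiag, Finsupp.sum_fintype]
  have h1 : Module.finrank ℝ (PP e) = Nat.card {s : Fin 3 →₀ ℕ | (s.sum fun _ e => e) ≤ e} := by
    have := Module.finrank_eq_nat_card_basis
      (basisRestrictSupport ℝ {s : Fin 3 →₀ ℕ | (s.sum fun _ e => e) ≤ e})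
    exact this
  rw [h1, h0, Nat.card_coe_set_eq, Set.ncard_coe_finset, Finset.card_biUnion]
  · simp only [Finset.card_finsuppAntidiag_nat_eq_choose]
    induction e with
    | zero => simp
    | succ e ih =>
      rw [Finset.sum_range_succ, ih]
      · simp only [Finset.card_univ, Fintype.card_fin]
        have e1 : 3 + (e + 1) - 1 = e + 1 + 2 := by omega
        rw [e1, Nat.choose_symm_add, show e + 1 + 3 = (e + 3) + 1 by ring, Nat.choose_succ_succ' (e+3) 2,
          show e + 1 + 2 = e + 3 by ring]
        ring
      · ext s
        simp [Finset.mem_finsuppAntidiag, Finsupp.sum_fintype]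
      · exact Module.finrank_eq_nat_card_basis
          (basisRestrictSupport ℝ {s : Fin 3 →₀ ℕ | (s.sum fun _ e => e) ≤ e})
  · intro i _ j _ hij
    rw [Function.onFun, Finset.disjoint_left]
    intro s hs hs'
    simp [Finset.mem_finsuppAntidiag] at hs hs'
    omega
lemma exists_poly_vanishing (e : ℕ) (T : Finset E3) (h : T.card < (e + 3).choose 3) :
    ∃ F : Poly, F ≠ 0 ∧ F.totalDegree ≤ e ∧ ∀ x ∈ T, eval x F = 0 := by
  let φ : PP e →ₗ[ℝ] (T → ℝ) :=
    { toFun := fun F x => eval x.1 F.1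
      map_add' := fun F G => by ext; simp
      map_smul' := fun c F => by ext; simp [smul_eval] }
  have hlt : Module.finrank ℝ (T → ℝ) < Module.finrank ℝ (PP e) := by
    rw [finrank_PP]; simpa using h
  have := LinearMap.ker_ne_bot_of_finrank_lt (f := φ) hlt
  obtain ⟨F, hF, hne⟩ := (Submodule.ne_bot_iff _).1 this
  refine ⟨F.1, by simpa using hne, (mem_restrictTotalDegree _ _ _).1 F.2, fun x hx => ?_⟩
  exact congrFun (LinearMap.mem_ker.1 hF) ⟨x, hx⟩
end GK
namespace GK
open MvPolynomial
def lp (w a : E3) : Poly := ∑ i, C (w i) * (X i - C (a i))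
lemma eval_lp (w a x : E3) : eval x (lp w a) = w ⬝ᵥ (x - a) := by
  simp [lp, dotProduct]
lemma totalDegree_lp (w a : E3) : (lp w a).totalDegree ≤ 1 := by
  apply totalDegree_finsetSum_le
  intro i _
  refine (totalDegree_mul _ _).trans ?_
  have := totalDegree_sub (X i : Poly) (C (a i))
  simp at this ⊢
  exact this
lemma exists_plane {l m : Set E3} (hl : IsLine l) (hm : IsLine m) (hne : l ≠ m) :
    ∃ F : Poly, F.totalDegree ≤ 1 ∧ Van F m ∧ ¬ Van F l := by
  obtain ⟨y, hy, hym⟩ : ∃ y ∈ l, y ∉ m := by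
    by_contra hcon
    push Not at hcon
    obtain ⟨x, hx⟩ := (line_infinite hl).nonempty
    obtain ⟨y, hy, hxy⟩ := (line_infinite hl).exists_notMem_finset {x}
    exact hne (line_eq_of_two hl hm hx hy (hcon x hx) (hcon y hy) (by rintro rfl; simp at hxy))
  obtain ⟨a, v, hv, rfl⟩ := hm
  set w : E3 := (v ⬝ᵥ v) • (y - a) - ((y - a) ⬝ᵥ v) • v with hw
  have hvv : v ⬝ᵥ v ≠ 0 := by simpa using hv
  have hwv : w ⬝ᵥ v = 0 := by
    simp only [hw, sub_dotProduct, smul_dotProduct, smul_eq_mul]; ring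
  refine ⟨lp w a, totalDegree_lp _ _, ?_, ?_⟩
  · rintro x ⟨t, rfl⟩
    simp [eval_lp, hwv]
  · intro h
    have h1 := h y hy
    rw [eval_lp] at h1
    have h2 : w ⬝ᵥ w = 0 := by
      have : w ⬝ᵥ w = (v ⬝ᵥ v) * (w ⬝ᵥ (y - a)) - ((y - a) ⬝ᵥ v) * (w ⬝ᵥ v) := by
        conv_lhs => rw [hw]
        rw [sub_dotProduct, smul_dotProduct, smul_dotProduct, dotProduct_comm (y - a) (_ - _),
          dotProduct_comm v (_ - _), ← hw]
        simp
      rw [this, h1, hwv]; simp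
    have h3 : w = 0 := by simpa using h2
    apply hym
    refine ⟨(v ⬝ᵥ v)⁻¹ * ((y - a) ⬝ᵥ v), ?_⟩
    have h4 : (v ⬝ᵥ v) • (y - a) = ((y - a) ⬝ᵥ v) • v := sub_eq_zero.1 (hw ▸ h3)
    rw [mul_smul, ← h4, smul_smul, inv_mul_cancel₀ hvv, one_smul]
    abel
def VV (n : ℕ) (Λ : Finset (Set E3)) : Submodule ℝ Poly where
  carrier := {F | F.totalDegree ≤ n ∧ ∀ l ∈ Λ, Van F l}
  zero_mem' := ⟨by simp, fun l _ x _ => by simp⟩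
  add_mem' := by
    rintro F G ⟨h1, h2⟩ ⟨h3, h4⟩
    refine ⟨(totalDegree_add _ _).trans (max_le h1 h3), fun l hl x hx => ?_⟩
    simp [h2 l hl x hx, h4 l hl x hx]
  smul_mem' := by
    rintro c F ⟨h1, h2⟩
    refine ⟨(totalDegree_smul_le _ _).trans h1, fun l hl x hx => ?_⟩
    simp [smul_eval, h2 l hl x hx]
lemma VV_le (n : ℕ) (Λ : Finset (Set E3)) : VV n Λ ≤ PP n :=
  fun _ hF => (mem_restrictTotalDegree _ _ _).2 hF.1
instance (n : ℕ) (Λ : Finset (Set E3)) : Module.Finite ℝ (VV n Λ) :=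
  Submodule.finiteDimensional_of_le (VV_le n Λ)
lemma VV_step (n : ℕ) (Λ : Finset (Set E3)) (hΛ : ∀ l ∈ Λ, IsLine l) (l : Set E3) (hl : IsLine l)
    (hlΛ : l ∉ Λ) [DecidableEq (Set E3)] :
    Module.finrank ℝ (VV n (insert l Λ)) + (n + 1 - Λ.card) ≤ Module.finrank ℝ (VV n Λ) := by
  classical
  choose! f hf using fun m hm => exists_plane hl (hΛ m hm) (by rintro rfl; exact hlΛ hm)
  set A : Poly := ∏ m ∈ Λ, f m with hA
  have hAd : A.totalDegree ≤ Λ.card := by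
    refine (totalDegree_finsetProd _ _).trans ?_
    rw [Finset.card_eq_sum_ones]
    exact Finset.sum_le_sum fun m hm => (hf m hm).1
  have hAl : ¬ Van A l := by
    rw [hA, van_prod hl]
    rintro ⟨m, hm, h⟩
    exact (hf m hm).2.2 h
  have hAV : ∀ m ∈ Λ, Van A m := by
    intro m hm
    rw [hA, van_prod (hΛ m hm)]
    exact ⟨m, hm, (hf m hm).2.1⟩
  obtain ⟨a, v, hv, rfl⟩ := hl
  have hvv : v ⬝ᵥ v ≠ 0 := by simpa using hv
  let ψ : VV n Λ →ₗ[ℝ] Polynomial ℝ := (restr a v).toLinearMap ∘ₗ (VV n Λ).subtype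
  have hrn := LinearMap.finrank_range_add_finrank_ker ψ
  have hker : Module.finrank ℝ (VV n (insert (lin a v) Λ)) ≤ Module.finrank ℝ (LinearMap.ker ψ) := by
    let ι : VV n (insert (lin a v) Λ) →ₗ[ℝ] LinearMap.ker ψ :=
      LinearMap.codRestrict _ (Submodule.inclusion (fun F hF =>
        ⟨hF.1, fun m hm => hF.2 m (Finset.mem_insert_of_mem hm)⟩ :
          VV n (insert (lin a v) Λ) ≤ VV n Λ)) (by
        intro F
        rw [LinearMap.mem_ker]
        exact (van_lin_iff _ _ _).1 (F.2.2 _ (Finset.mem_insert_self _ _)))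
    refine LinearMap.finrank_le_finrank_of_injective (f := ι) ?_
    intro F G h
    have : (ι F).1.1 = (ι G).1.1 := by rw [h]
    exact Subtype.ext this
  have hran : n + 1 - Λ.card ≤ Module.finrank ℝ (LinearMap.range ψ) := by
    rcases le_or_gt (n + 1) Λ.card with hcase | hcase
    · simp [Nat.sub_eq_zero_of_le hcase]
    let u : E3 := (v ⬝ᵥ v)⁻¹ • v
    have hu : u ⬝ᵥ v = 1 := by simp [u, smul_dotProduct, hvv]
    have hrl : restr a v (lp u a) = Polynomial.X := by
      apply Polynomial.funext; intro t
      rw [eval_restr, eval_lp]; simp [hu]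
    let lift : Polynomial.degreeLT ℝ (n + 1 - Λ.card) →ₗ[ℝ] LinearMap.range ψ :=
      { toFun := fun r => ⟨restr a v (A * Polynomial.aeval (lp u a) r.1), by
          refine ⟨⟨A * Polynomial.aeval (lp u a) r.1, ?_, ?_⟩, rfl⟩
          · refine (totalDegree_mul _ _).trans ?_
            have h1 : (Polynomial.aeval (lp u a) r.1).totalDegree ≤ n - Λ.card := by
              rw [Polynomial.aeval_eq_sum_range]
              apply totalDegree_finsetSum_le
              intro i hi
              refine (totalDegree_smul_le _ _).trans ((totalDegree_pow _ _).trans ?_)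
              have h2 := Polynomial.mem_degreeLT.1 r.2
              have h3 : r.1.natDegree < n + 1 - Λ.card := by
                by_cases h0 : r.1 = 0
                · rw [h0]; simp; omega
                · exact (Polynomial.natDegree_lt_iff_degree_lt h0).2 h2
              have h4 := totalDegree_lp u a
              have h5 := Finset.mem_range.1 hi
              calc i * (lp u a).totalDegree ≤ i * 1 := Nat.mul_le_mul_left _ h4
                _ ≤ n - Λ.card := by omega
            omega
          · intro m hm
            rw [van_mul (hΛ m hm)]
            exact Or.inl (hAV m hm)⟩
        map_add' := fun r s => by ext1; simp [mul_add]
        map_smul' := fun c r => by ext1; simp }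
    have hli : Function.Injective lift := by
      intro r s h
      have h1 : restr a v (A * Polynomial.aeval (lp u a) r.1) =
        restr a v (A * Polynomial.aeval (lp u a) s.1) := congrArg Subtype.val h
      have h2 : ∀ r : Polynomial ℝ, restr a v (Polynomial.aeval (lp u a) r) = r := by
        intro r
        rw [← Polynomial.aeval_algHom_apply, hrl, Polynomial.aeval_X_left_apply]
      rw [map_mul, map_mul, h2, h2] at h1
      rw [van_lin_iff] at hAl
      exact Subtype.ext (mul_left_cancel₀ hAl h1)
    have := LinearMap.finrank_le_finrank_of_injective hli
    rwa [LinearEquiv.finrank_eq (Polynomial.degreeLTEquiv ℝ _), Module.finrank_fin_fun] at this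
  omega
lemma VV_bound (n K : ℕ) (Λ : Finset (Set E3)) (hΛ : ∀ l ∈ Λ, IsLine l) (hK : Λ.card ≤ K) :
    Module.finrank ℝ (VV n Λ) + Λ.card * (n + 1 - K) ≤ (n + 3).choose 3 := by
  classical
  induction Λ using Finset.induction_on with
  | empty =>
    rw [← finrank_PP]
    simpa using Submodule.finrank_mono (VV_le n ∅)
  | insert l Λ hl ih =>
    rw [Finset.card_insert_of_notMem hl] at hK ⊢
    have h1 := ih (fun m hm => hΛ m (Finset.mem_insert_of_mem hm)) (by omega)
    have h2 := VV_step n Λ (fun m hm => hΛ m (Finset.mem_insert_of_mem hm)) l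
      (hΛ l (Finset.mem_insert_self _ _)) hl
    have : n + 1 - K ≤ n + 1 - Λ.card := by omega
    rw [add_mul]; linarith
lemma choose3 (n : ℕ) : (((n + 3).choose 3 : ℕ) : ℤ) * 6 = (n + 1) * (n + 2) * (n + 3) := by
  have h := Nat.ascFactorial_eq_factorial_mul_choose n 3
  have h2 : n.succ.ascFactorial 3 = (n + 1) * (n + 2) * (n + 3) := by
    simp [Nat.ascFactorial]; ring
  have h3 : n.succ.ascFactorial 3 = Nat.factorial 3 * (n + 3).choose 3 := by
    simpa using h
  rw [h2] at h3
  simp [Nat.factorial] at h3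
  zify at h3
  linarith
lemma bezout_num (d e s c1 c2 c3 c4 : ℤ) (hd : 0 ≤ d) (he : 0 ≤ e)
    (hs : s = 3 * (d * e + 1) ^ 2 + 10)
    (h1 : c1 * 6 = (d + e + s + 1) * (d + e + s + 2) * (d + e + s + 3))
    (h2 : c2 * 6 = (e + s + 1) * (e + s + 2) * (e + s + 3))
    (h3 : c3 * 6 = (d + s + 1) * (d + s + 2) * (d + s + 3))
    (h4 : c4 * 6 = (s + 1) * (s + 2) * (s + 3))
    (h : c2 + c3 + (d * e + 1) * (d + e + s + 1 - (d * e + 1)) ≤ c1 + c4) : False := by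
  have h7 : (d * e + 1) * (d + e + s - d * e) * 6 ≤
      6 * d * e * (d + e + s + 2) - 3 * d * e * (d + e) := by linarith
  have h8 : (0:ℤ) ≤ d * e * (d + e) := by positivity
  have h9 : (0:ℤ) ≤ d * e := by positivity
  have h10 : 6 * s ≤ 6 * (d * e) ^ 2 + 18 * (d * e) := by linarith
  rw [hs] at h10
  nlinarith
theorem bezout (h g : Poly) (hh : h ≠ 0) (hg : g ≠ 0) (hcop : ∀ c, h ∣ c * g → h ∣ c)
    (Λ : Finset (Set E3)) (hΛ : ∀ l ∈ Λ, IsLine l ∧ Van h l ∧ Van g l) :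
    Λ.card ≤ h.totalDegree * g.totalDegree := by
  classical
  by_contra hcon
  push Not at hcon
  set d := h.totalDegree with hd
  set e := g.totalDegree with he
  obtain ⟨Λ', hsub, hcard⟩ := Finset.exists_subset_card_eq (Nat.succ_le_of_lt hcon)
  set s := 3 * (d * e + 1) ^ 2 + 10 with hs
  set n := d + e + s with hn
  have h1 := VV_bound n (d * e + 1) Λ' (fun l hl => (hΛ l (hsub hl)).1) hcard.le
  let Φ : (PP (e + s) × PP (d + s)) →ₗ[ℝ] VV n Λ' :=
    { toFun := fun p => ⟨p.1.1 * h + p.2.1 * g, by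
        have e1 := (mem_restrictTotalDegree _ _ _).1 p.1.2
        have e2 := (mem_restrictTotalDegree _ _ _).1 p.2.2
        refine ⟨(totalDegree_add _ _).trans (max_le ?_ ?_), ?_⟩
        · refine (totalDegree_mul _ _).trans ?_; omega
        · refine (totalDegree_mul _ _).trans ?_; omega
        · intro l hl x hx
          simp [(hΛ l (hsub hl)).2.1 x hx, (hΛ l (hsub hl)).2.2 x hx]⟩
      map_add' := fun p q => by ext1; simp; ring
      map_smul' := fun c p => by ext1; simp }
  let Ψ : PP s →ₗ[ℝ] (PP (e + s) × PP (d + s)) :=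
    { toFun := fun c => (⟨c.1 * g, by
          have e1 := (mem_restrictTotalDegree _ _ _).1 c.2
          rw [mem_restrictTotalDegree]
          refine (totalDegree_mul _ _).trans ?_; omega⟩, ⟨- (c.1 * h), by
          have e1 := (mem_restrictTotalDegree _ _ _).1 c.2
          rw [mem_restrictTotalDegree, totalDegree_neg]
          refine (totalDegree_mul _ _).trans ?_; omega⟩)
      map_add' := fun p q => by ext1 <;> ext1 <;> simp <;> ring
      map_smul' := fun c p => by ext1 <;> ext1 <;> simp }
  have hker : LinearMap.ker Φ ≤ LinearMap.range Ψ := by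
    intro p hp
    have hp' : p.1.1 * h + p.2.1 * g = 0 := congrArg Subtype.val (LinearMap.mem_ker.1 hp)
    obtain ⟨c, hc⟩ := hcop p.2.1 ⟨-p.1.1, by linear_combination hp'⟩
    have h3 : p.1.1 = -(c * g) := by
      apply mul_right_cancel₀ hh
      rw [hc] at hp'
      linear_combination hp'
    have hcd : c.totalDegree ≤ s := by
      by_cases hc0 : c = 0
      · simp [hc0]
      · have := (mem_restrictTotalDegree _ _ _).1 p.2.2
        rw [hc, totalDegree_mul_of_isDomain hh hc0] at this
        omega
    refine ⟨⟨-c, (mem_restrictTotalDegree _ _ _).2 (by rwa [totalDegree_neg])⟩, ?_⟩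
    ext1 <;> ext1
    · simp [Ψ, h3]
    · simp [Ψ, hc]; ring
  have h2 := LinearMap.finrank_range_add_finrank_ker Φ
  have h3 := (Submodule.finrank_mono hker).trans (LinearMap.finrank_range_le Ψ)
  have h4 := Submodule.finrank_le (LinearMap.range Φ)
  rw [Module.finrank_prod, finrank_PP, finrank_PP] at h2
  rw [finrank_PP] at h3
  rw [hcard] at h1
  have c1 := choose3 n
  have c2 := choose3 (e + s)
  have c3 := choose3 (d + s)
  have c4 := choose3 s
  have h5 : (e + s + 3).choose 3 + (d + s + 3).choose 3 + (d * e + 1) * (n + 1 - (d * e + 1)) ≤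
    (n + 3).choose 3 + (s + 3).choose 3 := by rw [Nat.succ_eq_add_one] at h1; omega
  have h6 : d * e + 1 ≤ n + 1 := by nlinarith
  zify [h6] at h5
  have hsz : (s : ℤ) = 3 * ((d : ℤ) * e + 1) ^ 2 + 10 := by exact_mod_cast hs
  rw [hn] at c1 h5
  push_cast at c1 c2 c3 c4 h5
  exact bezout_num d e s _ _ _ _ (Int.natCast_nonneg _) (Int.natCast_nonneg _) hsz
    c1 c2 c3 c4 h5
lemma bezout_irr (h g : Poly) (hirr : Irreducible h) (hnd : ¬ h ∣ g)
    (Λ : Finset (Set E3)) (hΛ : ∀ l ∈ Λ, IsLine l ∧ Van h l ∧ Van g l) :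
    Λ.card ≤ h.totalDegree * g.totalDegree := by
  refine bezout h g hirr.ne_zero (by rintro rfl; simp at hnd) (fun c hc => ?_) Λ hΛ
  exact (hirr.prime.dvd_or_dvd hc).resolve_right hnd
end GK
namespace GK
open MvPolynomial
lemma sum_rank {α : Type*} [DecidableEq α] (S : Finset α) (key : α → ℕ) (hk : Function.Injective key)
    (f : ℕ → ℕ) : ∑ m ∈ S, f (S.filter (fun s => key s < key m)).card = ∑ j ∈ Finset.range S.card, f j := by
  have hinj : Set.InjOn (fun m => (S.filter (fun s => key s < key m)).card) S := by
    have hlt : ∀ a ∈ S, ∀ b ∈ S, key a < key b → (S.filter (fun s => key s < key a)).card <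
        (S.filter (fun s => key s < key b)).card := by
      intro a ha b hb hab
      apply Finset.card_lt_card
      rw [Finset.ssubset_iff_of_subset]
      · exact ⟨a, by simp [ha, hab], by simp⟩
      · intro s hs
        simp at hs ⊢
        exact ⟨hs.1, hs.2.trans hab⟩
    intro a ha b hb hab
    simp only at hab
    rcases lt_trichotomy (key a) (key b) with h | h | h
    · have := hlt a ha b hb h; omega
    · exact hk h
    · have := hlt b hb a ha h; omega
  have himg : S.image (fun m => (S.filter (fun s => key s < key m)).card) = Finset.range S.card := by
    apply Finset.eq_of_subset_of_card_le
    · intro j hj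
      obtain ⟨m, hm, rfl⟩ := Finset.mem_image.1 hj
      rw [Finset.mem_range]
      apply Finset.card_lt_card
      rw [Finset.ssubset_iff_of_subset (Finset.filter_subset _ _)]
      exact ⟨m, hm, by simp⟩
    · rw [Finset.card_image_of_injOn hinj, Finset.card_range]
  rw [← himg, Finset.sum_image hinj]
lemma sum_cost (e n : ℕ) : 2 * ∑ j ∈ Finset.range n, (e + 1 - j) ≤ (e + 1) * (e + 2) := by
  have h1 : ∑ j ∈ Finset.range n, (e + 1 - j) ≤ ∑ j ∈ Finset.range (e + 1), (e + 1 - j) := by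
    rcases le_total n (e + 1) with h | h
    · exact Finset.sum_le_sum_of_subset (Finset.range_subset_range.2 h)
    · apply le_of_eq
      symm
      apply Finset.sum_subset (Finset.range_subset_range.2 h)
      intro j _ hj
      simp at hj; omega
  have h2 : ∀ k : ℕ, 2 * ∑ j ∈ Finset.range k, (k - j) = k * (k + 1) := by
    intro k
    induction k with
    | zero => simp
    | succ k ih =>
      rw [Finset.sum_range_succ', Nat.mul_add]
      simp only [Nat.add_sub_add_right]
      rw [ih]; simp; ring
  calc _ ≤ _ := Nat.mul_le_mul_left 2 h1
    _ = _ := h2 (e + 1)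
lemma order_avg {α : Type*} [Fintype α] [DecidableEq α] (S : α → Finset α) (hS : ∀ a, a ∈ S a)
    (M : ℕ) (hc : ∀ a, (S a).card = M + 1) (e : ℕ) :
    ∃ key : α → ℕ, Function.Injective key ∧
      (∑ a, (e + 1 - ((S a).filter (fun s => key s < key a)).card)) * (2 * (M + 1)) ≤
        Fintype.card α * ((e + 1) * (e + 2)) := by
  let e0 := Fintype.equivFin α
  let K : Equiv.Perm α → α → ℕ := fun π a => (e0 (π a)).1
  have hK : ∀ π, Function.Injective (K π) := fun π a b h => by
    simpa [K, Fin.val_inj] using h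
  let f : ℕ → ℕ := fun j => e + 1 - j
  let rk : Equiv.Perm α → α → α → ℕ := fun π a m => ((S a).filter (fun s => K π s < K π m)).card
  have hswap : ∀ a, ∀ m ∈ S a, ∑ π, f (rk π a m) = ∑ π, f (rk π a a) := by
    intro a m hm
    apply Fintype.sum_equiv (Equiv.mulRight (Equiv.swap a m))
    intro π
    congr 1
    have : ((S a).filter (fun s => K π s < K π m)).map (Equiv.swap a m).toEmbedding =
        (S a).filter (fun s => K (π * Equiv.swap a m) s < K (π * Equiv.swap a m) a) := by
      ext s
      simp only [Finset.mem_map_equiv, Finset.mem_filter, Equiv.symm_swap, K, Equiv.Perm.mul_apply,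
        Equiv.swap_apply_left]
      have : Equiv.swap a m s ∈ S a ↔ s ∈ S a := by
        rw [Equiv.swap_apply_def]
        split_ifs with h1 h2
        · simp [h1, hm, hS a]
        · simp [h2, hm, hS a]
        · rfl
      rw [this]
    simp only [rk, Equiv.coe_mulRight]
    rw [← this, Finset.card_map]
  have hone : ∀ a, 2 * ((M + 1) * ∑ π, f (rk π a a)) ≤ (Fintype.card (Equiv.Perm α)) * ((e + 1) * (e + 2)) := by
    intro a
    have : (M + 1) * ∑ π, f (rk π a a) = ∑ π, ∑ m ∈ S a, f (rk π a m) := by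
      rw [Finset.sum_comm, Finset.sum_congr rfl (hswap a), Finset.sum_const, hc, smul_eq_mul]
    rw [this]
    simp only [rk, fun π => sum_rank (S a) (K π) (hK π) f]
    rw [Finset.sum_const, Finset.card_univ, smul_eq_mul]
    have := sum_cost e (S a).card
    calc _ = Fintype.card (Equiv.Perm α) * (2 * ∑ j ∈ Finset.range (S a).card, f j) := by ring
      _ ≤ _ := Nat.mul_le_mul_left _ this
  have htot : ∑ π : Equiv.Perm α, (∑ a, f (rk π a a)) * (2 * (M + 1)) ≤
      ∑ _π : Equiv.Perm α, Fintype.card α * ((e + 1) * (e + 2)) := by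
    rw [← Finset.sum_mul, Finset.sum_comm, Finset.sum_mul, Finset.sum_const, Finset.card_univ, smul_eq_mul]
    calc _ ≤ ∑ _a : α, (Fintype.card (Equiv.Perm α)) * ((e + 1) * (e + 2)) :=
          Finset.sum_le_sum fun a _ => by linarith [hone a]
      _ = _ := by rw [Finset.sum_const, Finset.card_univ, smul_eq_mul]; ring
  obtain ⟨π, -, hπ⟩ := Finset.exists_le_of_sum_le Finset.univ_nonempty htot
  exact ⟨K π, hK π, hπ⟩
theorem degree_reduction (Λ : Finset (Set E3)) (hΛ : ∀ l ∈ Λ, IsLine l) (M e : ℕ)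
    (hM : ∀ l ∈ Λ, ∃ T : Finset E3, T.card = M ∧ ∀ x ∈ T, x ∈ l ∧ ∃ m ∈ Λ, m ≠ l ∧ x ∈ m)
    (he : 3 * Λ.card < (M + 1) * (e + 3)) :
    ∃ F : Poly, F ≠ 0 ∧ F.totalDegree ≤ e ∧ ∀ l ∈ Λ, Van F l := by
  classical
  choose! T hTc hT using hM
  choose! q hq using fun l hl x hx => (hT l hl x hx).2
  have hqinj : ∀ l ∈ Λ, Set.InjOn (q l) (T l) := by
    intro l hl x hx y hy hxy
    by_contra hne
    have h1 := hq l hl x hx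
    have h2 := hq l hl y hy
    exact h1.2.1 (line_eq_of_two (hΛ _ h1.1) (hΛ l hl) h1.2.2 (hxy ▸ h2.2.2) (hT l hl x hx).1
      (hT l hl y hy).1 hne)
  let S : Λ → Finset Λ := fun l => insert l ((T l.1).attach.image
    fun x => ⟨q l.1 x.1, (hq l.1 l.2 x.1 x.2).1⟩)
  have hSc : ∀ l, (S l).card = M + 1 := by
    intro l
    rw [Finset.card_insert_of_notMem, Finset.card_image_of_injOn, Finset.card_attach, hTc l.1 l.2]
    · intro x _ y _ hxy
      simp only [Subtype.mk.injEq] at hxy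
      exact Subtype.ext (hqinj l.1 l.2 x.2 y.2 hxy)
    · intro h
      obtain ⟨x, -, hx⟩ := Finset.mem_image.1 h
      exact (hq l.1 l.2 x.1 x.2).2.1 (congrArg Subtype.val hx)
  obtain ⟨key, hkey, hsum⟩ := order_avg S (fun l => Finset.mem_insert_self _ _) M hSc e
  set cost : Λ → ℕ := fun a => e + 1 - ((S a).filter (fun s => key s < key a)).card with hcost
  have hU : ∀ l : Λ, ∃ U : Finset E3, (∀ x ∈ U, x ∈ l.1) ∧ U.card = cost l ∧ Disjoint U (T l.1) := by
    intro l
    have hinf : (l.1 \ (T l.1 : Set E3)).Infinite :=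
      (line_infinite (hΛ l.1 l.2)).sdiff (T l.1).finite_toSet
    obtain ⟨U, hU, hUc⟩ := hinf.exists_subset_card_eq (cost l)
    refine ⟨U, fun x hx => (hU hx).1, hUc, ?_⟩
    rw [Finset.disjoint_left]
    intro x hx hx'
    exact (hU hx).2 hx'
  choose U hUl hUc hUd using hU
  have hcardU : (Finset.univ.biUnion U).card < (e + 3).choose 3 := by
    have h1 : (Finset.univ.biUnion U).card ≤ ∑ l, cost l :=
      Finset.card_biUnion_le.trans (Finset.sum_le_sum fun l _ => (hUc l).le)
    have h2 := choose3 e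
    norm_cast at h2
    have h3 : Fintype.card Λ = Λ.card := Fintype.card_coe Λ
    rw [h3] at hsum
    by_contra hcon
    push Not at hcon
    have h4 := (hcon.trans h1)
    have h5 : (e + 3).choose 3 * (2 * (M + 1)) ≤ Λ.card * ((e + 1) * (e + 2)) :=
      (Nat.mul_le_mul_right _ h4).trans hsum
    have h6 : (M + 1) * (e + 3) * ((e + 1) * (e + 2)) ≤ 3 * Λ.card * ((e + 1) * (e + 2)) := by
      calc (M + 1) * (e + 3) * ((e + 1) * (e + 2)) = (M + 1) * ((e + 3).choose 3 * 6) := by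
            rw [h2]; ring
        _ = 3 * ((e + 3).choose 3 * (2 * (M + 1))) := by ring
        _ ≤ _ := by linarith
    have h7 := Nat.le_of_mul_le_mul_right h6 (by positivity)
    omega
  obtain ⟨F, hF0, hFd, hF⟩ := exists_poly_vanishing e _ hcardU
  refine ⟨F, hF0, hFd, ?_⟩
  have main : ∀ n, ∀ l : Λ, key l = n → Van F l.1 := by
    intro n
    induction n using Nat.strong_induction_on with
    | _ n ih =>
      intro l hl
      let T' : Finset E3 := (T l.1).filter (fun x => ∃ m : Λ, m.1 = q l.1 x ∧ key m < key l)
      have hT'c : ((S l).filter (fun s => key s < key l)).card ≤ T'.card := by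
        have : ((S l).filter (fun s => key s < key l)).image Subtype.val ⊆ T'.image (q l.1) := by
          intro m hm
          obtain ⟨s, hs, rfl⟩ := Finset.mem_image.1 hm
          obtain ⟨hs1, hs2⟩ := Finset.mem_filter.1 hs
          rcases Finset.mem_insert.1 hs1 with rfl | h
          · omega
          · obtain ⟨x, -, hx⟩ := Finset.mem_image.1 h
            refine Finset.mem_image.2 ⟨x.1, Finset.mem_filter.2 ⟨x.2, s, ?_, hs2⟩, ?_⟩
            · rw [← hx]
            · rw [← hx]
        have h2 := Finset.card_le_card this
        rw [Finset.card_image_of_injective _ Subtype.val_injective] at h2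
        exact h2.trans Finset.card_image_le
      apply van_of_points (hΛ l.1 l.2) F (U l ∪ T')
      · intro x hx
        rcases Finset.mem_union.1 hx with h | h
        · exact ⟨hUl l x h, hF x (Finset.mem_biUnion.2 ⟨l, Finset.mem_univ _, h⟩)⟩
        · obtain ⟨h1, m, hm, hmk⟩ := Finset.mem_filter.1 h
          refine ⟨(hT l.1 l.2 x h1).1, ih (key m) (hl ▸ hmk) m rfl x ?_⟩
          rw [hm]
          exact (hq l.1 l.2 x h1).2.2
      · rw [Finset.card_union_of_disjoint, hUc]
        · simp only [hcost]; omega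
        · exact (hUd l).mono_right (Finset.filter_subset _ _)
  exact fun l hl => main _ ⟨l, hl⟩ rfl
end GK
namespace GK
open MvPolynomial
open scoped Matrix
lemma pderiv_comm' (i j : Fin 3) (F : Poly) : pderiv i (pderiv j F) = pderiv j (pderiv i F) := by
  have h : ⁅pderiv (R := ℝ) i, pderiv (R := ℝ) j⁆ = 0 := by
    apply MvPolynomial.derivation_ext
    intro k
    rw [Derivation.commutator_apply]
    simp only [pderiv_X, Pi.single_apply, Derivation.coe_zero, Pi.zero_apply]
    split_ifs <;> simp
  have := congrArg (fun D => D F) h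
  simp only [Derivation.commutator_apply, Derivation.coe_zero, Pi.zero_apply] at this
  exact sub_eq_zero.1 this
lemma dd_C_mul (v : E3) (r : ℝ) (F : Poly) : dd v (C r * F) = C r * dd v F := by
  rw [dd_mul]; simp [dd]
lemma dd_sum (v : E3) {ι : Type*} (s : Finset ι) (f : ι → Poly) :
    dd v (∑ i ∈ s, f i) = ∑ i ∈ s, dd v (f i) := by
  simp only [dd, map_sum, Finset.mul_sum]
  exact Finset.sum_comm
lemma dd_pderiv (v : E3) (j : Fin 3) (F : Poly) : dd v (pderiv j F) = pderiv j (dd v F) := by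
  simp only [dd, map_sum, pderiv_C_mul, pderiv_comm' _ j]
lemma dd_comm (v w : E3) (F : Poly) : dd v (dd w F) = dd w (dd v F) := by
  conv_lhs => rw [dd.eq_def w F]
  conv_rhs => rw [dd.eq_def w]
  rw [dd_sum]
  simp only [dd_C_mul, dd_pderiv]
lemma dd_lin (α β γ : ℝ) (a b c : E3) (F : Poly) :
    dd (α • a + β • b + γ • c) F = C α * dd a F + C β * dd b F + C γ * dd c F := by
  simp only [dd, Finset.mul_sum, ← Finset.sum_add_distrib]
  refine Finset.sum_congr rfl fun i _ => ?_
  simp; ring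
lemma lin_shift {a u x : E3} (hx : x ∈ lin a u) : lin a u = lin x u := by
  obtain ⟨s, rfl⟩ := hx
  ext z; constructor
  · rintro ⟨t, rfl⟩; exact ⟨t - s, by ext i; simp; ring⟩
  · rintro ⟨t, rfl⟩; exact ⟨s + t, by ext i; simp; ring⟩
lemma cross_zero {u v : E3} (hu : u ≠ 0) (h : u ⨯₃ v = 0) : ∃ s : ℝ, v = s • u := by
  have h0 := congrFun h 0
  have h1 := congrFun h 1
  have h2 := congrFun h 2
  simp [cross_apply] at h0 h1 h2
  obtain ⟨k, hk⟩ := Function.ne_iff.1 hu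
  simp only [Pi.zero_apply] at hk
  refine ⟨v k / u k, ?_⟩
  ext i
  simp only [Pi.smul_apply, smul_eq_mul]
  rw [div_mul_eq_mul_div, eq_div_iff hk]
  fin_cases k <;> fin_cases i <;> simp <;> linarith
lemma lin_smul {x u : E3} {s : ℝ} (hs : s ≠ 0) : lin x (s • u) = lin x u := by
  ext z; constructor
  · rintro ⟨t, rfl⟩; exact ⟨t * s, by rw [mul_smul]⟩
  · rintro ⟨t, rfl⟩; exact ⟨t / s, by rw [smul_smul, div_mul_cancel₀ _ hs]⟩
lemma cross_ne_of_lines {x u v : E3} (hu : u ≠ 0) (hv : v ≠ 0) (h : lin x u ≠ lin x v) :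
    u ⨯₃ v ≠ 0 := by
  intro hc
  obtain ⟨s, rfl⟩ := cross_zero hu hc
  apply h
  rw [lin_smul]
  rintro rfl; simp at hv
lemma dot3 (u v : E3) : u ⬝ᵥ v = u 0 * v 0 + u 1 * v 1 + u 2 * v 2 := by
  simp [dotProduct, Fin.sum_univ_three]
lemma parallel_of_orth {u v n m : E3} (huv : u ⨯₃ v ≠ 0) (h1 : u ⬝ᵥ n = 0) (h2 : v ⬝ᵥ n = 0)
    (h3 : u ⬝ᵥ m = 0) (h4 : v ⬝ᵥ m = 0) (i j : Fin 3) : m i * n j - m j * n i = 0 := by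
  have key : ∀ p : E3, u ⬝ᵥ p = 0 → v ⬝ᵥ p = 0 → ∃ s : ℝ, p = s • (u ⨯₃ v) := by
    intro p hp hq
    apply cross_zero huv
    rw [dot3] at hp hq
    ext i
    fin_cases i <;> simp [cross_apply]
    · linear_combination v 0 * hp - u 0 * hq
    · linear_combination v 1 * hp - u 1 * hq
    · linear_combination v 2 * hp - u 2 * hq
  obtain ⟨s, hs⟩ := key n h1 h2
  obtain ⟨t, ht⟩ := key m h3 h4
  rw [hs, ht]; simp; ring
lemma span_of_orth {u v n w : E3} (huv : u ⨯₃ v ≠ 0) (hn : n ≠ 0) (h1 : u ⬝ᵥ n = 0)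
    (h2 : v ⬝ᵥ n = 0) (hw : w ⬝ᵥ n = 0) : ∃ α β : ℝ, w = α • u + β • v := by
  have hc : ∀ i j, n i * (u ⨯₃ v) j - n j * (u ⨯₃ v) i = 0 :=
    fun i j => parallel_of_orth (n := u ⨯₃ v) (m := n) huv (dot_self_cross u v) (dot_cross_self u v) h1 h2 i j
  obtain ⟨k, hk⟩ := Function.ne_iff.1 hn
  simp only [Pi.zero_apply] at hk
  set N := u ⨯₃ v with hN
  have hwN : w ⬝ᵥ N = 0 := by
    have : n k * (w ⬝ᵥ N) = 0 := by
      rw [dot3] at hw ⊢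
      have := hc k 0; have := hc k 1; have := hc k 2
      linear_combination N k * hw + w 0 * hc k 0 + w 1 * hc k 1 + w 2 * hc k 2
    exact (mul_eq_zero.1 this).resolve_left hk
  have hNN : N ⬝ᵥ N ≠ 0 := by simpa using huv
  refine ⟨((w ⨯₃ v) ⬝ᵥ N) / (N ⬝ᵥ N), ((u ⨯₃ w) ⬝ᵥ N) / (N ⬝ᵥ N), ?_⟩
  ext i
  simp only [Pi.add_apply, Pi.smul_apply, smul_eq_mul]
  rw [div_mul_eq_mul_div, div_mul_eq_mul_div, ← add_div, eq_div_iff hNN]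
  have h5 : w i * (N ⬝ᵥ N) = ((w ⨯₃ v) ⬝ᵥ N) * u i + ((u ⨯₃ w) ⬝ᵥ N) * v i + (w ⬝ᵥ N) * N i := by
    rw [hN]
    simp only [dot3, cross_apply]
    fin_cases i <;> simp <;> ring
  rw [h5, hwN]; ring
lemma eval_dd' (v x : E3) (F : Poly) : eval x (dd v F) = v ⬝ᵥ grad F x := by
  rw [eval_dd]; rfl
lemma wronsk {P N : Polynomial ℝ} {t : ℝ} (hN : N.eval t ≠ 0) (hP : P.eval t = 0)
    (h : Polynomial.derivative P * N = P * Polynomial.derivative N) : P = 0 := by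
  by_contra hne
  have hroot : P.IsRoot t := hP
  have h1 := Polynomial.derivative_rootMultiplicity_of_root hroot
  have hpos : 0 < P.rootMultiplicity t := (Polynomial.rootMultiplicity_pos hne).2 hroot
  have hd : Polynomial.derivative P ≠ 0 := by
    intro h0
    have := Polynomial.derivative_eq_zero.1 h0
    obtain ⟨c, rfl⟩ := Polynomial.natDegree_eq_zero.1 this
    simp at hP; simp [hP] at hne
  have hN0 : N ≠ 0 := by rintro rfl; simp at hN
  have hl : (Polynomial.derivative P * N).rootMultiplicity t = P.rootMultiplicity t - 1 := by
    rw [Polynomial.rootMultiplicity_mul (mul_ne_zero hd hN0), h1,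
      Polynomial.rootMultiplicity_eq_zero (p := N) (by simpa using hN), add_zero]
  have hr : P.rootMultiplicity t ≤ (P * Polynomial.derivative N).rootMultiplicity t := by
    rw [Polynomial.le_rootMultiplicity_iff (h ▸ mul_ne_zero hd hN0)]
    exact (Polynomial.pow_rootMultiplicity_dvd P t).mul_right _
  rw [← h, hl] at hr
  omega
lemma flat_line {f : Poly} {a u : E3} (hu : u ≠ 0) (T : Finset E3) (hTc : 2 * f.totalDegree < T.card)
    (hT : ∀ x ∈ T, x ∈ lin a u ∧ grad f x ≠ 0 ∧ ∃ v, u ⨯₃ v ≠ 0 ∧ eval x (dd u f) = 0 ∧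
      eval x (dd v f) = 0 ∧ eval x (dd u (dd u f)) = 0 ∧ eval x (dd v (dd u f)) = 0) :
    ∃ n0 : E3, n0 ≠ 0 ∧ ∀ y ∈ lin a u, ∃ s : ℝ, grad f y = s • n0 := by
  have hW : ∀ i j, Van (dd u (pderiv i f) * pderiv j f - dd u (pderiv j f) * pderiv i f) (lin a u) := by
    intro i j
    apply van_of_points (isLine_lin hu) _ T
    · intro x hx
      obtain ⟨h1, h2, v, h3, h4, h5, h6, h7⟩ := hT x hx
      refine ⟨h1, ?_⟩
      rw [eval_dd'] at h4 h5 h6 h7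
      have := parallel_of_orth h3 h4 h5 h6 h7 i j
      simp only [map_sub, map_mul, dd_pderiv]
      exact this
    · refine lt_of_le_of_lt ?_ hTc
      refine (totalDegree_sub _ _).trans (max_le ?_ ?_)
      all_goals
        refine (totalDegree_mul _ _).trans ?_
        have h1 := totalDegree_pderiv_le i f
        have h2 := totalDegree_pderiv_le j f
        have h3 := totalDegree_dd_le u (pderiv i f)
        have h4 := totalDegree_dd_le u (pderiv j f)
        omega
  obtain ⟨x, hx⟩ : T.Nonempty := Finset.card_pos.1 (by omega)
  obtain ⟨⟨t0, ht0⟩, hg, -⟩ := hT x hx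
  refine ⟨grad f x, hg, ?_⟩
  obtain ⟨j, hj⟩ := Function.ne_iff.1 hg
  simp only [Pi.zero_apply] at hj
  rintro y ⟨t, rfl⟩
  let N : Fin 3 → Polynomial ℝ := fun i => restr a u (pderiv i f)
  have hNe : ∀ i t, (N i).eval t = grad f (a + t • u) i := fun i t => eval_restr _ _ _ _
  have hkey : ∀ i, Polynomial.C ((N j).eval t0) * N i - Polynomial.C ((N i).eval t0) * N j = 0 := by
    intro i
    apply wronsk (t := t0) (N := N j)
    · rw [hNe, ← ht0]; exact hj
    · simp; ring
    · have := (van_lin_iff _ _ _).1 (hW i j)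
      simp only [map_sub, map_mul, ← derivative_restr] at this
      simp only [Polynomial.derivative_sub, Polynomial.derivative_C_mul]
      linear_combination Polynomial.C ((N j).eval t0) * this
  refine ⟨(N j).eval t / (N j).eval t0, ?_⟩
  have hj' : (N j).eval t0 ≠ 0 := by rw [hNe, ← ht0]; exact hj
  ext i
  have h1 := congrArg (Polynomial.eval t) (hkey i)
  simp only [Polynomial.eval_sub, Polynomial.eval_mul, Polynomial.eval_C, Polynomial.eval_zero] at h1
  rw [← hNe]
  simp only [Pi.smul_apply, smul_eq_mul]
  rw [ht0, ← hNe i t0]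
  field_simp
  linarith
lemma lp_irreducible {n a : E3} (hn : n ≠ 0) : (lp n a).totalDegree = 1 ∧ Irreducible (lp n a) := by
  have hd : (lp n a).totalDegree = 1 := by
    refine le_antisymm (totalDegree_lp _ _) (Nat.one_le_iff_ne_zero.2 fun h0 => ?_)
    have h1 := totalDegree_eq_zero_iff_eq_C.1 h0
    have h2 := eval_lp n a a
    have h3 := eval_lp n a (a + n)
    rw [h1] at h2 h3
    simp at h2 h3
    rw [h2] at h3
    exact hn (by simpa using h3.symm)
  refine ⟨hd, ?_⟩
  have h0 : lp n a ≠ 0 := by intro h; rw [h] at hd; simp at hd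
  have hunit : ∀ p : Poly, p ≠ 0 → p.totalDegree = 0 → IsUnit p := by
    intro p hp h
    rw [totalDegree_eq_zero_iff_eq_C.1 h] at hp ⊢
    exact (isUnit_iff_ne_zero.2 (by rintro h; simp [h] at hp)).map C
  refine ⟨fun hu => ?_, fun p q hpq => ?_⟩
  · obtain ⟨v, hv⟩ := hu.exists_right_inv
    have := congrArg totalDegree hv
    rw [totalDegree_mul_of_isDomain h0 (by rintro rfl; simp at hv), hd] at this
    simp at this
  · have hp : p ≠ 0 := by rintro rfl; simp at hpq; exact h0 hpq
    have hq : q ≠ 0 := by rintro rfl; simp at hpq; exact h0 hpq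
    have := congrArg totalDegree hpq
    rw [totalDegree_mul_of_isDomain hp hq, hd] at this
    rcases Nat.eq_zero_or_pos p.totalDegree with h | h
    · exact Or.inl (hunit p hp h)
    · exact Or.inr (hunit q hq (by omega))
lemma plane_dvd {f : Poly} {n a : E3} (hn : n ≠ 0) (Λ : Finset (Set E3))
    (hΛ : ∀ l ∈ Λ, IsLine l ∧ Van f l ∧ ∀ x ∈ l, n ⬝ᵥ (x - a) = 0) (hc : f.totalDegree < Λ.card) :
    lp n a ∣ f := by
  by_contra h
  have := bezout_irr (lp n a) f (lp_irreducible hn).2 h Λ (fun l hl =>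
    ⟨(hΛ l hl).1, fun x hx => by rw [eval_lp]; exact (hΛ l hl).2.2 x hx, (hΛ l hl).2.1⟩)
  rw [(lp_irreducible hn).1] at this
  omega
lemma exists_pderiv_ne {f : Poly} (h : f.totalDegree ≠ 0) : ∃ i, pderiv i f ≠ 0 := by
  by_contra hcon
  push Not at hcon
  apply h
  have : f = C (eval 0 f) := by
    apply MvPolynomial.funext
    intro x
    have h1 : Polynomial.derivative (restr 0 x f) = 0 := by
      rw [derivative_restr]; simp [dd, hcon]
    obtain ⟨c, hc⟩ := Polynomial.natDegree_eq_zero.1 (Polynomial.derivative_eq_zero.1 h1)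
    have h2 := eval_restr 0 x f 1
    have h3 := eval_restr 0 x f 0
    rw [← hc] at h2 h3
    simp at h2 h3
    rw [← h2, h3]; simp
  rw [this]; simp
lemma not_dvd_of_deg_lt {h g : Poly} (hg : g ≠ 0) (hd : g.totalDegree < h.totalDegree) : ¬ h ∣ g := by
  rintro ⟨c, rfl⟩
  rw [totalDegree_mul_of_isDomain (left_ne_zero_of_mul hg) (right_ne_zero_of_mul hg)] at hd
  omega
end GK
namespace GK
open MvPolynomial
open scoped Matrix
structure Jet (R : Type) where
  (n1 n2 n3 aa ab ac bb bc cc aaa aab aac abb abc acc bbb bbc bcc ccc : R)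
namespace Jet
variable {R S : Type} [CommRing R] [CommRing S] (j : Jet R)
def map (f : R →+* S) : Jet S :=
  ⟨f j.n1, f j.n2, f j.n3, f j.aa, f j.ab, f j.ac, f j.bb, f j.bc, f j.cc, f j.aaa, f j.aab, f j.aac,
    f j.abb, f j.abc, f j.acc, f j.bbb, f j.bbc, f j.bcc, f j.ccc⟩
def A : R := j.n3 * j.n3 * j.aa - (j.n1 * j.n3 * j.ac + j.n1 * j.n3 * j.ac) + j.n1 * j.n1 * j.cc
def B : R := j.n3 * j.n3 * j.ab - j.n3 * j.n2 * j.ac - j.n1 * j.n3 * j.bc + j.n1 * j.n2 * j.cc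
def Cq : R := j.n3 * j.n3 * j.bb - (j.n2 * j.n3 * j.bc + j.n2 * j.n3 * j.bc) + j.n2 * j.n2 * j.cc
def k0 : R := j.n3 * j.n3 * j.n3 * j.aaa - (j.n3 * j.n3 * j.n1 * j.aac + j.n3 * j.n3 * j.n1 * j.aac
  + j.n3 * j.n3 * j.n1 * j.aac) + (j.n3 * j.n1 * j.n1 * j.acc + j.n3 * j.n1 * j.n1 * j.acc
  + j.n3 * j.n1 * j.n1 * j.acc) - j.n1 * j.n1 * j.n1 * j.ccc
def t1 : R := j.n3 * j.n3 * j.n3 * j.aab - j.n3 * j.n3 * j.n2 * j.aac - (j.n3 * j.n3 * j.n1 * j.abc +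
  j.n3 * j.n3 * j.n1 * j.abc) + (j.n3 * j.n1 * j.n2 * j.acc + j.n3 * j.n1 * j.n2 * j.acc)
  + j.n3 * j.n1 * j.n1 * j.bcc - j.n1 * j.n1 * j.n2 * j.ccc
def t2 : R := j.n3 * j.n3 * j.n3 * j.abb - j.n3 * j.n3 * j.n1 * j.bbc - (j.n3 * j.n3 * j.n2 * j.abc +
  j.n3 * j.n3 * j.n2 * j.abc) + (j.n3 * j.n1 * j.n2 * j.bcc + j.n3 * j.n1 * j.n2 * j.bcc)
  + j.n3 * j.n2 * j.n2 * j.acc - j.n1 * j.n2 * j.n2 * j.ccc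
def k1 : R := j.t1 + j.t1 + j.t1
def k2 : R := j.t2 + j.t2 + j.t2
def k3 : R := j.n3 * j.n3 * j.n3 * j.bbb - (j.n3 * j.n3 * j.n2 * j.bbc + j.n3 * j.n3 * j.n2 * j.bbc
  + j.n3 * j.n3 * j.n2 * j.bbc) + (j.n3 * j.n2 * j.n2 * j.bcc + j.n3 * j.n2 * j.n2 * j.bcc
  + j.n3 * j.n2 * j.n2 * j.bcc) - j.n2 * j.n2 * j.n2 * j.ccc
def r1 : R := j.A * j.A * j.k2 - j.A * j.Cq * j.k0 - (j.A * j.B * j.k1 + j.A * j.B * j.k1) +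
  (j.B * j.B * j.k0 + j.B * j.B * j.k0 + j.B * j.B * j.k0 + j.B * j.B * j.k0)
def r0 : R := j.A * j.A * j.k3 - j.A * j.Cq * j.k1 + (j.B * j.Cq * j.k0 + j.B * j.Cq * j.k0)
def D1 (α β γ : R) : R := α * j.n1 + β * j.n2 + γ * j.n3
def D2 (α β γ : R) : R := α ^ 2 * j.aa + β ^ 2 * j.bb + γ ^ 2 * j.cc + 2 * α * β * j.ab
  + 2 * α * γ * j.ac + 2 * β * γ * j.bc
def D3 (α β γ : R) : R := α ^ 3 * j.aaa + β ^ 3 * j.bbb + γ ^ 3 * j.ccc + 3 * α ^ 2 * β * j.aab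
  + 3 * α ^ 2 * γ * j.aac + 3 * α * β ^ 2 * j.abb + 3 * α * γ ^ 2 * j.acc + 3 * β ^ 2 * γ * j.bbc
  + 3 * β * γ ^ 2 * j.bcc + 6 * α * β * γ * j.abc
def Q (α β : R) : R := j.A * α ^ 2 + 2 * j.B * α * β + j.Cq * β ^ 2
def K (α β : R) : R := j.k0 * α ^ 3 + j.k1 * α ^ 2 * β + j.k2 * α * β ^ 2 + j.k3 * β ^ 3
def S2 (α β γ : R) : R := j.cc * (j.n3 * γ - α * j.n1 - β * j.n2) + 2 * α * j.ac * j.n3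
  + 2 * β * j.bc * j.n3
def S3 (α β γ : R) : R := j.ccc * ((j.n3 * γ) ^ 2 - j.n3 * γ * (α * j.n1 + β * j.n2) +
    (α * j.n1 + β * j.n2) ^ 2) + 3 * α ^ 2 * j.aac * j.n3 ^ 2 + 3 * β ^ 2 * j.bbc * j.n3 ^ 2
    + 6 * α * β * j.abc * j.n3 ^ 2
    + (3 * α * j.acc + 3 * β * j.bcc) * j.n3 * (j.n3 * γ - (α * j.n1 + β * j.n2))
def L (α β : R) : R := j.A * j.k0 * α + (j.A * j.k1 - 2 * j.B * j.k0) * β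
lemma Q_eq (α β γ : R) : j.n3 ^ 2 * j.D2 α β γ = j.Q α β + j.D1 α β γ * j.S2 α β γ := by
  simp only [D2, Q, D1, S2, A, B, Cq]; ring
lemma K_eq (α β γ : R) : j.n3 ^ 3 * j.D3 α β γ = j.K α β + j.D1 α β γ * j.S3 α β γ := by
  simp only [D3, K, D1, S3, k0, k1, k2, k3, t1, t2]; ring
lemma rem_eq (α β : R) : j.A ^ 2 * j.K α β = j.Q α β * j.L α β + β ^ 2 * (j.r1 * α + j.r0 * β) := by
  simp only [K, Q, L, r1, r0]; ring
lemma main_eq (α β γ : R) : (j.A ^ 2 * j.n3 ^ 3) * j.D3 α β γ = j.n3 ^ 2 * j.L α β * j.D2 α β γ +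
    (j.A ^ 2 * j.S3 α β γ - j.S2 α β γ * j.L α β) * j.D1 α β γ + β ^ 2 * (j.r1 * α + j.r0 * β) := by
  linear_combination j.A ^ 2 * j.K_eq α β γ + j.rem_eq α β - j.L α β * j.Q_eq α β γ
lemma other_root (r : R) : j.Q (-r * j.A - 2 * j.B) j.A = j.A ^ 2 * j.Q r 1 := by
  simp only [Q]; ring
lemma map_A (f : R →+* S) : (j.map f).A = f j.A := by simp [A, map]
lemma map_B (f : R →+* S) : (j.map f).B = f j.B := by simp [B, map]
lemma map_Cq (f : R →+* S) : (j.map f).Cq = f j.Cq := by simp [Cq, map]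
lemma map_k0 (f : R →+* S) : (j.map f).k0 = f j.k0 := by simp [k0, map]
lemma map_k1 (f : R →+* S) : (j.map f).k1 = f j.k1 := by simp [k1, t1, map]
lemma map_k2 (f : R →+* S) : (j.map f).k2 = f j.k2 := by simp [k2, t2, map]
lemma map_k3 (f : R →+* S) : (j.map f).k3 = f j.k3 := by simp [k3, map]
lemma map_r1 (f : R →+* S) : (j.map f).r1 = f j.r1 := by
  simp [r1, map_A, map_B, map_Cq, map_k0, map_k1, map_k2]
lemma map_r0 (f : R →+* S) : (j.map f).r0 = f j.r0 := by
  simp [r0, map_A, map_B, map_Cq, map_k0, map_k1, map_k3]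
lemma map_D1 (f : R →+* S) (α β γ : R) : (j.map f).D1 (f α) (f β) (f γ) = f (j.D1 α β γ) := by simp [D1, map]
lemma map_D2 (f : R →+* S) (α β γ : R) : (j.map f).D2 (f α) (f β) (f γ) = f (j.D2 α β γ) := by simp [D2, map, map_ofNat]
lemma map_D3 (f : R →+* S) (α β γ : R) : (j.map f).D3 (f α) (f β) (f γ) = f (j.D3 α β γ) := by simp [D3, map, map_ofNat]
end Jet
def jet (h : Poly) (a b c : E3) : Jet Poly :=
  ⟨dd a h, dd b h, dd c h, dd a (dd a h), dd a (dd b h), dd a (dd c h), dd b (dd b h), dd b (dd c h),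
   dd c (dd c h), dd a (dd a (dd a h)), dd a (dd a (dd b h)), dd a (dd a (dd c h)), dd a (dd b (dd b h)),
   dd a (dd b (dd c h)), dd a (dd c (dd c h)), dd b (dd b (dd b h)), dd b (dd b (dd c h)),
   dd b (dd c (dd c h)), dd c (dd c (dd c h))⟩
section
variable (h : Poly) (a b c : E3) (α β γ : ℝ)
lemma jet_D1 : dd (α • a + β • b + γ • c) h = (jet h a b c).D1 (C α) (C β) (C γ) := by
  simp only [dd_lin, jet, Jet.D1]
lemma jet_D2 : dd (α • a + β • b + γ • c) (dd (α • a + β • b + γ • c) h) =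
    (jet h a b c).D2 (C α) (C β) (C γ) := by
  simp only [dd_lin, dd_add, dd_C_mul, dd_comm b a, dd_comm c a, dd_comm c b, jet, Jet.D2]; ring
lemma jet_D3 : dd (α • a + β • b + γ • c) (dd (α • a + β • b + γ • c) (dd (α • a + β • b + γ • c) h)) =
    (jet h a b c).D3 (C α) (C β) (C γ) := by
  simp only [dd_lin, dd_add, dd_C_mul, dd_comm b a, dd_comm c a, dd_comm c b, jet, Jet.D3]; ring
end
def DegLe (d : ℕ) (p : Poly) : Prop := p.totalDegree ≤ d
lemma DegLe.add {d : ℕ} {p q : Poly} (h1 : DegLe d p) (h2 : DegLe d q) : DegLe d (p + q) :=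
  (totalDegree_add _ _).trans (max_le h1 h2)
lemma DegLe.sub {d : ℕ} {p q : Poly} (h1 : DegLe d p) (h2 : DegLe d q) : DegLe d (p - q) :=
  (totalDegree_sub _ _).trans (max_le h1 h2)
lemma DegLe.mul {d e : ℕ} {p q : Poly} (h1 : DegLe d p) (h2 : DegLe e q) : DegLe (d + e) (p * q) :=
  (totalDegree_mul _ _).trans (add_le_add h1 h2)
lemma DegLe.dd {d : ℕ} {p : Poly} (h1 : DegLe d p) (v : E3) : DegLe d (dd v p) :=
  (totalDegree_dd_le _ _).trans ((Nat.sub_le _ _).trans h1)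
lemma jet_deg (h : Poly) (a b c : E3) (d : ℕ) (hd : DegLe d h) :
    DegLe (d + d + d) (jet h a b c).A ∧ DegLe d (jet h a b c).n3 ∧
    DegLe ((d + d + d) + (d + d + d) + (d + d + d + d)) (jet h a b c).r1 ∧
    DegLe ((d + d + d) + (d + d + d) + (d + d + d + d)) (jet h a b c).r0 := by
  have d1 := fun v => hd.dd v
  have d2 := fun v w => (hd.dd v).dd w
  have d3 := fun v w z => ((hd.dd v).dd w).dd z
  have e1 : DegLe d (jet h a b c).n1 := d1 _
  have e2 : DegLe d (jet h a b c).n2 := d1 _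
  have e3 : DegLe d (jet h a b c).n3 := d1 _
  have faa : DegLe d (jet h a b c).aa := d2 _ _
  have fab : DegLe d (jet h a b c).ab := d2 _ _
  have fac : DegLe d (jet h a b c).ac := d2 _ _
  have fbb : DegLe d (jet h a b c).bb := d2 _ _
  have fbc : DegLe d (jet h a b c).bc := d2 _ _
  have fcc : DegLe d (jet h a b c).cc := d2 _ _
  have faaa : DegLe d (jet h a b c).aaa := d3 _ _ _
  have faab : DegLe d (jet h a b c).aab := d3 _ _ _
  have faac : DegLe d (jet h a b c).aac := d3 _ _ _
  have fabb : DegLe d (jet h a b c).abb := d3 _ _ _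
  have fabc : DegLe d (jet h a b c).abc := d3 _ _ _
  have facc : DegLe d (jet h a b c).acc := d3 _ _ _
  have fbbb : DegLe d (jet h a b c).bbb := d3 _ _ _
  have fbbc : DegLe d (jet h a b c).bbc := d3 _ _ _
  have fbcc : DegLe d (jet h a b c).bcc := d3 _ _ _
  have fccc : DegLe d (jet h a b c).ccc := d3 _ _ _
  clear d1 d2 d3 hd
  generalize jet h a b c = j at *
  have hA : DegLe (d + d + d) j.A := by
    unfold Jet.A
    repeat' with_reducible first | assumption | refine DegLe.add ?_ ?_ | refine DegLe.sub ?_ ?_ | refine DegLe.mul ?_ ?_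
  have hB : DegLe (d + d + d) j.B := by
    unfold Jet.B
    repeat' with_reducible first | assumption | refine DegLe.add ?_ ?_ | refine DegLe.sub ?_ ?_ | refine DegLe.mul ?_ ?_
  have hC : DegLe (d + d + d) j.Cq := by
    unfold Jet.Cq
    repeat' with_reducible first | assumption | refine DegLe.add ?_ ?_ | refine DegLe.sub ?_ ?_ | refine DegLe.mul ?_ ?_
  have h0 : DegLe (d + d + d + d) j.k0 := by
    unfold Jet.k0
    repeat' with_reducible first | assumption | refine DegLe.add ?_ ?_ | refine DegLe.sub ?_ ?_ | refine DegLe.mul ?_ ?_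
  have h4 : DegLe (d + d + d + d) j.t1 := by
    unfold Jet.t1
    repeat' with_reducible first | assumption | refine DegLe.add ?_ ?_ | refine DegLe.sub ?_ ?_ | refine DegLe.mul ?_ ?_
  have h5 : DegLe (d + d + d + d) j.t2 := by
    unfold Jet.t2
    repeat' with_reducible first | assumption | refine DegLe.add ?_ ?_ | refine DegLe.sub ?_ ?_ | refine DegLe.mul ?_ ?_
  have h3 : DegLe (d + d + d + d) j.k3 := by
    unfold Jet.k3
    repeat' with_reducible first | assumption | refine DegLe.add ?_ ?_ | refine DegLe.sub ?_ ?_ | refine DegLe.mul ?_ ?_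
  have h1 : DegLe (d + d + d + d) j.k1 := (h4.add h4).add h4
  have h2 : DegLe (d + d + d + d) j.k2 := (h5.add h5).add h5
  refine ⟨hA, e3, ?_, ?_⟩
  · unfold Jet.r1
    repeat' with_reducible first | assumption | refine DegLe.add ?_ ?_ | refine DegLe.sub ?_ ?_ | refine DegLe.mul ?_ ?_
  · unfold Jet.r0
    repeat' with_reducible first | assumption | refine DegLe.add ?_ ?_ | refine DegLe.sub ?_ ?_ | refine DegLe.mul ?_ ?_
lemma van_derivs {h : Poly} {x u : E3} (hv : Van h (lin x u)) :
    eval x (dd u h) = 0 ∧ eval x (dd u (dd u h)) = 0 ∧ eval x (dd u (dd u (dd u h))) = 0 :=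
  ⟨van_dd hv x (mem_lin_self _ _), van_dd (van_dd hv) x (mem_lin_self _ _),
    van_dd (van_dd (van_dd hv)) x (mem_lin_self _ _)⟩
lemma exists_hyperbolic {h : Poly} (hirr : Irreducible h) (hd : 2 ≤ h.totalDegree) {l : Set E3}
    (hl : IsLine l) (hlv : Van h l) (hns : ∃ i, ¬ Van (pderiv i h) l) (T : Finset E3)
    (hTc : 3 * h.totalDegree < T.card)
    (hT : ∀ x ∈ T, x ∈ l ∧ ∃ m, IsLine m ∧ Van h m ∧ m ≠ l ∧ x ∈ m) :
    ∃ x u v, u ⨯₃ v ≠ 0 ∧ Van h (lin x u) ∧ Van h (lin x v) ∧ grad h x ≠ 0 ∧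
      eval x (dd v (dd u h)) ≠ 0 := by
  classical
  obtain ⟨a0, u, hu, rfl⟩ := hl
  by_contra hcon
  push Not at hcon
  obtain ⟨i, hi⟩ := hns
  have h1 : (T.filter (fun x => ¬ grad h x ≠ 0)).card ≤ h.totalDegree := by
    by_contra hc
    rw [not_le] at hc
    apply hi
    apply van_of_points (isLine_lin hu) _ (T.filter (fun x => ¬ grad h x ≠ 0))
    · intro x hx
      obtain ⟨hx1, hx2⟩ := Finset.mem_filter.1 hx
      rw [not_not] at hx2
      exact ⟨(hT x hx1).1, congrFun hx2 i⟩
    · have := totalDegree_pderiv_le i h; omega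
  have h2 := Finset.card_filter_add_card_filter_not (s := T) (fun x => grad h x ≠ 0)
  set T' := T.filter (fun x => grad h x ≠ 0) with hT'
  choose! m hm using fun x hx => (hT x hx).2
  have hdir : ∀ x ∈ T', ∃ v, m x = lin x v ∧ u ⨯₃ v ≠ 0 := by
    intro x hx
    obtain ⟨hx1, hx2⟩ := Finset.mem_filter.1 hx
    obtain ⟨h3, h4, h5, h6⟩ := hm x hx1
    obtain ⟨v, hv, hmv⟩ := line_dir h3 h6
    refine ⟨v, hmv, cross_ne_of_lines (x := x) hu hv ?_⟩
    rw [← lin_shift (hT x hx1).1, ← hmv]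
    exact h5.symm
  obtain ⟨n0, hn0, hflat⟩ := flat_line (f := h) (a := a0) hu T' (by omega) (by
    intro x hx
    obtain ⟨hx1, hx2⟩ := Finset.mem_filter.1 hx
    obtain ⟨h3, h4, h5, h6⟩ := hm x hx1
    obtain ⟨v, hmv, huv⟩ := hdir x hx
    have hlx := hlv
    rw [lin_shift (hT x hx1).1] at hlx
    rw [hmv] at h4
    exact ⟨(hT x hx1).1, hx2, v, huv, (van_derivs hlx).1, (van_derivs h4).1, (van_derivs hlx).2.1,
      hcon x u v huv hlx h4 hx2⟩)
  have hun : ∀ x ∈ T', ∀ w, Van h (lin x w) → n0 ⬝ᵥ w = 0 := by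
    intro x hx w hw
    obtain ⟨hx1, hx2⟩ := Finset.mem_filter.1 hx
    obtain ⟨s, hs⟩ := hflat x (hT x hx1).1
    have h3 := (van_derivs hw).1
    rw [eval_dd', hs, dotProduct_smul, smul_eq_mul, dotProduct_comm] at h3
    refine (mul_eq_zero.1 h3).resolve_left ?_
    rintro rfl; simp at hs; exact hx2 hs
  have hinj : Set.InjOn m T' := by
    intro x hx y hy hxy
    by_contra hne
    have hx1 := (Finset.mem_filter.1 hx).1
    have hy1 := (Finset.mem_filter.1 hy).1
    exact (hm x hx1).2.2.1 (line_eq_of_two (hm x hx1).1 (isLine_lin hu) (hm x hx1).2.2.2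
      (hxy ▸ (hm y hy1).2.2.2) (hT x hx1).1 (hT y hy1).1 hne)
  have hdvd : lp n0 a0 ∣ h := by
    apply plane_dvd hn0 (T'.image m)
    · intro l hl
      obtain ⟨x, hx, rfl⟩ := Finset.mem_image.1 hl
      have hx1 := (Finset.mem_filter.1 hx).1
      refine ⟨(hm x hx1).1, (hm x hx1).2.1, ?_⟩
      intro y hy
      obtain ⟨v, hmv, huv⟩ := hdir x hx
      have h3 := (hm x hx1).2.1
      rw [hmv] at hy h3
      have hlx := hlv
      rw [lin_shift (hT x hx1).1] at hlx
      obtain ⟨t, rfl⟩ := hy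
      obtain ⟨s, hs⟩ := (hT x hx1).1
      have e1 := hun x hx v h3
      have e2 := hun x hx u hlx
      have e3 : x + t • v - a0 = s • u + t • v := by rw [hs]; abel
      rw [e3, dotProduct_add, dotProduct_smul, dotProduct_smul, e1, e2]; simp
    · rw [Finset.card_image_of_injOn hinj]; omega
  have hass := (lp_irreducible (a := a0) hn0).2.associated_of_dvd hirr hdvd
  refine not_dvd_of_deg_lt (lp_irreducible (a := a0) hn0).2.ne_zero ?_ hass.symm.dvd
  rw [(lp_irreducible hn0).1]; omega
lemma rem_zero {j : Jet ℝ} (hn3 : j.n3 ≠ 0) (hA : j.A ≠ 0) {α β γ : ℝ} (hne : ¬ (α = 0 ∧ β = 0 ∧ γ = 0))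
    (h1 : j.D1 α β γ = 0) (h2 : j.D2 α β γ = 0) (h3 : j.D3 α β γ = 0) :
    β ≠ 0 ∧ j.r1 * α + j.r0 * β = 0 := by
  have hQ : j.Q α β = 0 := by have := j.Q_eq α β γ; rw [h1, h2] at this; linarith
  have hβ : β ≠ 0 := by
    rintro rfl
    simp only [Jet.Q] at hQ
    have hα : α = 0 := by
      have : j.A * α ^ 2 = 0 := by linarith
      simpa [hA] using this
    subst hα
    simp [Jet.D1, hn3] at h1
    exact hne ⟨rfl, rfl, h1⟩
  refine ⟨hβ, ?_⟩
  have := j.main_eq α β γ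
  rw [h1, h2, h3] at this
  have h5 : β ^ 2 * (j.r1 * α + j.r0 * β) = 0 := by linarith
  exact (mul_eq_zero.1 h5).resolve_left (pow_ne_zero 2 hβ)
theorem surface_step {h : Poly} (hirr : Irreducible h) (hd : 2 ≤ h.totalDegree) (Λ : Finset (Set E3))
    (hΛ : ∀ l ∈ Λ, IsLine l ∧ Van h l)
    (hT : ∀ l ∈ Λ, ∃ T : Finset E3, 15 * h.totalDegree < T.card ∧
      ∀ x ∈ T, x ∈ l ∧ ∃ m, IsLine m ∧ Van h m ∧ m ≠ l ∧ x ∈ m)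
    (hc : 15 * h.totalDegree ^ 2 < Λ.card) :
    ∃ x u v, u ⨯₃ v ≠ 0 ∧ Van h (lin x u) ∧ Van h (lin x v) ∧
      eval x (jet h (u + v) (u - v) (grad h x)).n3 ≠ 0 ∧ eval x (jet h (u + v) (u - v) (grad h x)).A ≠ 0 ∧
      h ∣ (jet h (u + v) (u - v) (grad h x)).r1 ∧ h ∣ (jet h (u + v) (u - v) (grad h x)).r0 := by
  classical
  set δ := h.totalDegree with hδ
  obtain ⟨i, hi⟩ := exists_pderiv_ne (f := h) (by omega)
  obtain ⟨l0, hl0, hl0v⟩ : ∃ l ∈ Λ, ¬ Van (pderiv i h) l := by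
    by_contra hcon
    push Not at hcon
    have hlt : (pderiv i h).totalDegree < h.totalDegree := by
      have := totalDegree_pderiv_le i h; omega
    have := bezout_irr h _ hirr (not_dvd_of_deg_lt hi hlt) Λ (fun l hl =>
      ⟨(hΛ l hl).1, (hΛ l hl).2, hcon l hl⟩)
    nlinarith
  obtain ⟨T0, hT0c, hT0⟩ := hT l0 hl0
  obtain ⟨X, u, v, huv, hXu, hXv, hn, hH⟩ := exists_hyperbolic hirr hd (hΛ l0 hl0).1 (hΛ l0 hl0).2
    ⟨i, hl0v⟩ T0 (by omega) hT0
  refine ⟨X, u, v, huv, hXu, hXv, ?_⟩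
  set n := grad h X with hndef
  set a := u + v with ha
  set b := u - v with hb
  set j := jet h a b n with hj
  have hun : u ⬝ᵥ n = 0 := by rw [hndef, ← eval_dd']; exact (van_derivs hXu).1
  have hvn : v ⬝ᵥ n = 0 := by rw [hndef, ← eval_dd']; exact (van_derivs hXv).1
  have hn3 : eval X j.n3 ≠ 0 := by
    change eval X (dd n h) ≠ 0
    rw [eval_dd', ← hndef]; simpa using hn
  have hn1 : eval X j.n1 = 0 := by
    change eval X (dd a h) = 0
    rw [eval_dd', ← hndef, ha, add_dotProduct, hun, hvn, add_zero]
  have haa : eval X j.aa ≠ 0 := by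
    change eval X (dd a (dd a h)) ≠ 0
    have : a = (1:ℝ) • u + (1:ℝ) • v + (0:ℝ) • v := by rw [ha]; simp
    rw [this]
    simp only [dd_lin, dd_add, dd_C_mul, dd_comm u v]
    simp [(van_derivs hXu).2.1, (van_derivs hXv).2.1]
    intro h0; apply hH; linarith
  have hA : eval X j.A ≠ 0 := by
    simp [Jet.A, hn1, hn3, haa]
  have hbasis : ∀ w : E3, ∃ α β γ : ℝ, w = α • a + β • b + γ • n := by
    intro w
    have hnn : n ⬝ᵥ n ≠ 0 := by simpa using hn
    obtain ⟨p, q, hpq⟩ := span_of_orth (w := w - ((w ⬝ᵥ n) / (n ⬝ᵥ n)) • n) huv hn hun hvn (by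
      rw [sub_dotProduct, smul_dotProduct, smul_eq_mul, div_mul_cancel₀ _ hnn, sub_self])
    refine ⟨(p + q) / 2, (p - q) / 2, (w ⬝ᵥ n) / (n ⬝ᵥ n), ?_⟩
    rw [sub_eq_iff_eq_add] at hpq
    generalize (w ⬝ᵥ n) / (n ⬝ᵥ n) = z at *
    rw [hpq, ha, hb]
    ext k; simp; ring
  have hXh : eval X h = 0 := hXu X (mem_lin_self _ _)
  obtain ⟨dA, dn3, dr1, dr0⟩ := jet_deg h a b n δ le_rfl
  rw [← hj] at dA dn3 dr1 dr0
  unfold DegLe at dA dn3 dr1 dr0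
  have hnd : ¬ h ∣ j.n3 * j.A := by
    rintro ⟨g, hg⟩
    have := congrArg (eval X) hg
    simp [hXh, hn3, hA] at this
  have hdeg : (j.n3 * j.A).totalDegree ≤ 4 * δ := by
    refine (totalDegree_mul _ _).trans ?_; omega
  have hbad : (Λ.filter (fun l => Van (j.n3 * j.A) l)).card ≤ 4 * δ ^ 2 := by
    have := bezout_irr h _ hirr hnd (Λ.filter (fun l => Van (j.n3 * j.A) l)) (fun l hl => by
      obtain ⟨h1, h2⟩ := Finset.mem_filter.1 hl
      exact ⟨(hΛ l h1).1, (hΛ l h1).2, h2⟩)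
    nlinarith
  have hsplit := Finset.card_filter_add_card_filter_not (s := Λ) (fun l => Van (j.n3 * j.A) l)
  have hgood : ∀ l ∈ Λ.filter (fun l => ¬ Van (j.n3 * j.A) l), Van j.r1 l ∧ Van j.r0 l := by
    intro l hl
    obtain ⟨h1, h2⟩ := Finset.mem_filter.1 hl
    obtain ⟨T, hTc, hT⟩ := hT l h1
    obtain ⟨Pz, hPz⟩ : ∃ Pz : E3 → Prop, ∀ x, Pz x ↔ eval x (j.n3 * j.A) = 0 := ⟨_, fun _ => Iff.rfl⟩
    have h3 : (T.filter (fun x => Pz x)).card ≤ 4 * δ := by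
      by_contra hcon
      rw [not_le] at hcon
      apply h2
      apply van_of_points (hΛ l h1).1 _ (T.filter (fun x => Pz x))
      · intro x hx
        obtain ⟨hx1, hx2⟩ := Finset.mem_filter.1 hx
        exact ⟨(hT x hx1).1, (hPz x).1 hx2⟩
      · omega
    have h4 := Finset.card_filter_add_card_filter_not (s := T) (fun x => Pz x)
    have key : ∀ x ∈ T.filter (fun x => ¬ Pz x), x ∈ l ∧ eval x j.r1 = 0 ∧
        eval x j.r0 = 0 := by
      intro x hx
      obtain ⟨hx1, hx2⟩ := Finset.mem_filter.1 hx
      obtain ⟨hxl, m, hm, hmv, hml, hxm⟩ := hT x hx1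
      refine ⟨hxl, ?_⟩
      obtain ⟨p, hp, hlp⟩ := line_dir (hΛ l h1).1 hxl
      obtain ⟨q, hq, hmq⟩ := line_dir hm hxm
      have hpq : p ⨯₃ q ≠ 0 := cross_ne_of_lines (x := x) hp hq (by rw [← hlp, ← hmq]; exact hml.symm)
      have hlv := (hΛ l h1).2
      rw [hlp] at hlv
      rw [hmq] at hmv
      rw [hPz, map_mul, mul_eq_zero, not_or] at hx2
      let J := j.map (eval x)
      have hJ3 : J.n3 ≠ 0 := hx2.1
      have hJA : J.A ≠ 0 := by rw [Jet.map_A]; exact hx2.2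
      have gen : ∀ w, w ≠ 0 → Van h (lin x w) → ∃ α β γ : ℝ, w = α • a + β • b + γ • n ∧ β ≠ 0 ∧
          J.D1 α β γ = 0 ∧ J.r1 * α + J.r0 * β = 0 := by
        intro w hw hvw
        obtain ⟨α, β, γ, hab⟩ := hbasis w
        obtain ⟨e1, e2, e3⟩ := van_derivs hvw
        rw [hab] at e1 e2 e3
        rw [jet_D1, ← hj] at e1
        rw [jet_D2, ← hj] at e2
        rw [jet_D3, ← hj] at e3
        rw [← Jet.map_D1] at e1
        rw [← Jet.map_D2] at e2
        rw [← Jet.map_D3] at e3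
        simp only [eval_C] at e1 e2 e3
        have := rem_zero (j := J) hJ3 hJA (α := α) (β := β) (γ := γ) (by
          rintro ⟨rfl, rfl, rfl⟩; simp at hab; exact hw hab) e1 e2 e3
        exact ⟨α, β, γ, hab, this.1, e1, this.2⟩
      obtain ⟨α, β, γ, hp1, hβ, hD, hr⟩ := gen p hp hlv
      obtain ⟨α', β', γ', hq1, hβ', hD', hr'⟩ := gen q hq hmv
      have hdet : α * β' - α' * β ≠ 0 := by
        intro h0
        apply hpq
        have hg : β * γ' = β' * γ := by
          apply mul_right_cancel₀ hJ3
          simp only [Jet.D1] at hD hD'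
          linear_combination β * hD' - β' * hD + J.n1 * h0
        have : q = (β' / β) • p := by
          rw [hp1, hq1]
          ext k
          simp
          field_simp
          linear_combination (-a k) * h0 + n k * hg
        rw [this]; simp
      have e1 : J.r1 * (α * β' - α' * β) = 0 := by linear_combination β' * hr - β * hr'
      have e2 : J.r0 * (α * β' - α' * β) = 0 := by linear_combination α * hr' - α' * hr
      have e3 := (mul_eq_zero.1 e1).resolve_right hdet
      have e4 := (mul_eq_zero.1 e2).resolve_right hdet
      rw [Jet.map_r1] at e3
      rw [Jet.map_r0] at e4
      exact ⟨e3, e4⟩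
    constructor
    · exact van_of_points (hΛ l h1).1 _ _ (fun x hx => ⟨(key x hx).1, (key x hx).2.1⟩) (by omega)
    · exact van_of_points (hΛ l h1).1 _ _ (fun x hx => ⟨(key x hx).1, (key x hx).2.2⟩) (by omega)
  have hfin : ∀ r : Poly, r.totalDegree ≤ 10 * δ →
      (∀ l ∈ Λ.filter (fun l => ¬ Van (j.n3 * j.A) l), Van r l) → h ∣ r := by
    intro r hr hv
    by_contra hcon
    have := bezout_irr h r hirr hcon _ (fun l hl => ⟨(hΛ l (Finset.mem_filter.1 hl).1).1,
      (hΛ l (Finset.mem_filter.1 hl).1).2, hv l hl⟩)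
    have h5 : h.totalDegree * r.totalDegree ≤ 10 * δ ^ 2 := by nlinarith
    omega
  exact ⟨hn3, hA, hfin _ (by omega) fun l hl => (hgood l hl).1, hfin _ (by omega) fun l hl => (hgood l hl).2⟩
end GK
namespace GK
open MvPolynomial
open scoped Matrix
lemma ode_zero {φ p l m w : Polynomial ℝ} (hp : p.coeff 0 ≠ 0)
    (he : p * φ.derivative.derivative.derivative = l * φ.derivative.derivative + m * φ.derivative + w * φ)
    (h0 : φ.coeff 0 = 0) (h1 : φ.coeff 1 = 0) (h2 : φ.coeff 2 = 0) : φ = 0 := by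
  ext n
  rw [Polynomial.coeff_zero]
  induction n using Nat.strong_induction_on with
  | _ n ih =>
    match n with
    | 0 => exact h0
    | 1 => exact h1
    | 2 => exact h2
    | k + 3 =>
      have := congrArg (fun q => q.coeff k) he
      simp only [Polynomial.coeff_add, Polynomial.coeff_mul] at this
      rw [Finset.sum_eq_single (0, k), Finset.sum_eq_zero, Finset.sum_eq_zero, Finset.sum_eq_zero] at this
      · simp only [Polynomial.coeff_derivative] at this
        simp only [add_zero, mul_eq_zero, hp, false_or] at this
        rcases this with ((h | h) | h) | h
        · exact h
        all_goals exfalso; norm_cast at h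
      · rintro ⟨i, j⟩ hij
        rw [Finset.HasAntidiagonal.mem_antidiagonal] at hij
        simp only at hij ⊢
        rw [ih j (by omega), mul_zero]
      · rintro ⟨i, j⟩ hij
        rw [Finset.HasAntidiagonal.mem_antidiagonal] at hij
        simp only [Polynomial.coeff_derivative] at hij ⊢
        rw [ih (j + 1) (by omega), zero_mul, mul_zero]
      · rintro ⟨i, j⟩ hij
        rw [Finset.HasAntidiagonal.mem_antidiagonal] at hij
        simp only [Polynomial.coeff_derivative] at hij ⊢
        rw [ih (j + 1 + 1) (by omega), zero_mul, zero_mul, mul_zero]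
      · rintro ⟨i, j⟩ hij hne
        rw [Finset.HasAntidiagonal.mem_antidiagonal] at hij
        simp only [Polynomial.coeff_derivative] at hij ⊢
        have : i ≠ 0 := by rintro rfl; apply hne; ext <;> simp_all
        rw [ih (j + 1 + 1 + 1) (by omega)]; simp
      · simp
lemma restr_coeff_zero (X J : E3) (f : Poly) : (restr X J f).coeff 0 = eval X f := by
  rw [Polynomial.coeff_zero_eq_eval_zero, eval_restr]; simp
lemma ode_line {h G L M W : Poly} {Y w : E3} (hG : eval Y G ≠ 0)
    (hm : G * dd w (dd w (dd w h)) = L * dd w (dd w h) + M * dd w h + W * h)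
    (hY : eval Y h = 0) (h1 : eval Y (dd w h) = 0) (h2 : eval Y (dd w (dd w h)) = 0) : restr Y w h = 0 := by
  refine ode_zero (p := restr Y w G) (l := restr Y w L) (m := restr Y w M) (w := restr Y w W) ?_ ?_ ?_ ?_ ?_
  · rw [restr_coeff_zero]; exact hG
  · simp only [derivative_restr, ← map_mul, ← map_add]; rw [hm]
  · rw [restr_coeff_zero, hY]
  · have := Polynomial.coeff_derivative (restr Y w h) 0
    rw [derivative_restr, restr_coeff_zero, h1] at this
    simpa using this.symm
  · have := Polynomial.coeff_derivative (restr Y w (dd w h)) 0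
    rw [derivative_restr, restr_coeff_zero, h2, ← derivative_restr, Polynomial.coeff_derivative] at this
    norm_num at this; exact this
lemma second_line {h : Poly} {a b c : E3} (hr1 : h ∣ (jet h a b c).r1) (hr0 : h ∣ (jet h a b c).r0)
    {Y : E3} (hY : eval Y h = 0) (h3 : eval Y (jet h a b c).n3 ≠ 0) (hA : eval Y (jet h a b c).A ≠ 0)
    {α β γ : ℝ} (h1 : ((jet h a b c).map (eval Y)).D1 α β γ = 0)
    (h2 : ((jet h a b c).map (eval Y)).D2 α β γ = 0) : Van h (lin Y (α • a + β • b + γ • c)) := by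
  rw [van_lin_iff]
  have e1 := jet_D1 h a b c α β γ
  have e2 := jet_D2 h a b c α β γ
  have e3 := jet_D3 h a b c α β γ
  generalize jet h a b c = j at *
  have h1' : eval Y (j.D1 (C α) (C β) (C γ)) = 0 := by rw [← Jet.map_D1]; simpa using h1
  have h2' : eval Y (j.D2 (C α) (C β) (C γ)) = 0 := by rw [← Jet.map_D2]; simpa using h2
  have hm := j.main_eq (C α) (C β) (C γ)
  obtain ⟨g1, hg1⟩ := hr1
  obtain ⟨g0, hg0⟩ := hr0
  rw [← e1] at h1'
  rw [← e2] at h2'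
  rw [← e1, ← e2, ← e3, hg1, hg0] at hm
  have e4 : C β ^ 2 * (h * g1 * C α + h * g0 * C β) = (C β ^ 2 * (g1 * C α + g0 * C β)) * h := by ring
  rw [e4] at hm
  refine ode_line ?_ hm hY h1' h2'
  rw [map_mul, map_pow, map_pow]; exact mul_ne_zero (pow_ne_zero _ hA) (pow_ne_zero _ h3)
def dirJ (h : Poly) (a b c : E3) (r : ℝ) (Y : E3) : E3 :=
  let j := (jet h a b c).map (eval Y)
  (j.n3 * (-r * j.A - 2 * j.B)) • a + (j.n3 * j.A) • b + (-((-r * j.A - 2 * j.B) * j.n1 + j.A * j.n2)) • c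
lemma second_line' {h : Poly} {a b c : E3} (hr1 : h ∣ (jet h a b c).r1) (hr0 : h ∣ (jet h a b c).r0)
    {Y : E3} (h3 : eval Y (jet h a b c).n3 ≠ 0) (hA : eval Y (jet h a b c).A ≠ 0)
    {r : ℝ} (hv : Van h (lin Y (r • a + b))) : Van h (lin Y (dirJ h a b c r Y)) := by
  have hJ3 : ((jet h a b c).map (eval Y)).n3 ≠ 0 := h3
  unfold dirJ
  obtain ⟨e1, e2, -⟩ := van_derivs hv
  have hrb : r • a + b = r • a + (1:ℝ) • b + (0:ℝ) • c := by simp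
  rw [hrb] at e1 e2
  rw [jet_D1, ← Jet.map_D1] at e1
  rw [jet_D2, ← Jet.map_D2] at e2
  simp only [eval_C] at e1 e2
  have hd1 : ∀ j : Jet ℝ, j.D1 (j.n3 * (-r * j.A - 2 * j.B)) (j.n3 * j.A)
      (-((-r * j.A - 2 * j.B) * j.n1 + j.A * j.n2)) = 0 := fun j => by simp only [Jet.D1]; ring
  have key : ∀ j : Jet ℝ, j.n3 ≠ 0 → j.D1 r 1 0 = 0 → j.D2 r 1 0 = 0 → j.D2 (j.n3 * (-r * j.A - 2 * j.B)) (j.n3 * j.A)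
      (-((-r * j.A - 2 * j.B) * j.n1 + j.A * j.n2)) = 0 := by
    intro j hj e1 e2
    have hq := j.Q_eq r 1 0
    rw [e1, e2] at hq
    have hq' : j.Q r 1 = 0 := by linarith
    have h5 := j.Q_eq (j.n3 * (-r * j.A - 2 * j.B)) (j.n3 * j.A) (-((-r * j.A - 2 * j.B) * j.n1 + j.A * j.n2))
    rw [hd1 j] at h5
    have h6 : j.Q (j.n3 * (-r * j.A - 2 * j.B)) (j.n3 * j.A) = j.n3 ^ 2 * j.Q (-r * j.A - 2 * j.B) j.A := by
      simp only [Jet.Q]; ring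
    rw [h6, j.other_root, hq'] at h5
    have : j.n3 ^ 2 * j.D2 (j.n3 * (-r * j.A - 2 * j.B)) (j.n3 * j.A)
      (-((-r * j.A - 2 * j.B) * j.n1 + j.A * j.n2)) = 0 := by linarith
    exact (mul_eq_zero.1 this).resolve_left (pow_ne_zero 2 hj)
  exact second_line hr1 hr0 (hv Y (mem_lin_self _ _)) h3 hA (hd1 _) (key _ hJ3 e1 e2)
lemma continuous_eval' (f : Poly) : Continuous (fun Y : E3 => eval Y f) := MvPolynomial.continuous_eval f
lemma continuous_dirJ (h : Poly) (a b c : E3) (r : ℝ) : Continuous (dirJ h a b c r) := by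
  unfold dirJ
  simp only [Jet.map_A, Jet.map_B]
  generalize jet h a b c = j
  have h1 : Continuous (fun Y : E3 => eval Y j.n1) := continuous_eval' _
  have h2 : Continuous (fun Y : E3 => eval Y j.n2) := continuous_eval' _
  have h3 : Continuous (fun Y : E3 => eval Y j.n3) := continuous_eval' _
  have h4 := continuous_eval' j.A
  have h5 := continuous_eval' j.B
  simp only [Jet.map]
  fun_prop
lemma cramer (J V c w : E3) : (J ⨯₃ V ⬝ᵥ c) • w = (w ⬝ᵥ V ⨯₃ c) • J + (w ⬝ᵥ c ⨯₃ J) • V + (w ⬝ᵥ J ⨯₃ V) • c := by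
  ext k
  fin_cases k <;> simp [cross_apply, dotProduct, Fin.sum_univ_three] <;> ring
lemma continuous_cross {α : Type*} [TopologicalSpace α] {f g : α → E3} (hf : Continuous f) (hg : Continuous g) :
    Continuous (fun x => f x ⨯₃ g x) := by
  simp only [cross_apply]
  refine continuous_pi fun k => ?_
  fin_cases k <;> simp <;> fun_prop
lemma continuous_dot {α : Type*} [TopologicalSpace α] {f g : α → E3} (hf : Continuous f) (hg : Continuous g) :
    Continuous (fun x => f x ⬝ᵥ g x) := by
  simp only [dotProduct]; fun_prop
open Filter Topology in
lemma meet_near {h : Poly} {X V c : E3} (hV : Van h (lin X V)) (hc : eval X (dd c h) ≠ 0) {Y J : ℝ → E3}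
    (hY : Continuous Y) (hJ : Continuous J) (hv : ∀ᶠ s in 𝓝 (0:ℝ), Van h (lin (Y s) (J s)))
    (hX : X ∈ lin (Y 0) (J 0)) (hJV : J 0 ⨯₃ V ≠ 0) {U : Set E3} (hU : U ∈ 𝓝 X) :
    ∀ᶠ s in 𝓝 (0:ℝ), ∃ z ∈ U, z ∈ lin (Y s) (J s) ∧ z ∈ lin X V := by
  have hv0 := hv.self_of_nhds
  rw [lin_shift hX] at hv0
  have hΔ : J 0 ⨯₃ V ⬝ᵥ c ≠ 0 := by
    intro h0
    obtain ⟨p, q, hpq⟩ := span_of_orth (w := c) hJV hJV (dot_self_cross _ _) (dot_cross_self _ _)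
      (by rw [dotProduct_comm]; exact h0)
    apply hc
    have h1 : J 0 ⬝ᵥ grad h X = 0 := by rw [← eval_dd']; exact (van_derivs hv0).1
    have h2 : V ⬝ᵥ grad h X = 0 := by rw [← eval_dd']; exact (van_derivs hV).1
    rw [eval_dd', hpq, add_dotProduct, smul_dotProduct, smul_dotProduct, h1, h2]; simp
  obtain ⟨t, ht⟩ := hX
  let Δ := fun s => J s ⨯₃ V ⬝ᵥ c
  let w := fun s => X - Y s
  have cw : Continuous w := continuous_const.sub hY
  have cΔ : Continuous Δ := continuous_dot (continuous_cross hJ continuous_const) continuous_const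
  let Z := fun s => Y s + (w s ⬝ᵥ V ⨯₃ c / Δ s) • J s
  let M := fun s => X + (-(w s ⬝ᵥ c ⨯₃ J s) / Δ s) • V
  let ε := fun s => -(w s ⬝ᵥ J s ⨯₃ V) / Δ s
  have hw0 : w 0 = t • J 0 := by simp only [w]; rw [ht]; abel
  have hZM : ∀ s, Δ s ≠ 0 → Z s = M s + ε s • c := by
    intro s hs
    have h1 := cramer (J s) V c (w s)
    have h2 : w s = (w s ⬝ᵥ V ⨯₃ c / Δ s) • J s + (w s ⬝ᵥ c ⨯₃ J s / Δ s) • V + (w s ⬝ᵥ J s ⨯₃ V / Δ s) • c := by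
      have h3 := congrArg (fun z => (Δ s)⁻¹ • z) h1
      simp only [smul_add, smul_smul] at h3
      rw [inv_mul_cancel₀ hs, one_smul] at h3
      simp only [div_eq_inv_mul]
      exact h3
    simp only [Z, M, ε, neg_div, neg_smul]
    rw [← sub_eq_zero]
    have h4 : X = w s + Y s := by simp [w]
    generalize w s ⬝ᵥ V ⨯₃ c / Δ s = p1 at *
    generalize w s ⬝ᵥ c ⨯₃ J s / Δ s = p2 at *
    generalize w s ⬝ᵥ J s ⨯₃ V / Δ s = p3 at *
    rw [h4, h2]; abel
  have hΔ0 : Δ 0 ≠ 0 := hΔ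
  have cZ : Tendsto Z (𝓝 0) (𝓝 X) := by
    have : ContinuousAt Z 0 := hY.continuousAt.add
      (((continuous_dot cw continuous_const).continuousAt.div cΔ.continuousAt hΔ0).smul hJ.continuousAt)
    have h0 : Z 0 = X := by
      simp only [Z]; rw [hw0, ht]
      have e : Δ 0 = J 0 ⬝ᵥ V ⨯₃ c := by
        simp only [Δ, cross_apply, dot3]; simp; ring
      rw [smul_dotProduct, ← e, smul_eq_mul, mul_div_cancel_right₀ _ hΔ0]
    rw [← h0]; exact this
  have cM : Tendsto M (𝓝 0) (𝓝 X) := by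
    have : ContinuousAt M 0 := continuousAt_const.add
      (((continuous_dot cw (continuous_cross continuous_const hJ)).continuousAt.neg.div cΔ.continuousAt hΔ0).smul
        continuousAt_const)
    have h0 : M 0 = X := by
      simp only [M]; rw [hw0]; simp
    rw [← h0]; exact this
  obtain ⟨e, he, hball⟩ := Metric.mem_nhds_iff.1 (inter_mem hU
    ((continuous_eval' (dd c h)).continuousAt.eventually_ne hc))
  filter_upwards [hv, cZ (Metric.ball_mem_nhds X he), cM (Metric.ball_mem_nhds X he),
    cΔ.continuousAt.eventually_ne hΔ0] with s h1 h2 h3 h4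
  refine ⟨Z s, (hball h2).1, ⟨_, rfl⟩, ?_⟩
  by_cases hε : ε s = 0
  · rw [hZM s h4, hε, zero_smul, add_zero]; exact ⟨_, rfl⟩
  exfalso
  have r0 : (restr (M s) c h).eval 0 = 0 := by rw [eval_restr, zero_smul, add_zero]; exact hV _ ⟨_, rfl⟩
  have r1 : (restr (M s) c h).eval (ε s) = 0 := by rw [eval_restr, ← hZM s h4]; exact h1 _ ⟨_, rfl⟩
  have rolle : ∃ τ ∈ Set.Icc (0:ℝ) 1, (Polynomial.derivative (restr (M s) c h)).eval (τ * ε s) = 0 := by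
    let g := fun τ : ℝ => (restr (M s) c h).eval (τ * ε s)
    have hg : ∀ τ, HasDerivAt g ((Polynomial.derivative (restr (M s) c h)).eval (τ * ε s) * ε s) τ := by
      intro τ
      have := ((restr (M s) c h).hasDerivAt (τ * ε s)).comp τ ((hasDerivAt_id τ).mul_const (ε s))
      simpa [g, Function.comp_def] using this
    obtain ⟨τ, hτ, h0⟩ := exists_hasDerivAt_eq_zero (f := g) (f' := _) (zero_lt_one (α := ℝ))
      (fun τ _ => (hg τ).continuousAt.continuousWithinAt) (by simp [g, r0, r1]) (fun τ _ => hg τ)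
    exact ⟨τ, Set.Ioo_subset_Icc_self hτ, (mul_eq_zero.1 h0).resolve_right hε⟩
  obtain ⟨τ, hτ, h0⟩ := rolle
  rw [derivative_restr, eval_restr] at h0
  refine (hball ?_).2 h0
  have : M s + (τ * ε s) • c = M s + τ • (Z s - M s) := by rw [hZM s h4, add_sub_cancel_left, smul_smul]
  rw [this]
  exact (convex_ball X e).add_smul_sub_mem h3 h2 hτ
lemma dirJ_at {h : Poly} {X u v c : E3} (hXu : Van h (lin X u)) (hXv : Van h (lin X v)) (r : ℝ) :
    ∀ k, k = eval X (jet h (u + v) (u - v) c).n3 * eval X (jet h (u + v) (u - v) c).A →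
    dirJ h (u + v) (u - v) c r X = k • (-r • (u + v) + (u - v)) := by
  rintro k rfl
  have u1 := (van_derivs hXu).1
  have u2 := (van_derivs hXu).2.1
  have v1 := (van_derivs hXv).1
  have v2 := (van_derivs hXv).2.1
  have ea : u + v = (1:ℝ) • u + (1:ℝ) • v + (0:ℝ) • v := by simp
  have eb : u - v = (1:ℝ) • u + (-1:ℝ) • v + (0:ℝ) • v := by simp [sub_eq_add_neg]
  have n1 : eval X (jet h (u + v) (u - v) c).n1 = 0 := by
    change eval X (dd (u + v) h) = 0
    rw [ea, dd_lin]; simp [u1, v1]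
  have n2 : eval X (jet h (u + v) (u - v) c).n2 = 0 := by
    change eval X (dd (u - v) h) = 0
    rw [eb, dd_lin]; simp [u1, v1]
  have ab : eval X (jet h (u + v) (u - v) c).ab = 0 := by
    change eval X (dd (u + v) (dd (u - v) h)) = 0
    rw [ea, eb]
    simp only [dd_lin, dd_add, dd_C_mul, dd_comm v u]
    simp [u2, v2]
  unfold dirJ
  generalize jet h (u + v) (u - v) c = j at *
  have hB : eval X j.B = 0 := by simp [Jet.B, n1, n2, ab]
  simp only [Jet.map_A, Jet.map_B, hB]
  simp only [Jet.map, n1, n2, mul_zero, add_zero, neg_zero, zero_smul, sub_zero]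
  rw [smul_add (_ * _) (_ • _), smul_smul]
  congr 2; ring
open Filter Topology in
theorem regulus {h : Poly} (hirr : Irreducible h) (hd : 3 ≤ h.totalDegree) {X u v c : E3} (huv : u ⨯₃ v ≠ 0)
    (hXu : Van h (lin X u)) (hXv : Van h (lin X v)) (h3 : eval X (jet h (u + v) (u - v) c).n3 ≠ 0)
    (hA : eval X (jet h (u + v) (u - v) c).A ≠ 0)
    (hr1 : h ∣ (jet h (u + v) (u - v) c).r1) (hr0 : h ∣ (jet h (u + v) (u - v) c).r0) : False := by
  classical
  have hu : u ≠ 0 := by rintro rfl; simp at huv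
  have hv : v ≠ 0 := by rintro rfl; simp at huv
  have hlu : IsLine (lin X u) := isLine_lin hu
  have hlv : IsLine (lin X v) := isLine_lin hv
  obtain ⟨k, hk⟩ : ∃ k, k = eval X (jet h (u + v) (u - v) c).n3 * eval X (jet h (u + v) (u - v) c).A := ⟨_, rfl⟩
  have hk0 : k ≠ 0 := by rw [hk]; exact mul_ne_zero h3 hA
  have hJu : dirJ h (u + v) (u - v) c (-1) X = (2 * k) • u := by
    rw [dirJ_at hXu hXv _ k hk]; ext i; simp; ring
  have hJv : dirJ h (u + v) (u - v) c 1 X = (-2 * k) • v := by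
    rw [dirJ_at hXu hXv _ k hk]; ext i; simp; ring
  have c3 := continuous_eval' (jet h (u + v) (u - v) c).n3
  have cA := continuous_eval' (jet h (u + v) (u - v) c).A
  have clin : ∀ w : E3, Continuous (fun s : ℝ => X + s • w) := fun w => by fun_prop
  have sl : ∀ (w : E3) (r q : ℝ), Van h (lin X w) → q ≠ 0 → r • (u + v) + (u - v) = q • w →
      ∀ᶠ s in 𝓝 (0:ℝ), eval (X + s • w) (jet h (u + v) (u - v) c).n3 ≠ 0 ∧
        Van h (lin (X + s • w) (dirJ h (u + v) (u - v) c r (X + s • w))) := by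
    intro w r q hw hq he
    have e1 := (c3.comp (clin w)).continuousAt.eventually_ne (x := 0) (by simpa using h3)
    have e2 := (cA.comp (clin w)).continuousAt.eventually_ne (x := 0) (by simpa using hA)
    filter_upwards [e1, e2] with s hs1 hs2
    refine ⟨hs1, second_line' hr1 hr0 hs1 hs2 ?_⟩
    rw [he, lin_smul hq, ← lin_shift (a := X) ⟨s, rfl⟩]; exact hw
  have slu := sl u 1 2 hXu (by norm_num) (by ext i; simp; ring)
  have slv := sl v (-1) (-2) hXv (by norm_num) (by ext i; simp; ring)
  clear sl
  have cJ := fun r => continuous_dirJ h (u + v) (u - v) c r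
  generalize hJd : dirJ h (u + v) (u - v) c = dJ at *
  have hn3 : ∀ Y, eval Y (jet h (u + v) (u - v) c).n3 = eval Y (dd c h) := fun _ => rfl
  simp only [hn3] at *
  generalize jet h (u + v) (u - v) c = jj at *
  have e3 : ∀ᶠ s in 𝓝 (0:ℝ), u ⨯₃ dJ 1 (X + s • u) ≠ 0 := by
    have : Continuous fun s : ℝ => u ⨯₃ dJ 1 (X + s • u) :=
      continuous_cross continuous_const ((cJ 1).comp (clin u))
    refine this.continuousAt.eventually_ne ?_
    simp only [zero_smul, add_zero, hJv]
    rw [map_smul]; exact smul_ne_zero (by simpa using hk0) huv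
  have e4 := (slu.and e3).filter_mono (nhdsWithin_le_nhds (s := {0}ᶜ))
  obtain ⟨s2, ⟨⟨h21, h22⟩, h23⟩, hs2⟩ := (e4.and self_mem_nhdsWithin).exists
  have hs2' : s2 ≠ 0 := hs2
  obtain ⟨s3, ⟨⟨⟨h31, h32⟩, h33⟩, hs3⟩, hs23⟩ := ((e4.and self_mem_nhdsWithin).and
    ((eventually_ne_nhds (b := s2) hs2'.symm).filter_mono (nhdsWithin_le_nhds (s := {0}ᶜ)))).exists
  have hs3' : s3 ≠ 0 := hs3
  clear hs2 hs3 e4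
  set X2 := X + s2 • u with hX2
  set X3 := X + s3 • u with hX3
  have hv2 : dJ 1 X2 ≠ 0 := by intro h0; rw [h0] at h23; simp at h23
  have hv3 : dJ 1 X3 ≠ 0 := by intro h0; rw [h0] at h33; simp at h33
  have hm2 := isLine_lin (a := X2) hv2
  have hm3 := isLine_lin (a := X3) hv3
  have ne2 : X ≠ X2 := by rw [hX2]; simpa [hu] using hs2'
  have ne3 : X ≠ X3 := by rw [hX3]; simpa [hu] using hs3'
  have ne23 : X2 ≠ X3 := fun h => hs23 (lin_inj (a := X) hu h).symm
  obtain ⟨R, hR0, hRd, hRv⟩ : ∃ R : Poly, R ≠ 0 ∧ R.totalDegree ≤ 2 ∧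
      (Van R (lin X v) ∧ Van R (lin X2 (dJ 1 X2)) ∧ Van R (lin X3 (dJ 1 X3))) := by
    obtain ⟨T1, h11, h12⟩ := (line_infinite hlv).exists_subset_card_eq 3
    obtain ⟨T2, h21, h22⟩ := (line_infinite hm2).exists_subset_card_eq 3
    obtain ⟨T3, h31, h32⟩ := (line_infinite hm3).exists_subset_card_eq 3
    obtain ⟨R, hR0, hRd, hR⟩ := exists_poly_vanishing 2 (T1 ∪ T2 ∪ T3) (by
      have := Finset.card_union_le (T1 ∪ T2) T3
      have := Finset.card_union_le T1 T2
      have : (2 + 3).choose 3 = 10 := by decide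
      omega)
    refine ⟨R, hR0, hRd, van_of_points hlv R T1 (fun x hx => ⟨h11 hx, hR x (by simp [hx])⟩) (by omega),
      van_of_points hm2 R T2 (fun x hx => ⟨h21 hx, hR x (by simp [hx])⟩) (by omega),
      van_of_points hm3 R T3 (fun x hx => ⟨h31 hx, hR x (by simp [hx])⟩) (by omega)⟩
  have hndvd := not_dvd_of_deg_lt (h := h) hR0 (by omega)
  have c1 := (cJ (-1)).comp (clin v)
  have hp0 : dJ (-1) (X + (0:ℝ) • v) = (2 * k) • u := by simp [hJu]
  have hJ0 : ∀ (s : ℝ) (w : E3), w = X + s • u → w ∈ lin (X + (0:ℝ) • v) (dJ (-1) (X + (0:ℝ) • v)) := by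
    intro s w hw
    rw [hp0, lin_smul (by simpa using hk0), hw]; exact ⟨s, by simp⟩
  obtain ⟨U2, U3, hU2, hU3, hU23⟩ := t2_separation_nhds ne23
  obtain ⟨U0, U2', hU0, hU2', hU02⟩ := t2_separation_nhds ne2
  obtain ⟨U0', U3', hU0', hU3', hU03⟩ := t2_separation_nhds ne3
  have meet : ∀ (s : ℝ) (Y : E3) (U : Set E3), Y = X + s • u → eval Y (dd c h) ≠ 0 → Van h (lin Y (dJ 1 Y)) →
      u ⨯₃ dJ 1 Y ≠ 0 → U ∈ 𝓝 Y → ∀ᶠ s in 𝓝 (0:ℝ), ∃ z ∈ U,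
        z ∈ lin (X + s • v) (dJ (-1) (X + s • v)) ∧ z ∈ lin Y (dJ 1 Y) := by
    intro s Y U hY f1 f2 f3 f4
    refine meet_near f2 f1 (clin v) c1 (slv.mono fun _ h => h.2) (hJ0 s Y hY) ?_ f4
    simp only [Function.comp]
    rw [hp0, map_smul, LinearMap.smul_apply]; exact smul_ne_zero (by simpa using hk0) f3
  have m2 := meet s2 X2 _ hX2 h21 h22 h23 (inter_mem hU2 hU2')
  have m3 := meet s3 X3 _ hX3 h31 h32 h33 (inter_mem hU3 hU3')
  have e0 : ∀ᶠ s in 𝓝 (0:ℝ), X + s • v ∈ U0 ∩ U0' :=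
    (clin v).continuousAt.eventually (by simpa using inter_mem hU0 hU0')
  have e5 : ∀ᶠ s in 𝓝 (0:ℝ), dJ (-1) (X + s • v) ⨯₃ v ≠ 0 := by
    refine (continuous_cross c1 continuous_const).continuousAt.eventually_ne ?_
    simp only [Function.comp]
    rw [hp0, map_smul, LinearMap.smul_apply]; exact smul_ne_zero (by simpa using hk0) huv
  have hall := (((m2.and m3).and e0).and e5).and slv
  obtain ⟨S, hS, hSc⟩ := (infinite_of_mem_nhds (0:ℝ) hall).exists_subset_card_eq (h.totalDegree * 2 + 1)
  let ℓ := fun s : ℝ => lin (X + s • v) (dJ (-1) (X + s • v))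
  have hinj : Set.InjOn ℓ S := by
    intro s hs t ht hst
    by_contra hne
    obtain ⟨⟨-, h5⟩, -⟩ := hS hs
    have hds : dJ (-1) (X + s • v) ≠ 0 := by intro h0; rw [h0] at h5; simp at h5
    have f1 : ℓ s = lin X v := line_eq_of_two (isLine_lin hds) hlv (mem_lin_self _ _)
      (by have := mem_lin_self (X + t • v) (dJ (-1) (X + t • v)); change _ ∈ ℓ t at this; rw [← hst] at this; exact this)
      ⟨s, rfl⟩ ⟨t, rfl⟩ (fun h => hne (lin_inj hv h))
    rw [lin_shift (a := X) (u := v) (x := X + s • v) ⟨s, rfl⟩] at f1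
    have f2 : X + s • v + (1:ℝ) • dJ (-1) (X + s • v) ∈ lin (X + s • v) v := f1 ▸ ⟨1, rfl⟩
    obtain ⟨q, hq⟩ := f2
    rw [one_smul, add_right_inj] at hq
    rw [hq] at h5
    simp at h5
  have := bezout_irr h R hirr hndvd (S.image ℓ) (by
    intro l hl
    obtain ⟨s, hs, rfl⟩ := Finset.mem_image.1 hl
    obtain ⟨⟨⟨⟨⟨z2, hz2, hz2a, hz2b⟩, z3, hz3, hz3a, hz3b⟩, hy⟩, h5⟩, -, hvan⟩ := hS hs
    have hds : dJ (-1) (X + s • v) ≠ 0 := by intro h0; rw [h0] at h5; simp at h5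
    refine ⟨isLine_lin hds, hvan, ?_⟩
    have d1 : X + s • v ≠ z2 := fun h => Set.disjoint_left.1 hU02 hy.1 (h ▸ hz2.2)
    have d2 : X + s • v ≠ z3 := fun h => Set.disjoint_left.1 hU03 hy.2 (h ▸ hz3.2)
    have d3 : z2 ≠ z3 := fun h => Set.disjoint_left.1 hU23 hz2.1 (h ▸ hz3.1)
    apply van_of_points (isLine_lin hds) R {X + s • v, z2, z3}
    · intro x hx
      simp only [Finset.mem_insert, Finset.mem_singleton] at hx
      rcases hx with rfl | rfl | rfl
      · exact ⟨mem_lin_self _ _, hRv.1 _ ⟨s, rfl⟩⟩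
      · exact ⟨hz2a, hRv.2.1 _ hz2b⟩
      · exact ⟨hz3a, hRv.2.2 _ hz3b⟩
    · rw [Finset.card_insert_of_notMem (by simp [d1, d2]), Finset.card_pair d3]; omega)
  rw [Finset.card_image_of_injOn hinj, hSc] at this
  have := Nat.mul_le_mul_left h.totalDegree hRd
  omega
theorem surface {h : Poly} (hirr : Irreducible h) (hd : 3 ≤ h.totalDegree) (Λ : Finset (Set E3))
    (hΛ : ∀ l ∈ Λ, IsLine l ∧ Van h l)
    (hT : ∀ l ∈ Λ, ∃ T : Finset E3, 15 * h.totalDegree < T.card ∧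
      ∀ x ∈ T, x ∈ l ∧ ∃ m, IsLine m ∧ Van h m ∧ m ≠ l ∧ x ∈ m) :
    Λ.card ≤ 15 * h.totalDegree ^ 2 := by
  by_contra hc
  obtain ⟨x, u, v, h1, h2, h3, h4, h5, h6, h7⟩ := surface_step hirr (by omega) Λ hΛ hT (not_le.1 hc)
  exact regulus hirr hd h1 h2 h3 h4 h5 h6 h7
end GK
namespace GK
open MvPolynomial
open scoped Matrix
lemma totalDegree_prod' {ι : Type*} (s : Finset ι) (f : ι → Poly) (h : ∀ i ∈ s, f i ≠ 0) :
    (∏ i ∈ s, f i).totalDegree = ∑ i ∈ s, (f i).totalDegree := by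
  classical
  induction s using Finset.induction_on with
  | empty => simp
  | insert a s ha ih =>
    rw [Finset.prod_insert ha, Finset.sum_insert ha, totalDegree_mul_of_isDomain (h a (by simp))
      (Finset.prod_ne_zero_iff.2 fun i hi => h i (by simp [hi])), ih fun i hi => h i (by simp [hi])]
lemma totalDegree_le_of_dvd' {f g : Poly} (hg : g ≠ 0) (h : f ∣ g) : f.totalDegree ≤ g.totalDegree := by
  by_contra hc; exact not_dvd_of_deg_lt hg (not_le.1 hc) h
lemma factor_data (f : Poly) (hf : f ≠ 0) : ∃ Fs : Finset Poly, (∀ g ∈ Fs, Irreducible g) ∧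
    (∀ g ∈ Fs, ∀ g' ∈ Fs, g ≠ g' → ¬ g ∣ g') ∧ (∀ x, eval x f = 0 → ∃ g ∈ Fs, eval x g = 0) ∧
    (∀ l, IsLine l → Van f l → ∃ g ∈ Fs, Van g l) ∧ ∑ g ∈ Fs, g.totalDegree ≤ f.totalDegree := by
  classical
  let _ : StrongNormalizationMonoid Poly := UniqueFactorizationMonoid.strongNormalizationMonoid
  let ms := UniqueFactorizationMonoid.normalizedFactors f
  have hms := UniqueFactorizationMonoid.prod_normalizedFactors hf
  have hirr : ∀ g ∈ ms.toFinset, Irreducible g := fun g hg =>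
    UniqueFactorizationMonoid.irreducible_of_normalized_factor g (Multiset.mem_toFinset.1 hg)
  obtain ⟨w, hw⟩ := hms.dvd'
  refine ⟨ms.toFinset, hirr, ?_, ?_, ?_, ?_⟩
  · intro g hg g' hg' hne hd
    exact hne (UniqueFactorizationMonoid.normalizedFactors_eq_of_dvd f g (Multiset.mem_toFinset.1 hg) g'
      (Multiset.mem_toFinset.1 hg') hd)
  · intro x hx
    have : eval x ms.prod = 0 := by rw [hw, map_mul, hx, zero_mul]
    rw [map_multiset_prod, Multiset.prod_eq_zero_iff, Multiset.mem_map] at this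
    obtain ⟨g, hg, h0⟩ := this
    exact ⟨g, Multiset.mem_toFinset.2 hg, h0⟩
  · rintro l ⟨a, v, hv, rfl⟩ hl
    rw [van_lin_iff] at hl
    have : restr a v ms.prod = 0 := by rw [hw, map_mul, hl, zero_mul]
    rw [map_multiset_prod, Multiset.prod_eq_zero_iff, Multiset.mem_map] at this
    obtain ⟨g, hg, h0⟩ := this
    exact ⟨g, Multiset.mem_toFinset.2 hg, (van_lin_iff _ _ _).2 h0⟩
  · rw [← totalDegree_prod' ms.toFinset (fun g => g) (fun g hg => (hirr g hg).ne_zero)]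
    apply totalDegree_le_of_dvd' hf
    exact (Multiset.toFinset_prod_dvd_prod ms).trans hms.dvd
lemma irr_deg_pos {g : Poly} (hg : Irreducible g) : 1 ≤ g.totalDegree := by
  by_contra h
  have h0 : g.totalDegree = 0 := by omega
  rw [totalDegree_eq_zero_iff_eq_C] at h0
  apply hg.not_isUnit
  rw [h0]
  apply IsUnit.map
  rw [isUnit_iff_ne_zero]
  intro h1; rw [h1] at h0; simp at h0; exact hg.ne_zero h0
def QH (Λ : Finset (Set E3)) (b : ℕ) : Prop := ∀ R : Poly, R ≠ 0 → R.totalDegree ≤ 2 → ∀ Λ' ⊆ Λ,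
  (∀ l ∈ Λ', Van R l) → Λ'.card ≤ b
lemma two_rich_core (c N : ℕ) (hN : 1 ≤ N) (Λ : Finset (Set E3)) (hΛ : ∀ l ∈ Λ, IsLine l)
    (hne : Λ.Nonempty) (hcard : Λ.card ≤ N ^ 2) (hq : QH Λ (c * N))
    (hM : ∀ l ∈ Λ, ∃ T : Finset E3, T.card = (6 * c + 24) * N ∧ ∀ x ∈ T, x ∈ l ∧ ∃ m ∈ Λ, m ≠ l ∧ x ∈ m) : False := by
  classical
  obtain ⟨C2, hC2⟩ : ∃ C2, C2 = 6 * c + 24 := ⟨_, rfl⟩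
  rw [← hC2] at hM
  obtain ⟨L, hL⟩ : ∃ L, L = Λ.card := ⟨_, rfl⟩
  have hL1 : 1 ≤ L := by rw [hL]; exact hne.card_pos
  have hMpos : 0 < C2 * N := by subst hC2; positivity
  obtain ⟨f, hf0, hfd, hfv⟩ := degree_reduction Λ hΛ (C2 * N) (3 * L / (C2 * N)) hM (by
    have := Nat.lt_div_mul_add (a := 3 * L) hMpos
    rw [← hL]; nlinarith)
  obtain ⟨Fs, hirr, hnd, -, hvan, hsum⟩ := factor_data f hf0
  obtain ⟨d, hd⟩ : ∃ d, d = ∑ g ∈ Fs, g.totalDegree := ⟨_, rfl⟩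
  have hd1 : d * (C2 * N) ≤ 3 * L := by
    have h1 : d ≤ 3 * L / (C2 * N) := by omega
    exact (Nat.mul_le_mul_right _ h1).trans (Nat.div_mul_le_self _ _)
  have hdN : d * C2 ≤ 3 * N := by
    have : (d * C2) * N ≤ (3 * N) * N := by nlinarith
    exact Nat.le_of_mul_le_mul_right this (by omega)
  have hd2 : d ^ 2 * C2 ^ 2 ≤ 9 * L := by
    have h1 : (d * C2) ^ 2 * N ^ 2 ≤ 9 * L * N ^ 2 := by
      have : (d * (C2 * N)) ^ 2 ≤ (3 * L) ^ 2 := Nat.pow_le_pow_left hd1 2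
      have : L * L ≤ L * N ^ 2 := Nat.mul_le_mul_left _ (hL ▸ hcard)
      nlinarith
    have := Nat.le_of_mul_le_mul_right h1 (by positivity)
    nlinarith
  have hgle : ∀ g ∈ Fs, g.totalDegree ≤ d := fun g hg => hd ▸
    Finset.single_le_sum (f := fun g : Poly => g.totalDegree) (fun _ _ => Nat.zero_le _) hg
  have hFc : Fs.card ≤ d := by
    rw [hd, Finset.card_eq_sum_ones]
    exact Finset.sum_le_sum fun g hg => irr_deg_pos (hirr g hg)
  choose! φ hφ using fun l (hl : l ∈ Λ) => hvan l (hΛ l hl) (hfv l hl)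
  let A1 := fun g : Poly => Λ.filter fun l => φ l = g ∧ g.totalDegree ≤ 2
  let A2 := fun p : Poly × Poly => Λ.filter fun l => p.1 ≠ p.2 ∧ Van p.1 l ∧ Van p.2 l
  let A3 := fun g : Poly => Λ.filter fun l => φ l = g ∧ 3 ≤ g.totalDegree ∧ ∀ g' ∈ Fs, g' ≠ g → ¬ Van g' l
  have hcov : Λ ⊆ (Fs.biUnion A1 ∪ (Fs ×ˢ Fs).biUnion A2) ∪ Fs.biUnion A3 := by
    intro l hl
    have := hφ l hl
    simp only [Finset.mem_union, Finset.mem_biUnion, A1, A2, A3, Finset.mem_filter, hl, true_and]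
    by_cases h1 : (φ l).totalDegree ≤ 2
    · exact Or.inl (Or.inl ⟨φ l, this.1, rfl, h1⟩)
    by_cases h2 : ∀ g' ∈ Fs, g' ≠ φ l → ¬ Van g' l
    · exact Or.inr ⟨φ l, this.1, rfl, by omega, h2⟩
    push Not at h2
    obtain ⟨g', hg', hne', hv'⟩ := h2
    exact Or.inl (Or.inr ⟨(g', φ l), Finset.mem_product.2 ⟨hg', this.1⟩, hne', hv', this.2⟩)
  have b1 : (Fs.biUnion A1).card ≤ d * (c * N) := by
    refine (Finset.card_biUnion_le_card_mul _ _ _ ?_).trans (Nat.mul_le_mul_right _ hFc)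
    intro g hg
    by_cases h2 : g.totalDegree ≤ 2
    · refine hq g (hirr g hg).ne_zero h2 _ (Finset.filter_subset _ _) ?_
      intro l hl
      obtain ⟨h3, h4, -⟩ := Finset.mem_filter.1 hl
      rw [← h4]; exact (hφ l h3).2
    · simp [A1, h2]
  have b2 : ((Fs ×ˢ Fs).biUnion A2).card ≤ d ^ 2 := by
    refine Finset.card_biUnion_le.trans ?_
    have : ∀ p ∈ Fs ×ˢ Fs, (A2 p).card ≤ p.1.totalDegree * p.2.totalDegree := by
      rintro ⟨g, g'⟩ hp
      obtain ⟨h1, h2⟩ := Finset.mem_product.1 hp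
      by_cases hgg : g = g'
      · simp [A2, hgg]
      refine bezout_irr g g' (hirr g h1) (hnd g h1 g' h2 hgg) _ ?_
      intro l hl
      obtain ⟨h3, h4, h5⟩ := Finset.mem_filter.1 hl
      exact ⟨hΛ l h3, h5⟩
    refine (Finset.sum_le_sum this).trans ?_
    rw [Finset.sum_product, hd, sq, Finset.sum_mul_sum]
  have b3 : (Fs.biUnion A3).card ≤ 15 * d ^ 2 := by
    refine Finset.card_biUnion_le.trans ?_
    have : ∀ g ∈ Fs, (A3 g).card ≤ 15 * d * g.totalDegree := by
      intro g hg
      by_cases h3 : 3 ≤ g.totalDegree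
      swap
      · simp [A3, h3]
      have : (A3 g).card ≤ 15 * g.totalDegree ^ 2 := by
        apply surface (hirr g hg) h3 (A3 g)
        · intro l hl
          obtain ⟨h4, h5, h6⟩ := Finset.mem_filter.1 hl
          exact ⟨hΛ l h4, h5 ▸ (hφ l h4).2⟩
        · intro l hl
          obtain ⟨h4, h5, -, h6⟩ := Finset.mem_filter.1 hl
          obtain ⟨T, hTc, hT⟩ := hM l h4
          refine ⟨T.filter fun x => ∃ m, IsLine m ∧ Van g m ∧ m ≠ l ∧ x ∈ m, ?_, ?_⟩
          · have h7 := Finset.card_filter_add_card_filter_not (s := T)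
              (fun x => ∃ m, IsLine m ∧ Van g m ∧ m ≠ l ∧ x ∈ m)
            have h8 : (T.filter fun x => ¬ ∃ m, IsLine m ∧ Van g m ∧ m ≠ l ∧ x ∈ m).card ≤ d := by
              have hsub : (T.filter fun x => ¬ ∃ m, IsLine m ∧ Van g m ∧ m ≠ l ∧ x ∈ m) ⊆
                  (Fs.erase g).biUnion fun g' => T.filter fun x => eval x g' = 0 := by
                intro x hx
                obtain ⟨hx1, hx2⟩ := Finset.mem_filter.1 hx
                obtain ⟨-, m, hm, hml, hxm⟩ := hT x hx1
                obtain ⟨h9, h10⟩ := hφ m hm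
                refine Finset.mem_biUnion.2 ⟨φ m, Finset.mem_erase.2 ⟨?_, h9⟩,
                  Finset.mem_filter.2 ⟨hx1, h10 x hxm⟩⟩
                intro h11
                exact hx2 ⟨m, hΛ m hm, h11 ▸ h10, hml, hxm⟩
              refine (Finset.card_le_card hsub).trans (Finset.card_biUnion_le.trans ?_)
              rw [hd]
              refine (Finset.sum_le_sum (g := fun g => g.totalDegree) ?_).trans
                (Finset.sum_le_sum_of_subset (Finset.erase_subset g Fs))
              intro g' hg'
              obtain ⟨h9, h10⟩ := Finset.mem_erase.1 hg'
              by_contra hcon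
              refine h6 g' h10 h9 (van_of_points (hΛ l h4) g' _ ?_ (not_le.1 hcon))
              intro x hx
              obtain ⟨hx1, hx2⟩ := Finset.mem_filter.1 hx
              exact ⟨(hT x hx1).1, hx2⟩
            have h9 := hgle g hg
            have : 16 * d < C2 * N := by
              have : 24 ≤ C2 := by omega
              nlinarith
            omega
          · intro x hx
            obtain ⟨hx1, hx2⟩ := Finset.mem_filter.1 hx
            exact ⟨(hT x hx1).1, hx2⟩
      have := hgle g hg
      nlinarith
    refine (Finset.sum_le_sum this).trans ?_
    rw [← Finset.mul_sum, ← hd]; nlinarith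
  have hfin := Finset.card_le_card hcov
  have := Finset.card_union_le (Fs.biUnion A1 ∪ (Fs ×ˢ Fs).biUnion A2) (Fs.biUnion A3)
  have := Finset.card_union_le (Fs.biUnion A1) ((Fs ×ˢ Fs).biUnion A2)
  have hfinal : L ≤ d * (c * N) + 16 * d ^ 2 := by omega
  have e1 : 2 * (d * (c * N)) ≤ L := by
    have : 6 * (d * (c * N)) ≤ d * (C2 * N) := by subst hC2; nlinarith [Nat.zero_le (d * N)]
    omega
  have e2 : 64 * d ^ 2 ≤ L := by
    have : 24 ^ 2 ≤ C2 ^ 2 := Nat.pow_le_pow_left (by omega) 2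
    nlinarith
  omega
theorem two_rich (c N : ℕ) (hN : 1 ≤ N) (n : ℕ) : ∀ (Λ : Finset (Set E3)), Λ.card = n → (∀ l ∈ Λ, IsLine l) →
    Λ.card ≤ N ^ 2 → QH Λ (c * N) → ∀ S : Finset E3,
    (∀ x ∈ S, ∃ l ∈ Λ, ∃ m ∈ Λ, l ≠ m ∧ x ∈ l ∧ x ∈ m) → S.card ≤ (6 * c + 24) * N * n := by
  classical
  induction n with
  | zero =>
    intro Λ h0 _ _ _ S hS
    rw [Finset.card_eq_zero] at h0
    subst h0
    have : S = ∅ := Finset.eq_empty_of_forall_notMem fun x hx => by simpa using hS x hx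
    simp [this]
  | succ n ih =>
    intro Λ hn hΛ hc hq S hS
    by_cases hex : ∃ l ∈ Λ, (S.filter (· ∈ l)).card ≤ (6 * c + 24) * N
    · obtain ⟨l, hl, hlc⟩ := hex
      have := ih (Λ.erase l) (by rw [Finset.card_erase_of_mem hl]; omega)
        (fun m hm => hΛ m (Finset.mem_of_mem_erase hm)) ((Finset.card_le_card (Finset.erase_subset _ _)).trans hc)
        (fun R h0 h1 Λ' h2 h3 => hq R h0 h1 Λ' (h2.trans (Finset.erase_subset _ _)) h3)
        (S.filter (· ∉ l)) (by
          intro x hx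
          obtain ⟨hx1, hx2⟩ := Finset.mem_filter.1 hx
          obtain ⟨p, hp, q, hq, hpq, h1, h2⟩ := hS x hx1
          exact ⟨p, Finset.mem_erase.2 ⟨fun h => hx2 (h ▸ h1), hp⟩, q,
            Finset.mem_erase.2 ⟨fun h => hx2 (h ▸ h2), hq⟩, hpq, h1, h2⟩)
      have h2 := Finset.card_filter_add_card_filter_not (s := S) (· ∈ l)
      rw [mul_add, mul_one]
      omega
    · exfalso
      push Not at hex
      refine two_rich_core c N hN Λ hΛ (Finset.card_pos.1 (by omega)) hc hq fun l hl => ?_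
      obtain ⟨T, hT, hTc⟩ := Finset.exists_subset_card_eq (hex l hl).le
      refine ⟨T, hTc, fun x hx => ?_⟩
      obtain ⟨hx1, hx2⟩ := Finset.mem_filter.1 (hT hx)
      refine ⟨hx2, ?_⟩
      obtain ⟨p, hp, q, hq, hpq, h1, h2⟩ := hS x hx1
      by_cases h : p = l
      · exact ⟨q, hq, fun h' => hpq (h.trans h'.symm), h2⟩
      · exact ⟨p, hp, h, h1⟩
end GK
namespace GK
open MvPolynomial
open scoped Matrix
lemma odd_root (p : Polynomial ℝ) (hm : p.Monic) (ho : Odd p.natDegree) : ∃ x, p.IsRoot x := by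
  have hd : 0 < p.natDegree := ho.pos
  have h1 := Polynomial.tendsto_atTop_of_leadingCoeff_nonneg p
    (Polynomial.natDegree_pos_iff_degree_pos.1 hd) (by simp [hm.leadingCoeff])
  have hn : (-(p.comp (-Polynomial.X))).natDegree = p.natDegree := by
    rw [Polynomial.natDegree_neg, Polynomial.natDegree_comp]; simp
  have h2 := Polynomial.tendsto_atTop_of_leadingCoeff_nonneg (-(p.comp (-Polynomial.X)))
    (Polynomial.natDegree_pos_iff_degree_pos.1 (by omega)) (by
      rw [Polynomial.leadingCoeff_neg, Polynomial.leadingCoeff_comp (by simp), hm.leadingCoeff]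
      simp [ho.neg_one_pow])
  obtain ⟨a, ha⟩ := (h1.eventually_ge_atTop 0).exists
  obtain ⟨b, hb⟩ := (h2.eventually_ge_atTop 0).exists
  simp only [Polynomial.eval_neg, Polynomial.eval_comp, Polynomial.eval_X] at hb
  obtain ⟨x, hx⟩ := mem_range_of_exists_le_of_exists_ge (c := (0:ℝ)) p.continuous
    ⟨-b, by linarith⟩ ⟨a, ha⟩
  exact ⟨x, hx⟩
lemma common_eigen {ι V : Type*} [AddCommGroup V] [Module ℝ V] (f : ι → Module.End ℝ V)
    (hc : ∀ i j v, f i (f j v) = f j (f i v)) (n : ℕ) : ∀ (W : Submodule ℝ V),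
    FiniteDimensional ℝ W → (∀ i, ∀ w ∈ W, f i w ∈ W) → Module.finrank ℝ W = n → Odd n →
    ∃ v ∈ W, v ≠ 0 ∧ ∀ i, ∃ μ : ℝ, f i v = μ • v := by
  induction n using Nat.strong_induction_on with
  | _ n ih =>
  intro W hfd hinv hn ho
  by_cases h : ∀ i, ∃ μ : ℝ, ∀ w ∈ W, f i w = μ • w
  · have : W ≠ ⊥ := by
      rintro rfl; simp at hn; subst hn; simp at ho
    obtain ⟨v, hv, hv0⟩ := (Submodule.ne_bot_iff _).1 this
    exact ⟨v, hv, hv0, fun i => (h i).imp fun μ hμ => hμ v hv⟩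
  push Not at h
  obtain ⟨i, hi⟩ := h
  let F : Module.End ℝ W := (f i).restrict (hinv i)
  obtain ⟨μ, hμ⟩ := odd_root F.charpoly F.charpoly_monic (by
    rw [LinearMap.charpoly_natDegree, hn]; exact ho)
  rw [← Module.End.hasEigenvalue_iff_isRoot_charpoly] at hμ
  obtain ⟨w, hw⟩ := hμ.exists_hasEigenvector
  have hw1 : f i w.1 = μ • w.1 := congrArg Subtype.val hw.apply_eq_smul
  have hw0 : w.1 ≠ 0 := fun h0 => hw.2 (Subtype.ext h0)
  let N : Module.End ℝ V := f i - μ • LinearMap.id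
  have hN : ∀ v, N v = f i v - μ • v := fun v => by simp [N]
  have hNc : ∀ j v, f j (N v) = N (f j v) := fun j v => by
    rw [hN, hN, map_sub, map_smul, hc]
  have hsum := LinearMap.finrank_range_add_finrank_ker (N.domRestrict W)
  have hr : LinearMap.range (N.domRestrict W) = W.map N := by
    rw [LinearMap.range_domRestrict]
  have hk : Module.finrank ℝ (LinearMap.ker (N.domRestrict W)) =
      Module.finrank ℝ (W ⊓ LinearMap.ker N : Submodule ℝ V) := by
    rw [LinearMap.ker_domRestrict]
    rw [← Submodule.map_comap_subtype]
    exact (LinearEquiv.finrank_eq (Submodule.equivMapOfInjective W.subtype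
      W.injective_subtype _))
  rw [hr, hk, hn] at hsum
  have hWK : FiniteDimensional ℝ (W ⊓ LinearMap.ker N : Submodule ℝ V) :=
    Submodule.finiteDimensional_of_le inf_le_left
  have hWM : FiniteDimensional ℝ (W.map N) := inferInstance
  have p1 : 0 < Module.finrank ℝ (W ⊓ LinearMap.ker N : Submodule ℝ V) := by
    rw [Module.finrank_pos_iff_exists_ne_zero]
    exact ⟨⟨w.1, w.2, by rw [SetLike.mem_coe, LinearMap.mem_ker, hN, hw1, sub_self]⟩,
      fun h0 => hw0 (congrArg Subtype.val h0)⟩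
  have p2 : 0 < Module.finrank ℝ (W.map N) := by
    rw [Module.finrank_pos_iff_exists_ne_zero]
    obtain ⟨u, hu, hne⟩ := hi μ
    refine ⟨⟨N u, Submodule.mem_map_of_mem hu⟩, fun h0 => hne ?_⟩
    have := congrArg Subtype.val h0
    simpa [hN, sub_eq_zero] using this
  by_cases h1 : Odd (Module.finrank ℝ (W ⊓ LinearMap.ker N : Submodule ℝ V))
  · obtain ⟨v, hv, h2⟩ := ih _ (by omega) _ hWK (fun j w hw => ⟨hinv j w hw.1, by
      rw [SetLike.mem_coe, LinearMap.mem_ker, ← hNc, LinearMap.mem_ker.1 hw.2, map_zero]⟩) rfl h1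
    exact ⟨v, hv.1, h2⟩
  · obtain ⟨v, hv, h2⟩ := ih (Module.finrank ℝ (W.map N)) (by omega) (W.map N) hWM (by
      rintro j _ ⟨u, hu, rfl⟩
      exact ⟨f j u, hinv j u hu, (hNc j u).symm⟩) rfl (by
      rw [Nat.odd_iff] at *; omega)
    refine ⟨v, ?_, h2⟩
    obtain ⟨u, hu, rfl⟩ := hv
    rw [hN]; exact W.sub_mem (hinv i u hu) (W.smul_mem _ hu)
end GK
namespace GK
open MvPolynomial
open scoped Matrix
section BU
set_option linter.unusedSectionVars false
variable {σ : Type} [Fintype σ] [DecidableEq σ]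
def GG (σ : Type) (n : ℕ) : Submodule ℝ (MvPolynomial σ ℝ) :=
  restrictSupport ℝ {c | c.degree < n ∧ c.degree % 2 = n % 2}
open scoped Pointwise in
lemma rs_mul {s t u : Set (σ →₀ ℕ)} (h : ∀ a ∈ s, ∀ b ∈ t, a + b ∈ u) {p q : MvPolynomial σ ℝ}
    (hp : p ∈ restrictSupport ℝ s) (hq : q ∈ restrictSupport ℝ t) :
    p * q ∈ restrictSupport ℝ u := by
  have : p * q ∈ restrictSupport ℝ (s + t) := by
    rw [restrictSupport_add]; exact Submodule.mul_mem_mul hp hq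
  refine restrictSupport_mono ℝ ?_ this
  rintro _ ⟨a, ha, b, hb, rfl⟩
  exact h a ha b hb
lemma mono_mem {s : Set (σ →₀ ℕ)} {c : σ →₀ ℕ} (h : c ∈ s) :
    monomial c (1:ℝ) ∈ restrictSupport ℝ s := by
  rw [monomial_mem_restrictSupport]; exact Or.inl h
def AA (c : σ →₀ ℕ) (p : MvPolynomial σ ℝ) : Prop := p - monomial c 1 ∈ GG σ c.degree
lemma AA.mul {c c' : σ →₀ ℕ} {p p' : MvPolynomial σ ℝ} (h : AA c p) (h' : AA c' p') :
    AA (c + c') (p * p') := by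
  unfold AA GG at *
  have e : p * p' - monomial (c + c') 1 = (p - monomial c 1) * (p' - monomial c' 1) +
      (p - monomial c 1) * monomial c' 1 + monomial c 1 * (p' - monomial c' 1) := by
    have : (monomial (c + c') (1:ℝ)) = monomial c 1 * monomial c' 1 := by
      rw [monomial_mul, one_mul]
    rw [this]; ring
  rw [e, map_add]
  refine Submodule.add_mem _ (Submodule.add_mem _ (rs_mul ?_ h h')
    (rs_mul ?_ h (mono_mem (Set.mem_singleton c')))) (rs_mul ?_ (mono_mem (Set.mem_singleton c)) h')
  · rintro a ⟨ha, ha'⟩ b ⟨hb, hb'⟩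
    simp only [Set.mem_ofPred_eq, map_add]; omega
  · rintro a ⟨ha, ha'⟩ b rfl
    simp only [Set.mem_ofPred_eq, map_add]; omega
  · rintro a rfl b ⟨ha, ha'⟩
    simp only [Set.mem_ofPred_eq, map_add]; omega
lemma AA.refl (c : σ →₀ ℕ) : AA c (monomial c 1) := by
  unfold AA; rw [sub_self]; exact Submodule.zero_mem _
lemma AA.pow {c : σ →₀ ℕ} {p : MvPolynomial σ ℝ} (h : AA c p) (n : ℕ) : AA (n • c) (p ^ n) := by
  induction n with
  | zero => simpa using AA.refl (0 : σ →₀ ℕ)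
  | succ n ih => rw [succ_nsmul, pow_succ]; exact ih.mul h
lemma AA.prod {ι : Type} (s : Finset ι) {c : ι → σ →₀ ℕ} {p : ι → MvPolynomial σ ℝ}
    (h : ∀ i ∈ s, AA (c i) (p i)) : AA (∑ i ∈ s, c i) (∏ i ∈ s, p i) := by
  classical
  induction s using Finset.induction_on with
  | empty => simpa using AA.refl (0 : σ →₀ ℕ)
  | insert a s ha ih =>
    rw [Finset.sum_insert ha, Finset.prod_insert ha]
    exact (h a (by simp)).mul (ih fun i hi => h i (by simp [hi]))
variable (d : σ → ℕ) (f : σ → MvPolynomial σ ℝ)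
def T0 (c : σ →₀ ℕ) : MvPolynomial σ ℝ := ∏ i, (f i ^ (c i / d i) * X i ^ (c i % d i))
def TT : MvPolynomial σ ℝ →ₗ[ℝ] MvPolynomial σ ℝ := (basisMonomials σ ℝ).constr ℝ (T0 d f)
lemma TT_mono (c : σ →₀ ℕ) : TT d f (monomial c 1) = T0 d f c := by
  have := (basisMonomials σ ℝ).constr_basis ℝ (T0 d f) c
  rwa [coe_basisMonomials] at this
lemma T0_AA (hf : ∀ i, AA (Finsupp.single i (d i)) (f i)) (c : σ →₀ ℕ) : AA c (T0 d f c) := by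
  have : AA (∑ i, Finsupp.single i (c i)) (T0 d f c) := by
    refine AA.prod _ fun i _ => ?_
    have h1 := (hf i).pow (c i / d i)
    have h2 := (AA.refl (Finsupp.single i 1)).pow (c i % d i)
    have h3 := h1.mul h2
    have e : (c i / d i) • Finsupp.single i (d i) + (c i % d i) • Finsupp.single i 1 =
        Finsupp.single i (c i) := by
      rw [Finsupp.smul_single, Finsupp.smul_single, ← Finsupp.single_add]
      congr 1
      simp [Nat.div_add_mod']
    rw [e] at h3
    exact h3
  rwa [Finsupp.univ_sum_single] at this
lemma T0_shift (hd : ∀ i, 0 < d i) (c : σ →₀ ℕ) (i : σ) :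
    T0 d f (c + Finsupp.single i (d i)) = f i * T0 d f c := by
  unfold T0
  rw [← Finset.mul_prod_erase _ _ (Finset.mem_univ i),
    ← Finset.mul_prod_erase (a := i) (f := fun i => f i ^ (c i / d i) * X i ^ (c i % d i)) _ (Finset.mem_univ i), ← mul_assoc]
  congr 1
  · simp [Nat.add_div_right _ (hd i), pow_succ]; ring
  · refine Finset.prod_congr rfl fun j hj => ?_
    have : i ≠ j := (Finset.ne_of_mem_erase hj).symm
    simp [this]
def LL (σ : Type) (e : Prop) (n : ℕ) : Submodule ℝ (MvPolynomial σ ℝ) :=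
  restrictSupport ℝ {c | c.degree < n ∧ (e → Even c.degree)}
lemma TT_lower (hf : ∀ i, AA (Finsupp.single i (d i)) (f i)) (e : Prop) (n : ℕ)
    (p : MvPolynomial σ ℝ) (hp : p ∈ LL σ e (n + 1)) : TT d f p - p ∈ LL σ e n := by
  have hle : LL σ e (n+1) ≤ (LL σ e n).comap (TT d f - LinearMap.id) := by
    unfold LL
    conv_lhs => rw [restrictSupport_eq_span]
    rw [Submodule.span_le]
    rintro _ ⟨c, ⟨hc, hc'⟩, rfl⟩
    simp only [SetLike.mem_coe, Submodule.mem_comap, LinearMap.sub_apply, LinearMap.id_apply, TT_mono]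
    refine restrictSupport_mono ℝ ?_ (T0_AA d f hf c)
    rintro b ⟨hb, hb'⟩
    refine ⟨by omega, fun he => ?_⟩
    have := hc' he
    rw [Nat.even_iff] at *; omega
  exact hle hp
lemma LL_zero {e : Prop} {p : MvPolynomial σ ℝ} (hp : p ∈ LL σ e 0) : p = 0 := by
  unfold LL at hp
  simpa [mem_restrictSupport_iff] using hp
lemma mem_LL (p : MvPolynomial σ ℝ) : p ∈ LL σ False (p.totalDegree + 1) := by
  unfold LL
  rw [mem_restrictSupport_iff]
  intro c hc
  refine ⟨Nat.lt_succ_of_le ?_, False.elim⟩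
  have := le_totalDegree hc
  simpa [Finsupp.degree_eq_sum, Finsupp.sum_fintype] using this
lemma TT_inj (hf : ∀ i, AA (Finsupp.single i (d i)) (f i)) : Function.Injective (TT d f) := by
  rw [injective_iff_map_eq_zero]
  intro p hp
  have : ∀ n, p ∈ LL σ False n → p = 0 := by
    intro n
    induction n with
    | zero => exact LL_zero
    | succ n ih =>
      intro h
      have := TT_lower d f hf _ n p h
      rw [hp, zero_sub] at this
      exact ih (by simpa using Submodule.neg_mem _ this)
  exact this _ (mem_LL p)
lemma TT_surj (hf : ∀ i, AA (Finsupp.single i (d i)) (f i)) (e : Prop) (n : ℕ) :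
    ∀ p ∈ LL σ e n, ∃ q ∈ LL σ e n, TT d f q = p := by
  induction n with
  | zero => exact fun p hp => ⟨0, Submodule.zero_mem _, by rw [map_zero, LL_zero hp]⟩
  | succ n ih =>
    intro p hp
    obtain ⟨q, hq, h⟩ := ih _ (TT_lower d f hf e n p hp)
    refine ⟨p - q, Submodule.sub_mem _ hp (restrictSupport_mono ℝ ?_ hq), by rw [map_sub, h]; ring⟩
    rintro b ⟨hb, hb'⟩
    exact ⟨by omega, hb'⟩
def JJ : Submodule ℝ (MvPolynomial σ ℝ) := restrictSupport ℝ {c | ∃ i, d i ≤ c i}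
lemma TT_shift (hd : ∀ i, 0 < d i) (i : σ) (q : MvPolynomial σ ℝ) :
    TT d f (q * monomial (Finsupp.single i (d i)) 1) = f i * TT d f q := by
  have : (TT d f) ∘ₗ (LinearMap.mulRight ℝ (monomial (Finsupp.single i (d i)) (1:ℝ))) =
      (LinearMap.mulLeft ℝ (f i)) ∘ₗ TT d f := by
    refine (basisMonomials σ ℝ).ext fun c => ?_
    simp only [coe_basisMonomials, LinearMap.comp_apply, LinearMap.mulRight_apply,
      LinearMap.mulLeft_apply, monomial_mul, one_mul, TT_mono]
    exact T0_shift d f hd c i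
  exact LinearMap.congr_fun this q
lemma ideal_le (hd : ∀ i, 0 < d i) (hf : ∀ i, AA (Finsupp.single i (d i)) (f i))
    (p : MvPolynomial σ ℝ) (hp : p ∈ Ideal.span (Set.range f)) : ∃ q ∈ JJ d, TT d f q = p := by
  obtain ⟨a, rfl⟩ := Ideal.mem_span_range_iff_exists_fun.1 hp
  have : ∀ i, ∃ q ∈ JJ d, TT d f q = a i * f i := by
    intro i
    obtain ⟨q, -, hq⟩ := TT_surj d f hf False _ (a i) (mem_LL (a i))
    refine ⟨q * monomial (Finsupp.single i (d i)) 1, ?_, by rw [TT_shift d f hd, hq, mul_comm]⟩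
    refine rs_mul (s := Set.univ) ?_ (by simp) (mono_mem (Set.mem_singleton _))
    rintro b - _ rfl
    exact ⟨i, by simp⟩
  choose q hq hq' using this
  exact ⟨∑ i, q i, Submodule.sum_mem _ fun i _ => hq i, by rw [map_sum]; simp [hq']⟩
lemma le_ideal (hd : ∀ i, 0 < d i) (q : MvPolynomial σ ℝ) (hq : q ∈ JJ d) :
    TT d f q ∈ Ideal.span (Set.range f) := by
  have : JJ d ≤ ((Ideal.span (Set.range f)).restrictScalars ℝ).comap (TT d f) := by
    unfold JJ
    rw [restrictSupport_eq_span, Submodule.span_le]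
    rintro _ ⟨c, ⟨i, hi⟩, rfl⟩
    simp only [SetLike.mem_coe, Submodule.mem_comap, Submodule.restrictScalars_mem, TT_mono]
    have : c = (c - Finsupp.single i (d i)) + Finsupp.single i (d i) :=
      (tsub_add_cancel_of_le (Finsupp.single_le_iff.2 hi)).symm
    rw [this, T0_shift d f hd]
    exact Ideal.mul_mem_right _ _ (Ideal.subset_span ⟨i, rfl⟩)
  exact this hq
def KK (σ : Type) : Submodule ℝ (MvPolynomial σ ℝ) := restrictSupport ℝ {c | Even c.degree}
def BB : Set (σ →₀ ℕ) := {c | (∀ i, c i < d i) ∧ Even c.degree}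
lemma LL_le_KK (n : ℕ) : LL σ True n ≤ KK σ :=
  restrictSupport_mono ℝ fun _ hc => hc.2 trivial
lemma mem_LL_K (p : MvPolynomial σ ℝ) (hp : p ∈ KK σ) : p ∈ LL σ True (p.totalDegree + 1) := by
  unfold LL
  rw [mem_restrictSupport_iff]
  intro c hc
  exact ⟨((mem_restrictSupport_iff ℝ).1 (mem_LL p) hc).1, fun _ => hp hc⟩
lemma finrank_W (hd : ∀ i, 0 < d i) (hf : ∀ i, AA (Finsupp.single i (d i)) (f i)) :
    Module.finrank ℝ ((KK σ).map (Ideal.Quotient.mkₐ ℝ (Ideal.span (Set.range f))).toLinearMap) =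
      Nat.card (BB d) := by
  let φ := ((Ideal.Quotient.mkₐ ℝ (Ideal.span (Set.range f))).toLinearMap ∘ₗ TT d f) ∘ₗ
    (restrictSupport ℝ (BB d)).subtype
  have hφ : ∀ q, φ q = Ideal.Quotient.mk (Ideal.span (Set.range f)) (TT d f q.1) := fun q => rfl
  have hinj : Function.Injective φ := by
    rw [injective_iff_map_eq_zero]
    intro q hq
    rw [hφ, Ideal.Quotient.eq_zero_iff_mem] at hq
    obtain ⟨r, hr, h⟩ := ideal_le d f hd hf _ hq
    have := TT_inj d f hf h
    rw [this] at hr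
    ext1
    change q.1 = 0
    rw [← support_eq_empty, Finset.eq_empty_iff_forall_notMem]
    intro c hc
    obtain ⟨i, hi⟩ := hr hc
    exact absurd ((q.2 hc).1 i) (by omega)
  have hrange : LinearMap.range φ =
      (KK σ).map (Ideal.Quotient.mkₐ ℝ (Ideal.span (Set.range f))).toLinearMap := by
    apply le_antisymm
    · rintro _ ⟨q, rfl⟩
      refine ⟨TT d f q.1, ?_, rfl⟩
      have h1 : q.1 ∈ KK σ := restrictSupport_mono ℝ (fun c hc => hc.2) q.2
      have h2 := TT_lower d f hf True _ q.1 (mem_LL_K _ h1)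
      have := Submodule.add_mem _ (LL_le_KK _ h2) h1
      simpa using this
    · rintro _ ⟨p, hp, rfl⟩
      obtain ⟨q, hq, rfl⟩ := TT_surj d f hf True _ p (mem_LL_K _ hp)
      have hle : KK σ ≤ restrictSupport ℝ (BB d) ⊔ JJ d := by
        conv_lhs => rw [KK, restrictSupport_eq_span]
        rw [Submodule.span_le]
        rintro _ ⟨c, hc, rfl⟩
        by_cases h : ∃ i, d i ≤ c i
        · exact Submodule.mem_sup_right (mono_mem h)
        · push Not at h
          exact Submodule.mem_sup_left (mono_mem ⟨h, hc⟩)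
      obtain ⟨b, hb, j, hj, rfl⟩ := Submodule.mem_sup.1 (hle (LL_le_KK _ hq))
      refine ⟨⟨b, hb⟩, ?_⟩
      rw [hφ]
      change _ = Ideal.Quotient.mk _ _
      rw [Ideal.Quotient.eq, map_add]
      simpa using le_ideal d f hd j hj
  rw [← hrange, LinearMap.finrank_range_of_inj hinj]
  exact Module.finrank_eq_nat_card_basis (basisRestrictSupport ℝ (BB d))
lemma card_BB (o : σ) (ho : d o = 6) (hodd : ∀ i, i ≠ o → Odd (d i)) : Odd (Nat.card (BB d)) := by
  let Q := Fintype.piFinset (fun i => Finset.range (d i))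
  have e1 : Nat.card (BB d) = (Q.filter fun c => Even (∑ i, c i)).card := by
    rw [← Fintype.card_coe, ← Nat.card_eq_fintype_card]
    refine Nat.card_congr (Equiv.subtypeEquiv Finsupp.equivFunOnFinite fun c => ?_)
    simp [Q, BB, Fintype.mem_piFinset, Finsupp.degree_eq_sum]
  have e2 := Finset.card_filter_add_card_filter_not (s := Q) (fun c => Even (∑ i, c i))
  have hsum : ∀ c ∈ Q, ∑ i, Function.update c o (5 - c o) i + 2 * c o = ∑ i, c i + 5 := by
    intro c hc
    have h6 := Fintype.mem_piFinset.1 hc o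
    rw [Finset.mem_range, ho] at h6
    rw [Finset.sum_update_of_mem (Finset.mem_univ o), ← Finset.add_sum_erase _ c (Finset.mem_univ o),
      Finset.sdiff_singleton_eq_erase]
    omega
  have hQ : ∀ c ∈ Q, Function.update c o (5 - c o) ∈ Q := by
    intro c hc
    rw [Fintype.mem_piFinset] at *
    intro i
    by_cases h : i = o
    · subst h; simp [ho]; omega
    · simpa [h] using hc i
  have hinv : ∀ c ∈ Q, Function.update (Function.update c o (5 - c o)) o
      (5 - Function.update c o (5 - c o) o) = c := by
    intro c hc
    have h6 := Fintype.mem_piFinset.1 hc o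
    rw [Finset.mem_range, ho] at h6
    rw [Function.update_self, Function.update_idem, show 5 - (5 - c o) = c o by omega,
      Function.update_eq_self]
  have e3 : (Q.filter fun c => Even (∑ i, c i)).card = (Q.filter fun c => ¬ Even (∑ i, c i)).card := by
    refine Finset.card_nbij' (fun c => Function.update c o (5 - c o))
      (fun c => Function.update c o (5 - c o)) ?_ ?_ ?_ ?_
    · intro c hc
      simp only [Finset.coe_filter, Set.mem_ofPred_eq] at *
      refine ⟨hQ c hc.1, ?_⟩
      have := hsum c hc.1
      have := hc.2
      rw [Nat.even_iff] at *; omega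
    · intro c hc
      simp only [Finset.coe_filter, Set.mem_ofPred_eq] at *
      refine ⟨hQ c hc.1, ?_⟩
      have := hsum c hc.1
      have := hc.2
      rw [Nat.even_iff] at *; omega
    · intro c hc
      exact hinv c (Finset.mem_filter.1 hc).1
    · intro c hc
      exact hinv c (Finset.mem_filter.1 hc).1
  have e4 : Q.card = 6 * ∏ i ∈ Finset.univ.erase o, d i := by
    rw [Fintype.card_piFinset, ← Finset.mul_prod_erase _ _ (Finset.mem_univ o)]
    simp [ho]
  have e5 : Odd (∏ i ∈ Finset.univ.erase o, d i) :=
    Finset.prod_induction _ _ (fun _ _ => Odd.mul) odd_one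
      fun i hi => hodd i (Finset.ne_of_mem_erase hi)
  rw [e1]
  obtain ⟨k, hk⟩ := e5
  rw [hk] at e4
  exact ⟨3 * k + 1, by omega⟩
lemma bu_alg (o : σ) (ho : d o = 6) (hodd : ∀ i, i ≠ o → Odd (d i))
    (hf : ∀ i, AA (Finsupp.single i (d i)) (f i))
    (hfo : f o = X o ^ 6 + (∑ i ∈ Finset.univ.erase o, X i ^ 2) - 1) :
    ∃ v : σ → ℝ, ∀ i, eval v (f i) = 0 := by
  have hd : ∀ i, 0 < d i := fun i => by
    by_cases h : i = o
    · subst h; omega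
    · exact (hodd i h).pos
  obtain ⟨mk, hmk⟩ : ∃ mk, mk = Ideal.Quotient.mkₐ ℝ (Ideal.span (Set.range f)) := ⟨_, rfl⟩
  have hmk0 : ∀ i, mk (f i) = 0 := fun i => by
    rw [hmk]; exact Ideal.Quotient.eq_zero_iff_mem.2 (Ideal.subset_span ⟨i, rfl⟩)
  have hfr := finrank_W d f hd hf
  rw [← hmk] at hfr
  have hB := card_BB d o ho hodd
  have hfd : FiniteDimensional ℝ ((KK σ).map mk.toLinearMap) :=
    FiniteDimensional.of_finrank_pos (by rw [hfr]; exact hB.pos)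
  obtain ⟨g, hgW, hg0, hg⟩ := common_eigen
    (fun ij : σ × σ => LinearMap.mulLeft ℝ (mk (X ij.1 * X ij.2)))
    (fun i j v => by simp only [LinearMap.mulLeft_apply]; ring) _ _ hfd (by
      rintro ⟨i, j⟩ _ ⟨p, hp, rfl⟩
      refine ⟨X i * X j * p, ?_, by simp [mul_assoc]⟩
      refine rs_mul (s := {c | Even c.degree}) ?_ ?_ hp
      · intro a ha b hb
        simp only [Set.mem_ofPred_eq, map_add] at *
        exact ha.add hb
      · have : (X i * X j : MvPolynomial σ ℝ) = monomial (Finsupp.single i 1 + Finsupp.single j 1) 1 := by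
          rw [X, X, monomial_mul, one_mul]
        rw [this]
        exact mono_mem (by simp)) hfr hB
  simp only [LinearMap.mulLeft_apply, Prod.forall] at hg
  choose μ hμ using hg
  have hcan : ∀ a b : ℝ, a • g = b • g → a = b := fun a b h => smul_left_injective ℝ hg0 h
  have hμ2 : ∀ i j k l, μ i j * μ k l = μ i k * μ j l := by
    intro i j k l
    apply hcan
    have h1 : mk (X i * X j) * (mk (X k * X l) * g) = (μ i j * μ k l) • g := by
      rw [hμ, mul_smul_comm, hμ, smul_smul, mul_comm]
    have h2 : mk (X i * X k) * (mk (X j * X l) * g) = (μ i k * μ j l) • g := by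
      rw [hμ, mul_smul_comm, hμ, smul_smul, mul_comm]
    rw [← h1, ← h2]; simp only [map_mul]; ring
  have hsum : μ o o ^ 3 + ∑ i ∈ Finset.univ.erase o, μ i i = 1 := by
    apply hcan
    have h1 : mk (f o) * g = 0 := by rw [hmk0, zero_mul]
    rw [hfo, map_sub, map_add, map_sum, map_one, sub_mul, one_mul, sub_eq_zero, add_mul,
      Finset.sum_mul] at h1
    have h6 : mk (X o ^ 6) * g = μ o o ^ 3 • g := by
      have : (X o ^ 6 : MvPolynomial σ ℝ) = (X o * X o) * ((X o * X o) * (X o * X o)) := by ring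
      rw [this, map_mul mk (X o * X o), map_mul mk (X o * X o) (X o * X o), mul_assoc, mul_assoc,
        hμ, mul_smul_comm, mul_smul_comm, hμ, mul_smul_comm, hμ, smul_smul, smul_smul]
      congr 1; ring
    have h2 : ∑ i ∈ Finset.univ.erase o, mk (X i ^ 2) * g =
        ∑ i ∈ Finset.univ.erase o, μ i i • g :=
      Finset.sum_congr rfl fun i _ => by rw [pow_two, hμ]
    rw [one_smul, add_smul, Finset.sum_smul, ← h6, ← h2, h1]
  obtain ⟨k, hk⟩ : ∃ k, 0 < μ k k := by
    by_contra! h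
    have h1 : μ o o ^ 3 ≤ 0 := by
      have := h o
      nlinarith [sq_nonneg (μ o o)]
    have h2 : ∑ i ∈ Finset.univ.erase o, μ i i ≤ 0 := Finset.sum_nonpos fun i _ => h i
    linarith
  have hsq := Real.mul_self_sqrt hk.le
  have hs0 : 0 < Real.sqrt (μ k k) := Real.sqrt_pos.2 hk
  obtain ⟨v, hv⟩ : ∃ v : σ → ℝ, v = fun i => μ i k / Real.sqrt (μ k k) := ⟨_, rfl⟩
  have hvv : ∀ i j, v i * v j = μ i j := by
    intro i j
    have hsym : μ j k = μ k j := hcan _ _ (by rw [← hμ, ← hμ, mul_comm (X j)])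
    have := hμ2 i k j k
    rw [hv]
    simp only
    rw [div_mul_div_comm, hsq, this]
    field_simp
  have hvk : v k ≠ 0 := fun h => by have := hvv k k; rw [h] at this; simp at this; linarith
  have hmono : ∀ n, ∀ c : σ →₀ ℕ, c.degree = 2 * n →
      mk (monomial c 1) * g = eval v (monomial c 1) • g := by
    intro n
    induction n with
    | zero =>
      intro c hc
      have : c = 0 := by rw [mul_zero] at hc; exact (Finsupp.degree_eq_zero_iff c).1 hc
      subst this
      simp [show (monomial (0 : σ →₀ ℕ) (1:ℝ)) = 1 from rfl]
    | succ n ih =>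
      intro c hc
      have step : ∀ c : σ →₀ ℕ, c.degree ≠ 0 → ∃ c' i, c = c' + Finsupp.single i 1 := by
        intro c hc
        have : c ≠ 0 := by rintro rfl; simp at hc
        obtain ⟨i, hi⟩ := Finsupp.ne_iff.1 this
        refine ⟨c - Finsupp.single i 1, i, (tsub_add_cancel_of_le (Finsupp.single_le_iff.2 ?_)).symm⟩
        exact Nat.one_le_iff_ne_zero.2 hi
      obtain ⟨c1, i, rfl⟩ := step c (by omega)
      rw [map_add, Finsupp.degree_single] at hc
      obtain ⟨c2, j, rfl⟩ := step c1 (by omega)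
      rw [map_add, Finsupp.degree_single] at hc
      have : monomial (c2 + Finsupp.single j 1 + Finsupp.single i 1) (1:ℝ) =
          monomial c2 1 * (X j * X i) := by
        rw [X, X, monomial_mul, monomial_mul, one_mul, one_mul, add_assoc]
      rw [this, map_mul mk, mul_assoc, hμ, mul_smul_comm, ih c2 (by omega), smul_smul,
        ← hvv]
      simp only [map_mul, eval_X]
      congr 1; ring
  have heven : ∀ p ∈ KK σ, mk p * g = eval v p • g := by
    intro p hp
    conv_lhs => rw [p.as_sum]
    conv_rhs => rw [p.as_sum]
    rw [map_sum, map_sum, Finset.sum_mul, Finset.sum_smul]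
    refine Finset.sum_congr rfl fun c hc => ?_
    have : monomial c (coeff c p) = coeff c p • monomial c (1:ℝ) := by
      rw [smul_monomial, smul_eq_mul, mul_one]
    obtain ⟨n, hn⟩ := hp hc
    rw [this, map_smul, smul_mul_assoc, hmono n c (by omega), smul_smul, smul_eval]
  refine ⟨v, fun i => ?_⟩
  have hz : ∀ p ∈ KK σ, mk p = 0 → eval v p = 0 := by
    intro p hp h
    apply hcan
    rw [← heven p hp, h, zero_mul, zero_smul]
  have hfi : f i ∈ restrictSupport ℝ {c | c.degree % 2 = d i % 2} := by
    have h1 : f i - monomial (Finsupp.single i (d i)) 1 ∈ restrictSupport ℝ {c | c.degree % 2 = d i % 2} :=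
      restrictSupport_mono ℝ (fun c hc => by simpa using hc.2) (hf i)
    have h2 : monomial (Finsupp.single i (d i)) (1:ℝ) ∈ restrictSupport ℝ {c | c.degree % 2 = d i % 2} :=
      mono_mem (by simp)
    simpa using Submodule.add_mem _ h1 h2
  by_cases h : i = o
  · refine hz _ (restrictSupport_mono ℝ ?_ hfi) (hmk0 i)
    intro c hc
    simp only [Set.mem_ofPred_eq, h, ho] at *
    rw [Nat.even_iff]; omega
  · have h1 := hz (X k * f i) (by
      refine rs_mul ?_ (mono_mem (Set.mem_singleton (Finsupp.single k 1))) hfi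
      rintro _ rfl b hb
      have := hodd i h
      simp only [Set.mem_ofPred_eq, map_add, Finsupp.degree_single] at *
      rw [Nat.odd_iff] at this
      rw [Nat.even_iff]; omega) (by rw [map_mul, hmk0, mul_zero])
    rw [map_mul, eval_X] at h1
    exact (mul_eq_zero.1 h1).resolve_left hvk
def SS (o : σ) : Set (σ → ℝ) := {v | v o ^ 6 + ∑ i ∈ Finset.univ.erase o, v i ^ 2 = 1}
lemma SS_bdd (o : σ) : ∀ v ∈ SS o, ∀ i, |v i| ≤ 1 := by
  intro v hv i
  have hv' : v o ^ 6 + ∑ i ∈ Finset.univ.erase o, v i ^ 2 = 1 := hv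
  have hnn : 0 ≤ ∑ i ∈ Finset.univ.erase o, v i ^ 2 := Finset.sum_nonneg fun i _ => sq_nonneg _
  by_cases h : i = o
  · subst h
    have : |v i| ^ 6 ≤ 1 := by
      rw [show |v i| ^ 6 = (|v i| ^ 2) ^ 3 by ring, sq_abs]; nlinarith
    exact (pow_le_one_iff_of_nonneg (abs_nonneg _) (by norm_num)).1 this
  · have h1 := Finset.single_le_sum (f := fun i => v i ^ 2) (fun i _ => sq_nonneg (v i))
      (Finset.mem_erase.2 ⟨h, Finset.mem_univ i⟩)
    have h2 : 0 ≤ v o ^ 6 := by positivity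
    rw [← sq_le_one_iff_abs_le_one]; linarith
lemma SS_compact (o : σ) : IsCompact (SS o) := by
  refine Metric.isCompact_of_isClosed_isBounded (isClosed_eq (by fun_prop) continuous_const) ?_
  refine (Metric.isBounded_closedBall (x := (0 : σ → ℝ)) (r := 1)).subset fun v hv => ?_
  rw [mem_closedBall_zero_iff, pi_norm_le_iff_of_nonneg zero_le_one]
  exact SS_bdd o v hv
lemma bu_poly (o : σ) (F : σ → MvPolynomial σ ℝ)
    (hF : ∀ i, F i ∈ restrictSupport ℝ {c : σ →₀ ℕ | Odd c.degree}) :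
    ∃ v : σ → ℝ, v o ^ 6 + ∑ i ∈ Finset.univ.erase o, v i ^ 2 = 1 ∧
      ∀ i, i ≠ o → eval v (F i) = 0 := by
  let D := 2 * (∑ i, (F i).totalDegree) + 1
  have hD : ∀ i, (F i).totalDegree < D := fun i => by
    have := Finset.single_le_sum (f := fun i => (F i).totalDegree) (fun _ _ => Nat.zero_le _)
      (Finset.mem_univ i)
    omega
  have hDodd : D % 2 = 1 := by omega
  let S : Set (σ → ℝ) := SS o
  have hb := SS_bdd o
  change ∀ v ∈ S, _ at hb
  have hex : ∀ t : ℝ, 0 < t → ∃ v ∈ S, ∀ i, i ≠ o → |eval v (F i)| ≤ t := by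
    intro t ht
    obtain ⟨v, hv⟩ := bu_alg (fun i => if i = o then 6 else D)
      (fun i => if i = o then X o ^ 6 + (∑ i ∈ Finset.univ.erase o, X i ^ 2) - 1
        else X i ^ D + C t⁻¹ * F i) o (by simp) (fun i hi => by
          simp only [if_neg hi]; exact Nat.odd_iff.2 hDodd) (fun i => by
        have hXp : ∀ (i : σ) n, monomial (Finsupp.single i n) (1:ℝ) = X i ^ n := fun i n => by
          rw [X_pow_eq_monomial]
        unfold AA GG
        by_cases h : i = o
        · subst h
          simp only [if_true, Finsupp.degree_single, hXp]
          rw [add_sub_assoc, add_sub_cancel_left]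
          refine Submodule.sub_mem _ (Submodule.sum_mem _ fun j _ => ?_) ?_
          · rw [← hXp]; exact mono_mem (by simp)
          · exact mono_mem (c := 0) (by simp)
        · simp only [if_neg h, Finsupp.degree_single, hXp]
          rw [add_sub_cancel_left, C_mul']
          refine Submodule.smul_mem _ _ fun c hc => ?_
          have h1 := hF i hc
          have h2 : c.degree ≤ (F i).totalDegree := by
            have := le_totalDegree hc
            simpa [Finsupp.degree_eq_sum, Finsupp.sum_fintype] using this
          have h3 := hD i
          simp only [Set.mem_ofPred_eq, Nat.odd_iff] at *
          omega) (by simp)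
    have hvS : v ∈ S := by
      have := hv o
      simp only [if_true, map_sub, map_add, map_pow, map_sum, eval_X, map_one] at this
      simp only [S, SS, Set.mem_ofPred_eq]; linarith
    refine ⟨v, hvS, fun i hi => ?_⟩
    have := hv i
    simp only [if_neg hi, map_add, map_mul, map_pow, eval_X, eval_C] at this
    have e : eval v (F i) = - (t * v i ^ D) := by
      field_simp at this; linarith
    rw [e, abs_neg, abs_mul, abs_pow, abs_of_pos ht]
    exact mul_le_of_le_one_right ht.le (pow_le_one₀ (abs_nonneg _) (hb v hvS i))
  have hS : IsCompact S := SS_compact o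
  obtain ⟨v0, hv0, -⟩ := hex 1 one_pos
  obtain ⟨v, hvS, hv⟩ := hS.exists_isMinOn ⟨v0, hv0⟩
    (f := fun v => ∑ i ∈ Finset.univ.erase o, |eval v (F i)|)
    (continuous_finsetSum _ fun i _ => ((F i).continuous_eval).abs).continuousOn
  have h0 : ∑ i ∈ Finset.univ.erase o, |eval v (F i)| ≤ 0 := by
    refine le_of_forall_pos_le_add fun ε hε => ?_
    obtain ⟨w, hw, h⟩ := hex (ε / (Fintype.card σ + 1)) (by positivity)
    refine (hv hw).trans ?_
    refine (Finset.sum_le_sum fun i hi => h i (Finset.ne_of_mem_erase hi)).trans ?_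
    rw [Finset.sum_const, nsmul_eq_mul, zero_add]
    have : ((Finset.univ.erase o).card : ℝ) ≤ Fintype.card σ + 1 := by
      exact_mod_cast ((Finset.card_erase_le).trans (Nat.le_succ _))
    calc _ ≤ ((Fintype.card σ : ℝ) + 1) * (ε / (Fintype.card σ + 1)) := by gcongr
      _ = ε := by field_simp
  refine ⟨v, hvS, fun i hi => ?_⟩
  have := Finset.single_le_sum (f := fun i => |eval v (F i)|) (fun i _ => abs_nonneg _)
        (Finset.mem_erase.2 ⟨hi, Finset.mem_univ i⟩)
  exact abs_nonpos_iff.1 (this.trans h0)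
end BU
end GK
namespace GK
open MvPolynomial
open scoped Matrix
lemma odd_approx (η R : ℝ) (hη : 0 < η) : ∃ ψ : Polynomial ℝ,
    (∀ n, ψ.coeff n ≠ 0 → Odd n) ∧ ∀ t, |t| ≤ R → |ψ.eval t| ≤ 1 + η ∧
      (η ≤ t → 1 - η ≤ ψ.eval t) ∧ (t ≤ -η → ψ.eval t ≤ -(1 - η)) := by
  let g : ℝ → ℝ := fun t => max (-1) (min 1 (t / η))
  have hg : Continuous g := by fun_prop
  have hodd : ∀ t, g (-t) = - g t := by
    intro t
    simp only [g, neg_div]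
    rcases le_total (t/η) 1 with h | h <;> rcases le_total (t/η) (-1) with h' | h'
    · rw [min_eq_right h, max_eq_left h', min_eq_left (by linarith), max_eq_right (by linarith)]; ring
    · rw [min_eq_right h, max_eq_right h', min_eq_right (by linarith), max_eq_right (by linarith)]
    · linarith
    · rw [min_eq_left h, max_eq_right (a := (-1:ℝ)) (b := 1) (by norm_num), min_eq_right (by linarith), max_eq_left (by linarith)]
  obtain ⟨q, hq⟩ := exists_polynomial_near_of_continuousOn (-R) R g hg.continuousOn η hη
  refine ⟨Polynomial.C (1/2) * (q - q.comp (-Polynomial.X)), ?_, ?_⟩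
  · intro n hn
    by_contra h
    rw [Nat.not_odd_iff_even] at h
    apply hn
    rw [Polynomial.coeff_C_mul, Polynomial.coeff_sub,
      show (-Polynomial.X : Polynomial ℝ) = Polynomial.C (-1) * Polynomial.X by simp,
      Polynomial.comp_C_mul_X_coeff, h.neg_one_pow]
    ring
  · intro t ht
    rw [abs_le] at ht
    have h1 := hq t ⟨ht.1, ht.2⟩
    have h2 := hq (-t) ⟨by linarith, by linarith⟩
    rw [hodd] at h2
    simp only [Polynomial.eval_mul, Polynomial.eval_C, Polynomial.eval_sub, Polynomial.eval_comp,
      Polynomial.eval_neg, Polynomial.eval_X]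
    rw [abs_lt] at h1 h2
    have h3 : -1 ≤ g t := le_max_left _ _
    have h4 : g t ≤ 1 := max_le (by norm_num) (min_le_left _ _)
    refine ⟨abs_le.2 ⟨by linarith, by linarith⟩, fun h => ?_, fun h => ?_⟩
    · have : g t = 1 := by
        have : 1 ≤ t / η := by rwa [le_div_iff₀ hη, one_mul]
        simp [g, min_eq_left this]
      linarith
    · have : g t = -1 := by
        have : t / η ≤ -1 := by rw [div_le_iff₀ hη]; linarith
        simp only [g]
        rw [max_eq_left]; exact (min_le_right _ _).trans this
      linarith
lemma aeval_odd {σ : Type} [Fintype σ] (ψ : Polynomial ℝ) (hψ : ∀ n, ψ.coeff n ≠ 0 → Odd n)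
    (ℓ : MvPolynomial σ ℝ) (hℓ : ℓ.IsHomogeneous 1) :
    Polynomial.aeval ℓ ψ ∈ restrictSupport ℝ {c : σ →₀ ℕ | Odd c.degree} := by
  rw [Polynomial.aeval_eq_sum_range]
  refine Submodule.sum_mem _ fun n _ => ?_
  by_cases h : ψ.coeff n = 0
  · rw [h, zero_smul]; exact Submodule.zero_mem _
  refine Submodule.smul_mem _ _ fun c hc => ?_
  have h1 := (hℓ.pow n) (mem_support_iff.1 hc)
  have h2 := hψ n h
  have h3 : c.degree = n := by
    rw [one_mul] at h1; rw [Finsupp.degree_eq_weight_one]; exact h1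
  simpa [h3] using h2
lemma ham_sandwich {σ : Type} [Fintype σ] [DecidableEq σ] (o : σ) (b : σ → Poly)
    (S : σ → Finset E3) : ∃ c : σ → ℝ, c ≠ 0 ∧ ∀ i, i ≠ o →
      2 * ((S i).filter fun x => 0 < eval x (∑ k, c k • b k)).card ≤ (S i).card ∧
      2 * ((S i).filter fun x => eval x (∑ k, c k • b k) < 0).card ≤ (S i).card := by
  obtain ⟨ev, hev⟩ : ∃ ev : (σ → ℝ) → E3 → ℝ, ev = fun c x => ∑ k, c k * eval x (b k) := ⟨_, rfl⟩
  have hev' : ∀ c x, eval x (∑ k, c k • b k) = ev c x := by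
    intro c x; rw [hev]; simp [smul_eval]
  simp only [hev']
  have hcont : ∀ x, Continuous fun c => ev c x := by
    intro x; rw [hev]; fun_prop
  let K : Set (σ → ℝ) := SS o
  have hb : ∀ v ∈ K, ∀ i, |v i| ≤ 1 := SS_bdd o
  have hK : IsCompact K := SS_compact o
  obtain ⟨M, hM⟩ : ∃ M : ℝ, ∀ i, ((S i).card : ℝ) ≤ M :=
    ⟨∑ i, ((S i).card : ℝ), fun i => Finset.single_le_sum (f := fun i => ((S i).card : ℝ))
      (fun _ _ => by positivity) (Finset.mem_univ i)⟩
  have hex : ∀ η : ℝ, 0 < η → M * η < 1 → ∃ c ∈ K, ∀ i, i ≠ o →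
      2 * ((S i).filter fun x => η ≤ ev c x).card ≤ (S i).card ∧
      2 * ((S i).filter fun x => ev c x ≤ -η).card ≤ (S i).card := by
    intro η hη hη1
    obtain ⟨R, hR⟩ : ∃ R : ℝ, ∀ c ∈ K, ∀ i, ∀ x ∈ S i, |ev c x| ≤ R := by
      refine ⟨∑ i, ∑ x ∈ S i, ∑ k, |eval x (b k)|, fun c hc i x hx => ?_⟩
      have h1 : |ev c x| ≤ ∑ k, |eval x (b k)| := by
        rw [hev]
        refine (Finset.abs_sum_le_sum_abs _ _).trans (Finset.sum_le_sum fun k _ => ?_)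
        rw [abs_mul]; exact mul_le_of_le_one_left (abs_nonneg _) (hb c hc k)
      have hn : ∀ x, 0 ≤ ∑ k, |eval x (b k)| := fun x => Finset.sum_nonneg fun k _ => abs_nonneg _
      refine h1.trans ((Finset.single_le_sum (f := fun x => ∑ k, |eval x (b k)|)
        (fun x _ => hn x) hx).trans ?_)
      exact Finset.single_le_sum (f := fun i => ∑ x ∈ S i, ∑ k, |eval x (b k)|)
        (fun i _ => Finset.sum_nonneg fun x _ => hn x) (Finset.mem_univ i)
    obtain ⟨ψ, hψ, hψ2⟩ := odd_approx η R hη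
    obtain ⟨c, hc, h⟩ := bu_poly o (fun i => ∑ x ∈ S i,
      Polynomial.aeval (∑ k, C (eval x (b k)) * X k : MvPolynomial σ ℝ) ψ) (fun i =>
        Submodule.sum_mem _ fun x _ => aeval_odd ψ hψ _ (by
          refine IsHomogeneous.sum _ _ _ fun k _ => ?_
          simpa using (isHomogeneous_C σ (eval x (b k))).mul (isHomogeneous_X ℝ k)))
    refine ⟨c, hc, fun i hi => ?_⟩
    have h0 : ∑ x ∈ S i, ψ.eval (ev c x) = 0 := by
      rw [← h i hi, map_sum]
      refine Finset.sum_congr rfl fun x _ => ?_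
      rw [← MvPolynomial.coe_aeval_eq_eval, RingHom.coe_coe, ← Polynomial.aeval_algHom_apply, map_sum, hev]
      simp [Polynomial.aeval_def, mul_comm]
    have hMi := hM i
    constructor
    · have h1 := Finset.sum_filter_add_sum_filter_not (S i) (fun x => η ≤ ev c x) (fun x => ψ.eval (ev c x))
      have h2 := Finset.card_filter_add_card_filter_not (s := S i) (fun x => η ≤ ev c x)
      have h3 := Finset.card_nsmul_le_sum ((S i).filter fun x => η ≤ ev c x) (fun x => ψ.eval (ev c x))
        (1 - η) (fun x hx => by
          rw [Finset.mem_filter] at hx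
          exact (hψ2 _ (hR c hc i x hx.1)).2.1 hx.2)
      have h4 := Finset.card_nsmul_le_sum ((S i).filter fun x => ¬ η ≤ ev c x) (fun x => ψ.eval (ev c x))
        (-(1 + η)) (fun x hx => by
          rw [Finset.mem_filter] at hx
          exact (abs_le.1 (hψ2 _ (hR c hc i x hx.1)).1).1)
      rw [nsmul_eq_mul] at h3 h4
      rw [h0] at h1
      rw [← h2] at hMi ⊢
      generalize ((S i).filter fun x => η ≤ ev c x).card = A at *
      generalize ((S i).filter fun x => ¬ η ≤ ev c x).card = B at *
      push_cast at hMi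
      have : (A : ℝ) < B + 1 := by nlinarith
      have : A < B + 1 := by exact_mod_cast this
      omega
    · have h1 := Finset.sum_filter_add_sum_filter_not (S i) (fun x => ev c x ≤ -η) (fun x => ψ.eval (ev c x))
      have h2 := Finset.card_filter_add_card_filter_not (s := S i) (fun x => ev c x ≤ -η)
      have h3 := Finset.sum_le_card_nsmul ((S i).filter fun x => ev c x ≤ -η) (fun x => ψ.eval (ev c x))
        (-(1 - η)) (fun x hx => by
          rw [Finset.mem_filter] at hx
          exact (hψ2 _ (hR c hc i x hx.1)).2.2 hx.2)
      have h4 := Finset.sum_le_card_nsmul ((S i).filter fun x => ¬ ev c x ≤ -η) (fun x => ψ.eval (ev c x))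
        (1 + η) (fun x hx => by
          rw [Finset.mem_filter] at hx
          exact (abs_le.1 (hψ2 _ (hR c hc i x hx.1)).1).2)
      rw [nsmul_eq_mul] at h3 h4
      rw [h0] at h1
      rw [← h2] at hMi ⊢
      generalize ((S i).filter fun x => ev c x ≤ -η).card = A at *
      generalize ((S i).filter fun x => ¬ ev c x ≤ -η).card = B at *
      push_cast at hMi
      have : (A : ℝ) < B + 1 := by nlinarith
      have : A < B + 1 := by exact_mod_cast this
      omega
  have hη : ∀ n : ℕ, M * (1 / ((n : ℝ) + 1 + |M|)) < 1 := by
    intro n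
    have : 0 < (n : ℝ) + 1 + |M| := by positivity
    rw [mul_one_div, div_lt_one this]
    have := le_abs_self M
    have : (0:ℝ) ≤ n := by positivity
    linarith
  choose c hcK hc using fun n : ℕ => hex (1 / ((n : ℝ) + 1 + |M|)) (by positivity) (hη n)
  obtain ⟨v, hvK, φ, hφ, hlim⟩ := hK.tendsto_subseq hcK
  have htend : Filter.Tendsto (fun n : ℕ => 1 / (((φ n : ℕ) : ℝ) + 1 + |M|)) Filter.atTop (nhds 0) := by
    have h1 : Filter.Tendsto (fun n : ℕ => 1 / ((n : ℝ) + 1 + |M|)) Filter.atTop (nhds 0) := by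
      simp only [one_div]
      refine Filter.Tendsto.inv_tendsto_atTop ?_
      refine Filter.tendsto_atTop_add_const_right _ _ (Filter.tendsto_atTop_add_const_right _ _ ?_)
      exact tendsto_natCast_atTop_atTop
    exact h1.comp hφ.tendsto_atTop
  refine ⟨v, ?_, fun i hi => ?_⟩
  · rintro rfl
    simp [K, SS] at hvK
  have hlx : ∀ x, Filter.Tendsto (fun n => ev (c (φ n)) x) Filter.atTop (nhds (ev v x)) := fun x =>
    ((hcont x).tendsto v).comp hlim
  constructor
  · have h1 : ∀ᶠ n in Filter.atTop, ∀ x ∈ (S i).filter fun x => 0 < ev v x,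
        1 / (((φ n : ℕ) : ℝ) + 1 + |M|) < ev (c (φ n)) x := by
      rw [Filter.eventually_all_finset]
      intro x hx
      exact htend.eventually_lt (hlx x) (Finset.mem_filter.1 hx).2
    obtain ⟨n, hn⟩ := h1.exists
    refine le_trans (Nat.mul_le_mul_left 2 (Finset.card_le_card fun x hx => ?_)) (hc (φ n) i hi).1
    exact Finset.mem_filter.2 ⟨(Finset.mem_filter.1 hx).1, (hn x hx).le⟩
  · have h1 : ∀ᶠ n in Filter.atTop, ∀ x ∈ (S i).filter fun x => ev v x < 0,
        ev (c (φ n)) x < -(1 / (((φ n : ℕ) : ℝ) + 1 + |M|)) := by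
      rw [Filter.eventually_all_finset]
      intro x hx
      refine (hlx x).eventually_lt htend.neg ?_
      rw [neg_zero]; exact (Finset.mem_filter.1 hx).2
    obtain ⟨n, hn⟩ := h1.exists
    refine le_trans (Nat.mul_le_mul_left 2 (Finset.card_le_card fun x hx => ?_)) (hc (φ n) i hi).2
    exact Finset.mem_filter.2 ⟨(Finset.mem_filter.1 hx).1, (hn x hx).le⟩
end GK
namespace GK
open MvPolynomial
open scoped Matrix
lemma card_image_factor {α β γ : Type*} [DecidableEq β] [DecidableEq γ] (T : Finset α) (a : α → β)
    (b : α → γ) (h : ∀ x ∈ T, ∀ y ∈ T, a x = a y → b x = b y) :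
    (T.image b).card ≤ (T.image a).card := by
  have h1 : T.image b = (T.image fun x => (a x, b x)).image Prod.snd := by
    rw [Finset.image_image]; rfl
  have h2 : T.image a = (T.image fun x => (a x, b x)).image Prod.fst := by
    rw [Finset.image_image]; rfl
  rw [h1, h2, Finset.card_image_of_injOn (f := Prod.fst)]
  · exact Finset.card_image_le
  · intro p hp q hq hpq
    simp only [Finset.coe_image, Set.mem_image, Finset.mem_coe] at hp hq
    obtain ⟨x, hx, rfl⟩ := hp
    obtain ⟨y, hy, rfl⟩ := hq
    exact Prod.ext hpq (h x hx y hy hpq)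
def lab {n : ℕ} (F : Fin n → Poly) (x : E3) : Fin n → Bool := fun k => decide (0 < eval x (F k))
lemma line_cells {n : ℕ} (F : Fin n → Poly) {l : Set E3} (hl : IsLine l)
    (hv : ¬ Van (∏ k, F k) l) (T : Finset E3)
    (hT : ∀ x ∈ T, x ∈ l ∧ eval x (∏ k, F k) ≠ 0) :
    (T.image (lab F)).card ≤ (∏ k, F k).totalDegree + 1 := by
  classical
  obtain ⟨a, v, hv0, rfl⟩ := hl
  obtain ⟨f, hf⟩ : ∃ f, f = ∏ k, F k := ⟨_, rfl⟩
  rw [← hf] at hv hT ⊢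
  rw [van_lin_iff] at hv
  obtain ⟨p, hp⟩ : ∃ p, p = restr a v f := ⟨_, rfl⟩
  rw [← hp] at hv
  have hpar : ∀ x : E3, ∃ t : ℝ, x ∈ lin a v → x = a + t • v := by
    intro x
    by_cases h : x ∈ lin a v
    · obtain ⟨t, ht⟩ := h
      exact ⟨t, fun _ => ht⟩
    · exact ⟨0, fun h' => absurd h' h⟩
  choose t ht using hpar
  have hpe : ∀ s : ℝ, p.eval s = eval (a + s • v) f := fun s => by rw [hp, eval_restr]
  have hroot : ∀ s : ℝ, ∀ k, eval (a + s • v) (F k) = 0 → s ∈ p.roots.toFinset := by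
    intro s k h
    rw [Multiset.mem_toFinset, Polynomial.mem_roots hv, Polynomial.IsRoot, hpe, hf, map_prod]
    exact Finset.prod_eq_zero (Finset.mem_univ k) h
  let nr : E3 → ℕ := fun x => (p.roots.toFinset.filter fun s => s < t x).card
  have key : ∀ x ∈ T, ∀ y ∈ T, t x ≤ t y → nr x = nr y → lab F x = lab F y := by
    intro x hx y hy hxy hnr
    have hsub : (p.roots.toFinset.filter fun s => s < t x) =
        (p.roots.toFinset.filter fun s => s < t y) := by
      refine Finset.eq_of_subset_of_card_le ?_ hnr.ge
      intro s hs
      rw [Finset.mem_filter] at *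
      exact ⟨hs.1, hs.2.trans_le hxy⟩
    have hno : ∀ s ∈ p.roots.toFinset, t x ≤ s → s ≤ t y → False := by
      intro s hs h1 h2
      rcases h2.lt_or_eq with h2 | h2
      · have : s ∈ p.roots.toFinset.filter fun s => s < t x := by
          rw [hsub]; exact Finset.mem_filter.2 ⟨hs, h2⟩
        exact absurd (Finset.mem_filter.1 this).2 (not_lt.2 h1)
      · rw [Multiset.mem_toFinset, Polynomial.mem_roots hv, Polynomial.IsRoot, hpe, h2,
          ← ht y (hT y hy).1] at hs
        exact (hT y hy).2 hs
    have hx' := ht x (hT x hx).1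
    have hy' := ht y (hT y hy).1
    funext k
    have hc : ContinuousOn (fun s : ℝ => eval (a + s • v) (F k)) (Set.Icc (t x) (t y)) := by
      refine Continuous.continuousOn ?_
      exact (F k).continuous_eval.comp (by fun_prop)
    simp only [lab, decide_eq_decide]
    by_contra hne
    have h01 : (0 : ℝ) ∈ (fun s : ℝ => eval (a + s • v) (F k)) '' Set.Icc (t x) (t y) := by
      by_cases h : 0 < eval x (F k)
      · apply intermediate_value_Icc' hxy hc
        rw [← hx', ← hy']
        refine ⟨?_, h.le⟩
        by_contra h2; exact hne ⟨fun _ => not_le.1 h2, fun _ => h⟩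
      · apply intermediate_value_Icc hxy hc
        rw [← hx', ← hy']
        refine ⟨not_lt.1 h, ?_⟩
        by_contra h2
        exact hne ⟨fun h' => absurd h' h, fun h' => absurd h'.le h2⟩
    obtain ⟨s, hs, h0⟩ := h01
    exact hno s (hroot s k h0) hs.1 hs.2
  refine (card_image_factor T nr (lab F) fun x hx y hy h => ?_).trans ?_
  · rcases le_total (t x) (t y) with h1 | h1
    · exact key x hx y hy h1 h
    · exact (key y hy x hx h1 h.symm).symm
  · have : T.image nr ⊆ Finset.range (f.totalDegree + 1) := by
      intro m hm
      obtain ⟨x, -, rfl⟩ := Finset.mem_image.1 hm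
      rw [Finset.mem_range, Nat.lt_succ_iff]
      refine (Finset.card_filter_le _ _).trans ((Multiset.toFinset_card_le _).trans
        ((Polynomial.card_roots' p).trans ?_))
      rw [hp]; exact natDegree_restr_le _ _ _
    simpa using Finset.card_le_card this
lemma step_poly (i e : ℕ) (he : 2 ^ i + 1 ≤ (e + 3).choose 3) (S : (Fin i → Bool) → Finset E3) :
    ∃ p : Poly, p ≠ 0 ∧ p.totalDegree ≤ e ∧ ∀ s,
      2 * ((S s).filter fun x => 0 < eval x p).card ≤ (S s).card ∧
      2 * ((S s).filter fun x => eval x p < 0).card ≤ (S s).card := by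
  classical
  have hfd : FiniteDimensional ℝ (PP e) := FiniteDimensional.of_finrank_pos (by
    rw [finrank_PP]; exact Nat.choose_pos (by omega))
  let bs := Module.finBasis ℝ (PP e)
  have hcard : Fintype.card (Option (Fin i → Bool)) ≤ Fintype.card (Fin (Module.finrank ℝ (PP e))) := by
    rw [finrank_PP]; simpa using he
  obtain ⟨em⟩ := Function.Embedding.nonempty_of_card_le hcard
  obtain ⟨c, hc0, hc⟩ := ham_sandwich (none : Option (Fin i → Bool)) (fun k => (bs (em k)).1)
    (fun k => k.elim ∅ S)
  refine ⟨∑ k, c k • (bs (em k)).1, ?_, ?_, fun s => hc (some s) (by simp)⟩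
  · intro h
    apply hc0
    have hli := bs.linearIndependent.comp em em.injective
    rw [Fintype.linearIndependent_iff] at hli
    funext k
    refine hli c ?_ k
    ext1
    simpa using h
  · have : ∑ k, c k • (bs (em k)).1 ∈ PP e :=
      Submodule.sum_mem _ fun k _ => Submodule.smul_mem _ _ (bs (em k)).2
    exact (mem_restrictTotalDegree _ _ _).1 this
lemma partition_aux (S : Finset E3) (n : ℕ) : ∃ F : Fin n → Poly, (∀ k, F k ≠ 0) ∧
    (∀ k, (F k).totalDegree ≤ 4 * 2 ^ ((k : ℕ) / 3)) ∧
    ∀ s, 2 ^ n * (S.filter fun x => eval x (∏ k, F k) ≠ 0 ∧ lab F x = s).card ≤ S.card := by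
  induction n with
  | zero =>
    refine ⟨Fin.elim0, fun k => k.elim0, fun k => k.elim0, fun s => ?_⟩
    simpa using Finset.card_filter_le _ _
  | succ n ih =>
    obtain ⟨F, h0, hd, hF⟩ := ih
    have hch : 2 ^ n + 1 ≤ (4 * 2 ^ (n / 3) + 3).choose 3 := by
      have h1 : 2 ^ n ≤ 4 * (2 ^ (n / 3)) ^ 3 := by
        rw [← pow_mul, show 4 = 2 ^ 2 by norm_num, ← pow_add]
        exact Nat.pow_le_pow_right (by norm_num) (by omega)
      have hm : 1 ≤ 2 ^ (n/3) := Nat.one_le_two_pow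
      generalize 2 ^ (n/3) = m at *
      have h3 : (4 * m + 3).choose 3 * 6 = (4*m+3)*(4*m+2)*(4*m+1) := by
        have := Nat.descFactorial_eq_factorial_mul_choose (4*m+3) 3
        simp [Nat.descFactorial, Nat.factorial] at this
        rw [mul_comm, ← this]; ring
      have h5 : 1 ≤ m ^ 3 := Nat.one_le_pow _ _ hm
      nlinarith [Nat.zero_le (m ^ 2)]
    obtain ⟨p, hp0, hpd, hp⟩ := step_poly n _ hch
      (fun s => S.filter fun x => eval x (∏ k, F k) ≠ 0 ∧ lab F x = s)
    refine ⟨Fin.snoc F p, ?_, ?_, fun s => ?_⟩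
    · intro k
      refine Fin.lastCases ?_ (fun k => ?_) k
      · simpa using hp0
      · simpa using h0 k
    · intro k
      refine Fin.lastCases ?_ (fun k => ?_) k
      · simpa using hpd
      · simpa using hd k
    · have h1 := hp (fun k => s k.castSucc)
      have h2 := hF (fun k => s k.castSucc)
      rw [pow_succ]
      have hlab : ∀ x, lab (Fin.snoc F p : Fin (n+1) → Poly) x = s →
          lab F x = (fun k => s k.castSucc) ∧ decide (0 < eval x p) = s (Fin.last n) := by
        rintro x rfl
        refine ⟨?_, ?_⟩
        · funext k; simp [lab]
        · simp [lab]
      have h3 : (S.filter fun x => eval x (∏ k, (Fin.snoc F p : Fin (n+1) → Poly) k) ≠ 0 ∧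
          lab (Fin.snoc F p : Fin (n+1) → Poly) x = s).card * 2 ≤
          (S.filter fun x => eval x (∏ k, F k) ≠ 0 ∧ lab F x = (fun k => s k.castSucc)).card := by
        by_cases hs : s (Fin.last n) = true
        · rw [mul_comm]
          refine le_trans (Nat.mul_le_mul_left _ (Finset.card_le_card ?_)) h1.1
          intro x hx
          rw [Finset.mem_filter, Fin.prod_univ_castSucc] at hx
          simp only [Fin.snoc_castSucc, Fin.snoc_last, map_mul] at hx
          have h4 := hlab x hx.2.2
          rw [hs, decide_eq_true_iff] at h4
          simp only [Finset.mem_filter]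
          exact ⟨⟨hx.1, left_ne_zero_of_mul hx.2.1, h4.1⟩, h4.2⟩
        · rw [mul_comm]
          refine le_trans (Nat.mul_le_mul_left _ (Finset.card_le_card ?_)) h1.2
          intro x hx
          rw [Finset.mem_filter, Fin.prod_univ_castSucc] at hx
          simp only [Fin.snoc_castSucc, Fin.snoc_last, map_mul] at hx
          have h4 := hlab x hx.2.2
          rw [Bool.not_eq_true] at hs
          rw [hs, decide_eq_false_iff_not] at h4
          simp only [Finset.mem_filter]
          exact ⟨⟨hx.1, left_ne_zero_of_mul hx.2.1, h4.1⟩,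
            lt_of_le_of_ne (not_lt.1 h4.2) (right_ne_zero_of_mul hx.2.1)⟩
      rw [mul_assoc, mul_comm 2]
      exact (Nat.mul_le_mul_left _ h3).trans h2
lemma partition (S : Finset E3) (j : ℕ) : ∃ (n : ℕ) (F : Fin n → Poly), (∏ k, F k) ≠ 0 ∧
    (∏ k, F k).totalDegree ≤ 12 * 2 ^ j ∧
    ∀ s, 8 ^ j * (S.filter fun x => eval x (∏ k, F k) ≠ 0 ∧ lab F x = s).card ≤ S.card := by
  obtain ⟨F, h0, hd, hF⟩ := partition_aux S (3 * j)
  refine ⟨_, F, Finset.prod_ne_zero_iff.2 fun k _ => h0 k, ?_, fun s => ?_⟩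
  · refine (totalDegree_finsetProd _ _).trans ((Finset.sum_le_sum fun k _ => hd k).trans ?_)
    rw [Fin.sum_univ_eq_sum_range (fun k => 4 * 2 ^ (k / 3))]
    clear hF hd h0 F
    induction j with
    | zero => simp
    | succ j ih =>
      rw [show 3 * (j+1) = 3*j+1+1+1 by ring, Finset.sum_range_succ, Finset.sum_range_succ,
        Finset.sum_range_succ, show 3*j/3 = j by omega, show (3*j+1)/3 = j by omega,
        show (3*j+1+1)/3 = j by omega, pow_succ]
      omega
  · have := hF s
    rwa [pow_mul] at this
end GK
namespace GK
open MvPolynomial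
open scoped Matrix
open scoped Classical in
def rr (Λ : Finset (Set E3)) (x : E3) : Finset (Set E3) := Λ.filter fun l => x ∈ l
open scoped Classical in
def pts (S : Finset E3) (l : Set E3) : Finset E3 := S.filter fun x => x ∈ l
lemma mem_rr {Λ : Finset (Set E3)} {x : E3} {l : Set E3} : l ∈ rr Λ x ↔ l ∈ Λ ∧ x ∈ l := by
  simp [rr]
lemma mem_pts {S : Finset E3} {x : E3} {l : Set E3} : x ∈ pts S l ↔ x ∈ S ∧ x ∈ l := by
  simp [pts]
lemma double_count (Λ : Finset (Set E3)) (S : Finset E3) :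
    ∑ x ∈ S, (rr Λ x).card = ∑ l ∈ Λ, (pts S l).card := by
  classical
  have := Finset.sum_card_bipartiteAbove_eq_sum_card_bipartiteBelow (s := S) (t := Λ)
    (fun (x : E3) (l : Set E3) => x ∈ l)
  convert this using 3 <;> ext <;> simp [mem_rr, mem_pts]
lemma off_count (Λ : Finset (Set E3)) (hΛ : ∀ l ∈ Λ, IsLine l) (S : Finset E3) (k m : ℕ) {n : ℕ}
    (F : Fin n → Poly) (h0 : ∀ x ∈ S, eval x (∏ k, F k) ≠ 0) (hk : ∀ x ∈ S, k ≤ (rr Λ x).card)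
    (hm : ∀ s, (S.filter fun x => lab F x = s).card ≤ m) :
    k * S.card ≤ Λ.card * ((∏ k, F k).totalDegree + 1) + S.card * m := by
  classical
  let Q := (S ×ˢ S).filter fun p => p.1 ≠ p.2 ∧ lab F p.1 = lab F p.2
  have hQ : Q.card ≤ S.card * m := by
    have : Q.card ≤ ∑ x ∈ S, (S.filter fun y => lab F y = lab F x).card := by
      rw [← Finset.card_sigma]
      refine Finset.card_le_card_of_injOn (fun p => ⟨p.1, p.2⟩) ?_ ?_
      · intro p hp
        simp only [Q, Finset.coe_filter, Finset.mem_product, Set.mem_ofPred_eq] at hp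
        simp only [Finset.coe_sigma, Set.mem_sigma_iff, Finset.mem_coe, Finset.mem_filter]
        exact ⟨hp.1.1, hp.1.2, hp.2.2.symm⟩
      · rintro ⟨a, b⟩ - ⟨c, d⟩ - h
        simpa using h
    refine this.trans ((Finset.sum_le_card_nsmul _ _ m fun x _ => hm _).trans ?_)
    rw [smul_eq_mul]
  have hline : ∀ l ∈ Λ, (pts S l).card ≤ ((∏ k, F k).totalDegree + 1) +
      (Q.filter fun p => p.1 ∈ l ∧ p.2 ∈ l).card := by
    intro l hl
    by_cases hv : Van (∏ k, F k) l
    · have : pts S l = ∅ := by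
        rw [Finset.eq_empty_iff_forall_notMem]
        intro x hx
        rw [mem_pts] at hx
        exact h0 x hx.1 (hv x hx.2)
      rw [this]; simp
    have h1 := line_cells F (hΛ l hl) hv (pts S l) fun x hx => by
      rw [mem_pts] at hx; exact ⟨hx.2, h0 x hx.1⟩
    have h2 : ∀ s, ∃ x, s ∈ (pts S l).image (lab F) → x ∈ pts S l ∧ lab F x = s := by
      intro s
      by_cases h : s ∈ (pts S l).image (lab F)
      · obtain ⟨x, hx, hx'⟩ := Finset.mem_image.1 h
        exact ⟨x, fun _ => ⟨hx, hx'⟩⟩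
      · exact ⟨0, fun h' => absurd h' h⟩
    choose ρ hρ using h2
    have hρ' : ∀ x ∈ pts S l, ρ (lab F x) ∈ pts S l ∧ lab F (ρ (lab F x)) = lab F x := fun x hx =>
      hρ _ (Finset.mem_image_of_mem _ hx)
    rw [← Finset.card_filter_add_card_filter_not (s := pts S l) (fun x => ρ (lab F x) = x)]
    refine add_le_add (le_trans ?_ h1) ?_
    · refine Finset.card_le_card_of_injOn (lab F) ?_ ?_
      · intro x hx
        exact Finset.mem_image_of_mem _ (Finset.mem_filter.1 hx).1
      · intro x hx y hy hxy
        rw [← (Finset.mem_filter.1 hx).2, ← (Finset.mem_filter.1 hy).2, hxy]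
    · refine Finset.card_le_card_of_injOn (fun x => (x, ρ (lab F x))) ?_ ?_
      · intro x hx
        obtain ⟨h3, h4⟩ := Finset.mem_filter.1 hx
        have h5 := hρ' x h3
        rw [mem_pts] at h3
        rw [mem_pts] at h5
        simp only [Q, Finset.mem_coe, Finset.mem_filter, Finset.mem_product]
        exact ⟨⟨⟨h3.1, h5.1.1⟩, fun h => h4 h.symm, h5.2.symm⟩, h3.2, h5.1.2⟩
      · intro x _ y _ h
        exact (Prod.ext_iff.1 h).1
  have hsumQ : ∑ l ∈ Λ, (Q.filter fun p => p.1 ∈ l ∧ p.2 ∈ l).card ≤ Q.card := by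
    have h1 := Finset.sum_card_bipartiteAbove_eq_sum_card_bipartiteBelow (s := Λ) (t := Q)
      (fun (l : Set E3) (p : E3 × E3) => p.1 ∈ l ∧ p.2 ∈ l)
    have h2 : ∑ l ∈ Λ, (Q.filter fun p => p.1 ∈ l ∧ p.2 ∈ l).card =
      ∑ p ∈ Q, (Λ.filter fun l => p.1 ∈ l ∧ p.2 ∈ l).card := h1
    rw [h2, Finset.card_eq_sum_ones]
    refine Finset.sum_le_sum fun p hp => Finset.card_le_one.2 fun l hl l' hl' => ?_
    rw [Finset.mem_filter] at hl hl'
    have h3 := (Finset.mem_filter.1 hp).2.1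
    exact line_eq_of_two (hΛ l hl.1) (hΛ l' hl'.1) hl.2.1 hl.2.2 hl'.2.1 hl'.2.2 h3
  calc k * S.card = S.card • k := by rw [smul_eq_mul, mul_comm]
    _ ≤ ∑ x ∈ S, (rr Λ x).card := Finset.card_nsmul_le_sum _ _ _ hk
    _ = ∑ l ∈ Λ, (pts S l).card := double_count Λ S
    _ ≤ ∑ l ∈ Λ, (((∏ k, F k).totalDegree + 1) + (Q.filter fun p => p.1 ∈ l ∧ p.2 ∈ l).card) :=
      Finset.sum_le_sum hline
    _ ≤ Λ.card * ((∏ k, F k).totalDegree + 1) + S.card * m := by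
      rw [Finset.sum_add_distrib, Finset.sum_const, smul_eq_mul]
      exact add_le_add le_rfl (hsumQ.trans hQ)
lemma sing_count (Fs : Finset Poly) (hirr : ∀ g ∈ Fs, Irreducible g)
    (hnd : ∀ g ∈ Fs, ∀ g' ∈ Fs, g ≠ g' → ¬ g ∣ g') (Λ : Finset (Set E3))
    (hΛ : ∀ l ∈ Λ, IsLine l ∧ Van (∏ g ∈ Fs, g) l ∧ ∀ i, Van (pderiv i (∏ g ∈ Fs, g)) l) :
    Λ.card ≤ (∑ g ∈ Fs, g.totalDegree) ^ 2 := by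
  classical
  have hpd : ∀ g : Poly, ∃ h : Fin 3, g ∈ Fs → pderiv h g ≠ 0 ∧
      (pderiv h g).totalDegree < g.totalDegree := by
    intro g
    by_cases hg : g ∈ Fs
    · have h1 := irr_deg_pos (hirr g hg)
      obtain ⟨i, hi⟩ := exists_pderiv_ne (f := g) (by omega)
      have h2 := totalDegree_pderiv_le i g
      exact ⟨i, fun _ => ⟨hi, by omega⟩⟩
    · exact ⟨0, fun h => absurd h hg⟩
  choose ix hix using hpd
  let H : Poly → Poly → Poly := fun g g' => if g = g' then pderiv (ix g) g else g'
  have hH : ∀ g ∈ Fs, ∀ g' ∈ Fs, ¬ g ∣ H g g' ∧ (H g g').totalDegree ≤ g'.totalDegree := by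
    intro g hg g' hg'
    by_cases h : g = g'
    · subst h
      simp only [H, if_true]
      exact ⟨not_dvd_of_deg_lt (hix g hg).1 (hix g hg).2, (hix g hg).2.le⟩
    · simp only [H, if_neg h]
      exact ⟨hnd g hg g' hg' h, le_rfl⟩
  have hsub : Λ ⊆ Fs.biUnion fun g => Fs.biUnion fun g' =>
      Λ.filter fun l => Van g l ∧ Van (H g g') l := by
    intro l hl
    obtain ⟨h1, h2, h3⟩ := hΛ l hl
    obtain ⟨g, hg, hgl⟩ := (van_prod h1 Fs (fun g => g)).1 h2
    have h4 := h3 (ix g)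
    rw [← Finset.mul_prod_erase Fs (fun g => g) hg, Derivation.leibniz, smul_eq_mul, smul_eq_mul] at h4
    have h5 : Van ((∏ x ∈ Fs.erase g, x) * pderiv (ix g) g) l := by
      intro x hx
      have := h4 x hx
      rw [map_add, map_mul, hgl x hx, zero_mul, zero_add] at this
      exact this
    simp only [Finset.mem_biUnion, Finset.mem_filter]
    rcases (van_mul h1 _ _).1 h5 with h6 | h6
    · obtain ⟨g', hg', h7⟩ := (van_prod h1 _ (fun g => g)).1 h6
      rw [Finset.mem_erase] at hg'
      exact ⟨g, hg, g', hg'.2, hl, hgl, by simpa [H, hg'.1.symm] using h7⟩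
    · exact ⟨g, hg, g, hg, hl, hgl, by simpa [H] using h6⟩
  refine (Finset.card_le_card hsub).trans (Finset.card_biUnion_le.trans ?_)
  rw [pow_two, Finset.sum_mul]
  refine Finset.sum_le_sum fun g hg => Finset.card_biUnion_le.trans ?_
  rw [Finset.mul_sum]
  refine Finset.sum_le_sum fun g' hg' => ?_
  refine (bezout_irr g (H g g') (hirr g hg) (hH g hg g' hg').1 _ fun l hl => ?_).trans
    (Nat.mul_le_mul_left _ (hH g hg g' hg').2)
  rw [Finset.mem_filter] at hl
  exact ⟨(hΛ l hl.1).1, hl.2⟩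
end GK
namespace GK
open MvPolynomial
open scoped Matrix
lemma flat_pt {q : Poly} {x u v w : E3} (hu : u ≠ 0) (hv : v ≠ 0) (hw : w ≠ 0)
    (huv : lin x u ≠ lin x v) (huw : lin x w ≠ lin x u) (hvw : lin x w ≠ lin x v)
    (qu : Van q (lin x u)) (qv : Van q (lin x v)) (qw : Van q (lin x w)) (hg : grad q x ≠ 0) :
    u ⨯₃ v ≠ 0 ∧ eval x (dd u q) = 0 ∧
      eval x (dd v q) = 0 ∧ eval x (dd u (dd u q)) = 0 ∧ eval x (dd v (dd u q)) = 0 := by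
  have hc := cross_ne_of_lines hu hv huv
  have e1 := van_dd qu x (mem_lin_self _ _)
  have e2 := van_dd qv x (mem_lin_self _ _)
  have e3 := van_dd qw x (mem_lin_self _ _)
  have f1 := van_dd (van_dd qu) x (mem_lin_self _ _)
  have f2 := van_dd (van_dd qv) x (mem_lin_self _ _)
  have f3 := van_dd (van_dd qw) x (mem_lin_self _ _)
  refine ⟨hc, e1, e2, f1, ?_⟩
  rw [eval_dd'] at e1 e2 e3
  obtain ⟨α, β, hab⟩ := span_of_orth hc hg e1 e2 e3
  have hα : α ≠ 0 := by
    rintro rfl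
    have h : w = β • v := by simpa using hab
    apply hvw
    rw [h, lin_smul]
    rintro rfl; simp at h; exact hw h
  have hβ : β ≠ 0 := by
    rintro rfl
    have h : w = α • u := by simpa using hab
    apply huw
    rw [h, lin_smul]
    exact hα
  have hw' : w = α • u + β • v + (0:ℝ) • (0 : E3) := by simpa using hab
  have h1 : ∀ F : Poly, eval x (dd w F) = α * eval x (dd u F) + β * eval x (dd v F) := by
    intro F; rw [hw', dd_lin]; simp
  have h2 : dd w (dd u q) = dd u (dd w q) := dd_comm _ _ _
  have h3 : dd w (dd v q) = dd v (dd w q) := dd_comm _ _ _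
  have h4 : dd u (dd v q) = dd v (dd u q) := dd_comm _ _ _
  rw [h1, ← h2, ← h3, h1, h1, f1, f2, h4] at f3
  have h5 : α * β * eval x (dd v (dd u q)) = 0 := by linarith
  simpa [hα, hβ] using h5
lemma flat_lines {q : Poly} (Λ : Finset (Set E3)) (hΛ : ∀ l ∈ Λ, IsLine l ∧ Van q l) {l : Set E3}
    (hl : l ∈ Λ) (T : Finset E3) (hT : ∀ x ∈ T, x ∈ l ∧ grad q x ≠ 0 ∧ 3 ≤ (rr Λ x).card)
    (hc : 2 * q.totalDegree < T.card) :
    ∃ n a : E3, n ≠ 0 ∧ lp n a ∣ q ∧ Van (lp n a) l ∧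
      ∃ M : Finset (Set E3), M ⊆ Λ ∧ M.card = T.card ∧ ∀ m ∈ M, Van (lp n a) m := by
  classical
  obtain ⟨a, u, hu, hlu⟩ := (hΛ l hl).1
  have h1 : ∀ x : E3, ∃ v, x ∈ T → v ≠ 0 ∧ lin x v ∈ Λ ∧ lin x v ≠ l ∧ u ⨯₃ v ≠ 0 ∧
      eval x (dd u q) = 0 ∧
      eval x (dd v q) = 0 ∧ eval x (dd u (dd u q)) = 0 ∧ eval x (dd v (dd u q)) = 0 := by
    intro x
    by_cases hx : x ∈ T
    swap
    · exact ⟨0, fun h => absurd h hx⟩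
    obtain ⟨hxl, hg, h3⟩ := hT x hx
    have hmem : l ∈ rr Λ x := mem_rr.2 ⟨hl, hxl⟩
    have h4 : 1 < ((rr Λ x).erase l).card := by rw [Finset.card_erase_of_mem hmem]; omega
    obtain ⟨m1, hm1, m2, hm2, h12⟩ := Finset.one_lt_card.1 h4
    rw [Finset.mem_erase, mem_rr] at hm1 hm2
    obtain ⟨v, hv, hv'⟩ := line_dir (hΛ m1 hm1.2.1).1 hm1.2.2
    obtain ⟨w, hw, hw'⟩ := line_dir (hΛ m2 hm2.2.1).1 hm2.2.2
    have hlx : l = lin x u := by rw [hlu]; exact lin_shift (by rw [← hlu]; exact hxl)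
    have := flat_pt (q := q) (x := x) hu hv hw (by rw [← hlx, ← hv']; exact hm1.1.symm)
      (by rw [← hlx, ← hw']; exact hm2.1) (by rw [← hv', ← hw']; exact h12.symm)
      (by rw [← hlx]; exact (hΛ l hl).2) (by rw [← hv']; exact (hΛ _ hm1.2.1).2)
      (by rw [← hw']; exact (hΛ _ hm2.2.1).2) hg
    exact ⟨v, fun _ => ⟨hv, by rw [← hv']; exact hm1.2.1, by rw [← hv']; exact hm1.1, this⟩⟩
  choose v hv using h1
  obtain ⟨n, hn, hn'⟩ := flat_line (f := q) (a := a) hu T hc fun x hx =>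
    ⟨by rw [← hlu]; exact (hT x hx).1, (hT x hx).2.1, v x, (hv x hx).2.2.2⟩
  have horth : ∀ x ∈ T, u ⬝ᵥ n = 0 ∧ v x ⬝ᵥ n = 0 := by
    intro x hx
    obtain ⟨hxl, hg, -⟩ := hT x hx
    obtain ⟨s, hs⟩ := hn' x (by rw [← hlu]; exact hxl)
    obtain ⟨-, -, -, -, e1, e2, -⟩ := hv x hx
    rw [eval_dd', hs, dotProduct_smul, smul_eq_mul] at e1 e2
    have hs0 : s ≠ 0 := by rintro rfl; apply hg; rw [hs, zero_smul]
    exact ⟨by simpa [hs0] using e1, by simpa [hs0] using e2⟩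
  have hTne : T.Nonempty := Finset.card_pos.1 (by omega)
  obtain ⟨x0, hx0⟩ := hTne
  have hun := (horth x0 hx0).1
  have hvl : ∀ x ∈ l, n ⬝ᵥ (x - a) = 0 := by
    intro x hx
    rw [hlu] at hx
    obtain ⟨t, rfl⟩ := hx
    rw [add_sub_cancel_left, dotProduct_smul, dotProduct_comm, hun, smul_zero]
  have hvm : ∀ x ∈ T, ∀ y ∈ lin x (v x), n ⬝ᵥ (y - a) = 0 := by
    rintro x hx y ⟨t, rfl⟩
    have e1 := hvl x (hT x hx).1
    have e2 := (horth x hx).2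
    rw [dotProduct_comm] at e2
    have : x + t • v x - a = (x - a) + t • v x := by abel
    rw [this, dotProduct_add, e1, dotProduct_smul, e2]; simp
  have hinj : Set.InjOn (fun x => lin x (v x)) T := by
    intro x hx y hy hxy
    by_contra hne
    simp only at hxy
    have hx' := hv x hx
    apply hx'.2.2.1
    exact line_eq_of_two (hΛ _ hx'.2.1).1 (hΛ l hl).1 (mem_lin_self _ _)
      (by rw [hxy]; exact mem_lin_self _ _) (hT x hx).1 (hT y hy).1 hne
  have hM : ∀ m ∈ T.image (fun x => lin x (v x)), m ∈ Λ ∧ ∀ y ∈ m, n ⬝ᵥ (y - a) = 0 := by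
    intro m hm
    obtain ⟨x, hx, rfl⟩ := Finset.mem_image.1 hm
    exact ⟨(hv x hx).2.1, hvm x hx⟩
  have hcard := Finset.card_image_of_injOn hinj
  refine ⟨n, a, hn, plane_dvd hn (T.image fun x => lin x (v x)) (fun m hm => ?_) (by omega),
    fun x hx => by rw [eval_lp]; exact hvl x hx, T.image (fun x => lin x (v x)),
    fun m hm => (hM m hm).1, hcard, fun m hm y hy => by rw [eval_lp]; exact (hM m hm).2 y hy⟩
  exact ⟨(hΛ m (hM m hm).1).1, (hΛ m (hM m hm).1).2, (hM m hm).2⟩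
lemma QH.mono {Λ Λ' : Finset (Set E3)} {b : ℕ} (h : QH Λ b) (hs : Λ' ⊆ Λ) : QH Λ' b :=
  fun R h0 hd M hM hv => h R h0 hd M (hM.trans hs) hv
lemma flat_count (Fs : Finset Poly) (hirr : ∀ g ∈ Fs, Irreducible g) (D b : ℕ)
    (hD : (∏ g ∈ Fs, g).totalDegree ≤ D) (hD' : ∑ g ∈ Fs, g.totalDegree ≤ D)
    (Λ : Finset (Set E3)) (hΛ : ∀ l ∈ Λ, IsLine l ∧ Van (∏ g ∈ Fs, g) l)
    (hq : QH Λ b) (S : Finset E3) (hS : ∀ x ∈ S, grad (∏ g ∈ Fs, g) x ≠ 0 ∧ 3 ≤ (rr Λ x).card) :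
    ∑ l ∈ Λ, (pts S l).card ≤ 2 * D * Λ.card + D * b * b := by
  classical
  let B := Λ.filter fun l => 2 * D < (pts S l).card
  have key : ∀ l ∈ B, (∃ g ∈ Fs, g.totalDegree ≤ 2 ∧ Van g l) ∧ (pts S l).card ≤ b := by
    intro l hl
    obtain ⟨hl, hlc⟩ := Finset.mem_filter.1 hl
    obtain ⟨n, a, hn, hdvd, hvl, M, hM, hMc, hMv⟩ := flat_lines (q := ∏ g ∈ Fs, g) Λ hΛ hl (pts S l)
      (fun x hx => by
        rw [mem_pts] at hx
        exact ⟨hx.2, hS x hx.1⟩) (by omega)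
    obtain ⟨hd, hi⟩ := lp_irreducible (a := a) hn
    constructor
    · obtain ⟨g, hg, hgd⟩ := (Prime.dvd_finsetProd_iff hi.prime (fun g : Poly => g)).1 hdvd
      have has : Associated (lp n a) g := hi.associated_of_dvd (hirr g hg) hgd
      refine ⟨g, hg, ?_, fun x hx => ?_⟩
      · have := totalDegree_le_of_dvd' hi.ne_zero has.symm.dvd
        omega
      · obtain ⟨r, hr⟩ := hgd
        rw [hr, map_mul, hvl x hx, zero_mul]
    · rw [← hMc]
      exact hq _ hi.ne_zero (by omega) M hM hMv
  have hB : B.card ≤ D * b := by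
    have hsub : B ⊆ Fs.biUnion fun g => if g.totalDegree ≤ 2 then Λ.filter fun l => Van g l else ∅ := by
      intro l hl
      obtain ⟨⟨g, hg, h1, h2⟩, -⟩ := key l hl
      rw [Finset.mem_biUnion]
      refine ⟨g, hg, ?_⟩
      rw [if_pos h1, Finset.mem_filter]
      exact ⟨(Finset.mem_filter.1 hl).1, h2⟩
    refine (Finset.card_le_card hsub).trans (Finset.card_biUnion_le.trans ?_)
    refine le_trans (Finset.sum_le_sum (g := fun g : Poly => g.totalDegree * b) fun g hg => ?_) ?_
    · split_ifs with h
      · refine le_trans (hq g (hirr g hg).ne_zero h _ (Finset.filter_subset _ _) fun l hl =>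
          (Finset.mem_filter.1 hl).2) ?_
        exact Nat.le_mul_of_pos_left _ (irr_deg_pos (hirr g hg))
      · simp
    · rw [← Finset.sum_mul]
      exact Nat.mul_le_mul_right _ hD'
  rw [← Finset.sum_filter_add_sum_filter_not Λ (fun l => 2 * D < (pts S l).card), add_comm]
  refine add_le_add ?_ ?_
  · refine (Finset.sum_le_card_nsmul _ _ (2 * D) fun l hl => ?_).trans ?_
    · exact not_lt.1 (Finset.mem_filter.1 hl).2
    · rw [smul_eq_mul, mul_comm]
      exact Nat.mul_le_mul_left _ (Finset.card_filter_le _ _)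
  · refine (Finset.sum_le_card_nsmul _ _ b fun l hl => (key l hl).2).trans ?_
    rw [smul_eq_mul]
    exact Nat.mul_le_mul_right _ hB
lemma on_count (c N : ℕ) (hN : 1 ≤ N) (Fs : Finset Poly) (hirr : ∀ g ∈ Fs, Irreducible g)
    (hnd : ∀ g ∈ Fs, ∀ g' ∈ Fs, g ≠ g' → ¬ g ∣ g') (D k : ℕ) (hD : ∑ g ∈ Fs, g.totalDegree ≤ D)
    (Λ : Finset (Set E3)) (hΛ : ∀ l ∈ Λ, IsLine l) (hcard : Λ.card ≤ N ^ 2) (hq : QH Λ (c * N))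
    (S : Finset E3) (hS : ∀ x ∈ S, ∃ g ∈ Fs, eval x g = 0)
    (hk : ∀ x ∈ S, k ≤ (rr Λ x).card ∧ (rr Λ x).card ≤ 2 * k) :
    k * S.card ≤ 4 * D * N ^ 2 + D * (c * N) * (c * N) + 3 * S.card +
      (6 * c + 24) * N * D ^ 2 * (2 * k) := by
  classical
  have hqd : (∏ g ∈ Fs, g).totalDegree ≤ D := by
    rw [totalDegree_prod' Fs (fun g => g) fun g hg => (hirr g hg).ne_zero]; exact hD
  have hS0 : ∀ x ∈ S, eval x (∏ g ∈ Fs, g) = 0 := by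
    intro x hx
    obtain ⟨g, hg, h⟩ := hS x hx
    rw [map_prod]
    exact Finset.prod_eq_zero hg h
  have hsing := sing_count Fs hirr hnd
  have hflat := flat_count Fs hirr D (c * N) hqd hD
  generalize (∏ g ∈ Fs, g) = q at *
  let Λ1 := Λ.filter fun l => ¬ Van q l
  let Λ2 := Λ.filter fun l => Van q l ∧ ∀ i, Van (pderiv i q) l
  let Λ3 := Λ.filter fun l => Van q l ∧ ∃ i, ¬ Van (pderiv i q) l
  have hs1 : Λ1 ⊆ Λ := Finset.filter_subset _ _
  have hs2 : Λ2 ⊆ Λ := Finset.filter_subset _ _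
  have hs3 : Λ3 ⊆ Λ := Finset.filter_subset _ _
  have hsplit : ∀ x, (rr Λ x).card ≤ (rr Λ1 x).card + (rr Λ2 x).card + (rr Λ3 x).card := by
    intro x
    have : rr Λ x ⊆ rr Λ1 x ∪ rr Λ2 x ∪ rr Λ3 x := by
      intro l hl
      simp only [Finset.mem_union, mem_rr, Λ1, Λ2, Λ3, Finset.mem_filter] at hl ⊢
      by_cases h1 : Van q l
      · by_cases h2 : ∀ i, Van (pderiv i q) l
        · exact Or.inl (Or.inr ⟨⟨hl.1, h1, h2⟩, hl.2⟩)
        · exact Or.inr ⟨⟨hl.1, h1, not_forall.1 h2⟩, hl.2⟩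
      · exact Or.inl (Or.inl ⟨⟨hl.1, h1⟩, hl.2⟩)
    exact (Finset.card_le_card this).trans ((Finset.card_union_le _ _).trans
      (add_le_add (Finset.card_union_le _ _) le_rfl))
  have hle : ∀ Λ' ⊆ Λ, ∀ (T : Finset E3), (∀ l ∈ Λ', (pts T l).card ≤ D) →
      ∑ x ∈ T, (rr Λ' x).card ≤ D * N ^ 2 := by
    intro Λ' hΛ' T h
    rw [double_count]
    refine (Finset.sum_le_card_nsmul _ _ D h).trans ?_
    rw [smul_eq_mul, mul_comm]
    exact Nat.mul_le_mul_left _ ((Finset.card_le_card hΛ').trans hcard)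
  have hb1 : ∑ x ∈ S, (rr Λ1 x).card ≤ D * N ^ 2 := by
    refine hle Λ1 hs1 S fun l hl => ?_
    by_contra hc
    refine (Finset.mem_filter.1 hl).2 (van_of_points (hΛ l (hs1 hl)) q (pts S l) (fun x hx => ?_) (by omega))
    rw [mem_pts] at hx
    exact ⟨hx.2, hS0 x hx.1⟩
  have hc2 : Λ2.card ≤ D ^ 2 := by
    refine (hsing Λ2 fun l hl => ⟨hΛ l (hs2 hl), (Finset.mem_filter.1 hl).2⟩).trans ?_
    exact Nat.pow_le_pow_left hD 2
  have hb2 : ∑ x ∈ S, (rr Λ2 x).card ≤ S.card + (6 * c + 24) * N * D ^ 2 * (2 * k) := by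
    rw [← Finset.sum_filter_add_sum_filter_not S (fun x => (rr Λ2 x).card ≤ 1)]
    refine add_le_add ?_ ?_
    · refine (Finset.sum_le_card_nsmul _ _ 1 fun x hx => (Finset.mem_filter.1 hx).2).trans ?_
      rw [smul_eq_mul, mul_one]
      exact Finset.card_filter_le _ _
    · refine (Finset.sum_le_card_nsmul _ _ (2 * k) fun x hx => ?_).trans ?_
      · refine le_trans (Finset.card_le_card fun l hl => ?_) (hk x (Finset.mem_filter.1 hx).1).2
        rw [mem_rr] at hl ⊢
        exact ⟨hs2 hl.1, hl.2⟩
      rw [smul_eq_mul]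
      refine Nat.mul_le_mul_right _ ?_
      refine (two_rich c N hN _ Λ2 rfl (fun l hl => hΛ l (hs2 hl)) ((Finset.card_le_card hs2).trans hcard)
        (hq.mono hs2) _ fun x hx => ?_).trans (Nat.mul_le_mul_left _ hc2)
      have h := (Finset.mem_filter.1 hx).2
      rw [not_le] at h
      obtain ⟨l, hl, m, hm, hlm⟩ := Finset.one_lt_card.1 h
      rw [mem_rr] at hl hm
      exact ⟨l, hl.1, m, hm.1, hlm, hl.2, hm.2⟩
  have hb3 : ∑ x ∈ S, (rr Λ3 x).card ≤ 3 * D * N ^ 2 + D * (c * N) * (c * N) + 2 * S.card := by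
    rw [← Finset.sum_filter_add_sum_filter_not S (fun x => grad q x = 0),
      ← Finset.sum_filter_add_sum_filter_not (S.filter fun x => ¬ grad q x = 0) (fun x => (rr Λ3 x).card ≤ 2)]
    have e1 : ∑ x ∈ S with grad q x = 0, (rr Λ3 x).card ≤ D * N ^ 2 := by
      refine hle Λ3 hs3 _ fun l hl => ?_
      by_contra hc
      obtain ⟨-, -, i, hi⟩ := Finset.mem_filter.1 hl
      refine hi (van_of_points (hΛ l (hs3 hl)) _ _ (fun x hx => ?_)
        (lt_of_le_of_lt ((totalDegree_pderiv_le i q).trans ((Nat.sub_le _ _).trans hqd)) (not_le.1 hc)))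
      rw [mem_pts, Finset.mem_filter] at hx
      exact ⟨hx.2, congrFun hx.1.2 i⟩
    have e2 : ∑ x ∈ S.filter (fun x => ¬ grad q x = 0) with (rr Λ3 x).card ≤ 2, (rr Λ3 x).card
        ≤ 2 * S.card := by
      refine (Finset.sum_le_card_nsmul _ _ 2 fun x hx => (Finset.mem_filter.1 hx).2).trans ?_
      rw [smul_eq_mul, mul_comm]
      exact Nat.mul_le_mul_left _ ((Finset.card_filter_le _ _).trans (Finset.card_filter_le _ _))
    have e3 : ∑ x ∈ S.filter (fun x => ¬ grad q x = 0) with ¬ (rr Λ3 x).card ≤ 2, (rr Λ3 x).card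
        ≤ 2 * D * N ^ 2 + D * (c * N) * (c * N) := by
      rw [double_count]
      refine (hflat Λ3 (fun l hl => ⟨hΛ l (hs3 hl), (Finset.mem_filter.1 hl).2.1⟩) (hq.mono hs3) _
        fun x hx => ?_).trans ?_
      · rw [Finset.mem_filter, Finset.mem_filter] at hx
        exact ⟨hx.1.2, by omega⟩
      · exact add_le_add (Nat.mul_le_mul_left _ ((Finset.card_le_card hs3).trans hcard)) le_rfl
    linarith
  have htot : k * S.card ≤ ∑ x ∈ S, ((rr Λ1 x).card + (rr Λ2 x).card + (rr Λ3 x).card) := by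
    rw [mul_comm, ← smul_eq_mul]
    exact Finset.card_nsmul_le_sum _ _ _ fun x hx => (hk x hx).1.trans (hsplit x)
  rw [Finset.sum_add_distrib, Finset.sum_add_distrib] at htot
  linarith
end GK
namespace GK
open MvPolynomial
open scoped Matrix
lemma krich_arith (a b N k n D : ℕ) (ha : 1 ≤ a) (hkN : k ≤ N) (hD : D = 12 ∨ D ^ 3 * k ≤ 27648 * n)
    (h : 7 * (k * n) ≤ 8 * (a * (D * N ^ 2)) + 8 * (b * (N * D ^ 2 * k))) :
    n * k ^ 2 ≤ (27 * 27648 ^ 2 * (a ^ 3 + b ^ 3 + a + b)) * N ^ 3 := by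
  rcases Nat.eq_zero_or_pos k with rfl | hk
  · simp
  have h2 : k * n ≤ 3 * a * (D * N ^ 2) ∨ n ≤ 3 * b * N * D ^ 2 := by
    by_contra hc
    rw [not_or, not_le, not_le] at hc
    have := Nat.mul_lt_mul_of_pos_right hc.2 hk
    nlinarith
  rcases h2 with h2 | h2
  · rcases hD with rfl | hD
    · calc n * k ^ 2 = (k * n) * k := by ring
        _ ≤ 3 * a * (12 * N ^ 2) * N := Nat.mul_le_mul h2 hkN
        _ = 36 * a * N ^ 3 := by ring
        _ ≤ _ := Nat.mul_le_mul_right _ (by nlinarith [Nat.zero_le (a ^ 3), Nat.zero_le (b ^ 3)])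
    · rcases Nat.eq_zero_or_pos n with rfl | hn
      · simp
      have h3 := Nat.mul_le_mul_right k (Nat.pow_le_pow_left h2 3)
      have h4 : (n * k ^ 2) ^ 2 * n ≤ 27 * 27648 * a ^ 3 * N ^ 6 * n := by
        calc (n * k ^ 2) ^ 2 * n = (k * n) ^ 3 * k := by ring
          _ ≤ (3 * a * (D * N ^ 2)) ^ 3 * k := h3
          _ = 27 * a ^ 3 * N ^ 6 * (D ^ 3 * k) := by ring
          _ ≤ 27 * a ^ 3 * N ^ 6 * (27648 * n) := Nat.mul_le_mul_left _ hD
          _ = _ := by ring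
      have h5 := Nat.le_of_mul_le_mul_right h4 hn
      refine le_trans ((Nat.pow_le_pow_iff_left (n := 2) (by norm_num)).1 ?_) (Nat.mul_le_mul_right (N ^ 3)
        (show 27 * 27648 * a ^ 3 ≤ _ by nlinarith [Nat.zero_le (a ^ 3), Nat.zero_le (b ^ 3)]))
      refine h5.trans ?_
      have h6 : 27 * 27648 * a ^ 3 ≤ (27 * 27648 * a ^ 3) ^ 2 := Nat.le_self_pow (by norm_num) _
      calc _ ≤ (27 * 27648 * a ^ 3) ^ 2 * N ^ 6 := Nat.mul_le_mul_right _ h6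
        _ = _ := by ring
  · rcases hD with rfl | hD
    · calc n * k ^ 2 ≤ (3 * b * N * 12 ^ 2) * N ^ 2 := Nat.mul_le_mul h2 (Nat.pow_le_pow_left hkN 2)
        _ = 432 * b * N ^ 3 := by ring
        _ ≤ _ := Nat.mul_le_mul_right _ (by nlinarith [Nat.zero_le (a ^ 3), Nat.zero_le (b ^ 3)])
    · rcases Nat.eq_zero_or_pos n with rfl | hn
      · simp
      have h4 : (n * k ^ 2) * n ^ 2 ≤ (27 * 27648 ^ 2 * b ^ 3 * N ^ 3) * n ^ 2 := by
        calc (n * k ^ 2) * n ^ 2 = n ^ 3 * k ^ 2 := by ring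
          _ ≤ (3 * b * N * D ^ 2) ^ 3 * k ^ 2 := Nat.mul_le_mul_right _ (Nat.pow_le_pow_left h2 3)
          _ = 27 * b ^ 3 * N ^ 3 * (D ^ 3 * k) ^ 2 := by ring
          _ ≤ 27 * b ^ 3 * N ^ 3 * (27648 * n) ^ 2 := Nat.mul_le_mul_left _ (Nat.pow_le_pow_left hD 2)
          _ = _ := by ring
      refine (Nat.le_of_mul_le_mul_right h4 (by positivity)).trans (Nat.mul_le_mul_right _ ?_)
      nlinarith [Nat.zero_le (a ^ 3), Nat.zero_le (b ^ 3)]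
theorem krich (c : ℕ) : ∃ A : ℕ, ∀ N k : ℕ, 24 ≤ k → k ≤ N → ∀ Λ : Finset (Set E3),
    (∀ l ∈ Λ, IsLine l) → Λ.card ≤ N ^ 2 → QH Λ (c * N) → ∀ S : Finset E3,
    (∀ x ∈ S, k ≤ (rr Λ x).card ∧ (rr Λ x).card ≤ 2 * k) → S.card * k ^ 2 ≤ A * N ^ 3 := by
  classical
  refine ⟨27 * 27648 ^ 2 * ((8 + c * c) ^ 3 + (12 * c + 48) ^ 3 + (8 + c * c) + (12 * c + 48)), ?_⟩
  intro N k hk hkN Λ hΛ hcard hq S hS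
  have hex : ∃ j, 2 * S.card ≤ 8 ^ j * k :=
    ⟨2 * S.card, (Nat.lt_pow_self (by norm_num)).le.trans (Nat.le_mul_of_pos_right _ (by omega))⟩
  obtain ⟨j, hj, hjmin⟩ : ∃ j, 2 * S.card ≤ 8 ^ j * k ∧ ∀ i < j, ¬ 2 * S.card ≤ 8 ^ i * k :=
    ⟨Nat.find hex, Nat.find_spec hex, fun i hi => Nat.find_min hex hi⟩
  obtain ⟨n, F, hF0, hFd, hF⟩ := partition S j
  obtain ⟨D, hD⟩ : ∃ D, D = 12 * 2 ^ j := ⟨_, rfl⟩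
  rw [← hD] at hFd
  have hD1 : 12 ≤ D := by rw [hD]; exact Nat.le_mul_of_pos_right _ (by positivity)
  refine krich_arith _ _ N k S.card D (by omega) hkN ?_ ?_
  · rcases Nat.eq_zero_or_pos j with rfl | hj0
    · left; rw [hD]; norm_num
    · right
      obtain ⟨i, rfl⟩ : ∃ i, j = i + 1 := ⟨j - 1, by omega⟩
      have h1 := hjmin i (by omega)
      rw [not_le] at h1
      have : D ^ 3 * k = 13824 * (8 ^ i * k) := by
        rw [hD, show (8:ℕ) = 2 ^ 3 by norm_num, ← pow_mul, mul_comm 3 i, pow_mul]; ring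
      rw [this]; omega
  have hoff := off_count Λ hΛ (S.filter fun x => eval x (∏ k, F k) ≠ 0) k (k / 2) F
    (fun x hx => (Finset.mem_filter.1 hx).2) (fun x hx => (hS x (Finset.mem_filter.1 hx).1).1) (by
      intro s
      have h1 := hF s
      rw [Finset.filter_filter]
      have h2 : 8 ^ j * (2 * (S.filter fun x => eval x (∏ k, F k) ≠ 0 ∧ lab F x = s).card) ≤ 8 ^ j * k := by
        refine le_trans ?_ hj
        rw [mul_left_comm]; exact Nat.mul_le_mul_left _ h1
      have h3 := Nat.le_of_mul_le_mul_left h2 (by positivity)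
      rw [Nat.le_div_iff_mul_le (by norm_num)]
      linarith)
  obtain ⟨Fs, f1, f2, f3, f4, f5⟩ := factor_data (∏ k, F k) hF0
  have hon := on_count c N (by omega) Fs f1 f2 D k (f5.trans hFd) Λ hΛ hcard hq
    (S.filter fun x => ¬ eval x (∏ k, F k) ≠ 0) (fun x hx => f3 x (not_not.1 (Finset.mem_filter.1 hx).2))
    (fun x hx => hS x (Finset.mem_filter.1 hx).1)
  have hsum := Finset.card_filter_add_card_filter_not (s := S) (fun x => eval x (∏ k, F k) ≠ 0)
  generalize (∏ k, F k).totalDegree = d at *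
  generalize (S.filter fun x => eval x (∏ k, F k) ≠ 0).card = s1 at *
  generalize (S.filter fun x => ¬ eval x (∏ k, F k) ≠ 0).card = s2 at *
  generalize S.card = s at *
  have e1 : k * s1 ≤ 2 * (N ^ 2 * (D + 1)) := by
    have : s1 * (k / 2) * 2 ≤ s1 * k := by rw [mul_assoc]; exact Nat.mul_le_mul_left _ (Nat.div_mul_le_self _ _)
    have : Λ.card * (d + 1) ≤ N ^ 2 * (D + 1) := Nat.mul_le_mul hcard (by omega)
    nlinarith
  have e2 : 24 * s2 ≤ k * s2 := Nat.mul_le_mul_right _ hk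
  have e3 : N ^ 2 * 12 ≤ N ^ 2 * D := Nat.mul_le_mul_left _ hD1
  subst hsum
  have e4 : 24 * s2 ≤ k * (s1 + s2) := e2.trans (Nat.mul_le_mul_left _ (by omega))
  ring_nf at *
  linarith
end GK
namespace GK
open MvPolynomial
open scoped Matrix
theorem gk_sum (c : ℕ) : ∃ A : ℕ, ∀ N : ℕ, 1 ≤ N → ∀ Λ : Finset (Set E3),
    (∀ l ∈ Λ, IsLine l) → Λ.card ≤ N ^ 2 → QH Λ (c * N) → (∀ x, (rr Λ x).card ≤ N) →
    ∀ Q : Finset (Set E3 × Set E3), (∀ p ∈ Q, p.1 ∈ Λ ∧ p.2 ∈ Λ ∧ p.1 ≠ p.2 ∧ ∃ x, x ∈ p.1 ∧ x ∈ p.2) →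
    Q.card ≤ A * N ^ 3 * (Nat.log 2 N + 1) := by
  classical
  obtain ⟨A, hA⟩ := krich c
  refine ⟨4 * A + 1024 * (6 * c + 24), fun N hN Λ hΛ hcard hq hr Q hQ => ?_⟩
  have h1 : ∀ p : Set E3 × Set E3, ∃ x, p ∈ Q → x ∈ p.1 ∧ x ∈ p.2 := by
    intro p
    by_cases hp : p ∈ Q
    · obtain ⟨x, hx⟩ := (hQ p hp).2.2.2
      exact ⟨x, fun _ => hx⟩
    · exact ⟨0, fun h => absurd h hp⟩
  choose X hX using h1
  obtain ⟨S, hS⟩ : ∃ S, S = Q.image X := ⟨_, rfl⟩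
  have hS2 : ∀ x ∈ S, ∃ l ∈ Λ, ∃ m ∈ Λ, l ≠ m ∧ x ∈ l ∧ x ∈ m := by
    intro x hx
    rw [hS] at hx
    obtain ⟨p, hp, rfl⟩ := Finset.mem_image.1 hx
    obtain ⟨e1, e2, e3, -⟩ := hQ p hp
    exact ⟨p.1, e1, p.2, e2, e3, hX p hp⟩
  have hQS : Q.card ≤ ∑ x ∈ S, (rr Λ x).card ^ 2 := by
    rw [Finset.card_eq_sum_card_image X Q, ← hS]
    refine Finset.sum_le_sum fun x hx => ?_
    rw [pow_two, ← Finset.card_product]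
    refine Finset.card_le_card fun p hp => ?_
    obtain ⟨hp', rfl⟩ := Finset.mem_filter.1 hp
    clear hp
    rw [Finset.mem_product, mem_rr, mem_rr]
    exact ⟨⟨(hQ p hp').1, (hX p hp').1⟩, ⟨(hQ p hp').2.1, (hX p hp').2⟩⟩
  have hmaps : ∀ x ∈ S, Nat.log 2 (rr Λ x).card ∈ Finset.range (Nat.log 2 N + 1) := by
    intro x _
    rw [Finset.mem_range, Nat.lt_succ_iff]
    exact Nat.log_mono_right (hr x)
  rw [← Finset.sum_fiberwise_of_maps_to hmaps] at hQS
  refine hQS.trans ((Finset.sum_le_card_nsmul _ _ ((4 * A + 1024 * (6 * c + 24)) * N ^ 3)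
    fun j hj => ?_).trans (by rw [smul_eq_mul, Finset.card_range, mul_comm]))
  have hpos : ∀ x ∈ S, (rr Λ x).card ≠ 0 := by
    intro x hx h0
    obtain ⟨l, hl, -, -, -, hxl, -⟩ := hS2 x hx
    rw [Finset.card_eq_zero] at h0
    have := mem_rr.2 ⟨hl, hxl⟩
    rw [h0] at this; simp at this
  obtain ⟨T, hT⟩ : ∃ T, T = S.filter fun x => Nat.log 2 (rr Λ x).card = j := ⟨_, rfl⟩
  have hTS : T ⊆ S := by rw [hT]; exact Finset.filter_subset _ _
  have hTr : ∀ x ∈ T, 2 ^ j ≤ (rr Λ x).card ∧ (rr Λ x).card ≤ 2 * 2 ^ j := by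
    intro x hx
    have h2 : Nat.log 2 (rr Λ x).card = j := by
      rw [hT] at hx; exact (Finset.mem_filter.1 hx).2
    have h3 := Nat.pow_log_le_self 2 (hpos x (hTS hx))
    have h4 := Nat.lt_pow_succ_log_self (b := 2) (by norm_num) (rr Λ x).card
    rw [h2] at h3 h4
    rw [pow_succ] at h4
    exact ⟨h3, by omega⟩
  rw [← hT]
  refine (Finset.sum_le_card_nsmul _ _ ((2 * 2 ^ j) ^ 2) fun x hx =>
    Nat.pow_le_pow_left (hTr x hx).2 2).trans ?_
  rw [smul_eq_mul]
  rw [Finset.mem_range, Nat.lt_succ_iff] at hj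
  by_cases hj5 : 5 ≤ j
  · have h32 : 2 ^ 5 ≤ 2 ^ j := Nat.pow_le_pow_right (by norm_num) hj5
    have hkN : 2 ^ j ≤ N := (Nat.pow_le_pow_right (by norm_num) hj).trans (Nat.pow_log_le_self 2 (by omega))
    have := hA N (2 ^ j) (by omega) hkN Λ hΛ hcard hq T hTr
    nlinarith [Nat.zero_le (N ^ 3), Nat.zero_le (c * N ^ 3)]
  · have h2 := two_rich c N hN _ Λ rfl hΛ hcard hq T fun x hx => hS2 x (hTS hx)
    have h3 : (2 * 2 ^ j) ^ 2 ≤ 1024 := by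
      have : 2 ^ j ≤ 2 ^ 4 := Nat.pow_le_pow_right (by norm_num) (by omega)
      calc (2 * 2 ^ j) ^ 2 ≤ (2 * 2 ^ 4) ^ 2 := Nat.pow_le_pow_left (by omega) 2
        _ = 1024 := by norm_num
    calc T.card * (2 * 2 ^ j) ^ 2 ≤ ((6 * c + 24) * N * Λ.card) * 1024 := Nat.mul_le_mul h2 h3
      _ ≤ ((6 * c + 24) * N * N ^ 2) * 1024 := Nat.mul_le_mul_right _ (Nat.mul_le_mul_left _ hcard)
      _ ≤ _ := by nlinarith [Nat.zero_le (A * N ^ 3)]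
end GK
namespace GK
open MvPolynomial
open scoped Matrix
def ca (p q : ℍ) : ℝ := q.re + q.im * p.re / p.im
def cb (p q : ℍ) : ℝ := q.im / p.im
def cc (p q : ℍ) : ℝ := -(q.im * (p.re ^ 2 + p.im ^ 2) / p.im)
def cd (p q : ℍ) : ℝ := q.re - q.im * p.re / p.im
def ln (s : ℝ) (p q : ℍ) : Set E3 :=
  lin ![0, ca p q, cc p q] ![1, cb p q - s * ca p q, cd p q - s * cc p q]
lemma isLine_ln (s : ℝ) (p q : ℍ) : IsLine (ln s p q) :=
  isLine_lin fun h => by simpa using congrFun h 0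
lemma mem_ln {s : ℝ} {p q : ℍ} {x : E3} : x ∈ ln s p q ↔
    x 1 = ca p q * (1 - s * x 0) + cb p q * x 0 ∧ x 2 = cc p q * (1 - s * x 0) + cd p q * x 0 := by
  constructor
  · rintro ⟨t, rfl⟩
    constructor <;> simp <;> ring
  · rintro ⟨h1, h2⟩
    refine ⟨x 0, ?_⟩
    ext i
    fin_cases i <;> simp [h1, h2] <;> ring
lemma ln_pt (s : ℝ) (p q : ℍ) (t : ℝ) :
    ![t, ca p q * (1 - s * t) + cb p q * t, cc p q * (1 - s * t) + cd p q * t] ∈ ln s p q := by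
  rw [mem_ln]; simp
lemma ext_re_im {p q : ℍ} (h1 : p.re = q.re) (h2 : p.im = q.im) : p = q :=
  UpperHalfPlane.ext (Complex.ext h1 h2)
lemma ln_inj {s : ℝ} {p q p' q' : ℍ} (h : ln s p q = ln s p' q') : p = p' ∧ q = q' := by
  have h0 := ln_pt s p q 0
  have h1 := ln_pt s p q 1
  rw [h, mem_ln] at h0 h1
  simp at h0 h1
  have hy := p.im_pos
  have hy' := p'.im_pos
  have hv := q.im_pos
  obtain ⟨e1, e2⟩ := h0
  have e3 : cb p q = cb p' q' := by rw [e1] at h1; linarith [h1.1]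
  have e4 : cd p q = cd p' q' := by rw [e2] at h1; linarith [h1.2]
  have hu : q.re = q'.re := by unfold ca at e1; unfold cd at e4; linarith
  have hb : q'.im / p'.im = q.im / p.im := by unfold cb at e3; exact e3.symm
  have hbp : 0 < q.im / p.im := by positivity
  have a1 : ca p q = q.re + q.im / p.im * p.re := by unfold ca; ring
  have a2 : ca p' q' = q.re + q.im / p.im * p'.re := by unfold ca; rw [← hb, hu]; ring
  have c1 : cc p q = - (q.im / p.im * (p.re ^ 2 + p.im ^ 2)) := by unfold cc; ring
  have c2 : cc p' q' = - (q.im / p.im * (p'.re ^ 2 + p'.im ^ 2)) := by unfold cc; rw [← hb]; ring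
  have hx : p.re = p'.re := by
    rw [a1, a2] at e1
    exact mul_left_cancel₀ hbp.ne' (by linarith)
  have hy2 : p.im = p'.im := by
    rw [c1, c2, hx] at e2
    have := mul_left_cancel₀ hbp.ne' (neg_injective e2)
    exact (sq_eq_sq₀ hy.le hy'.le).1 (by linarith)
  refine ⟨ext_re_im hx hy2, ext_re_im hu ?_⟩
  rw [hy2] at hb
  field_simp at hb
  exact hb.symm
lemma ln_disj {s : ℝ} {p q q' : ℍ} {x : E3} (h : x ∈ ln s p q) (h' : x ∈ ln s p q') : q = q' := by
  rw [mem_ln] at h h'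
  obtain ⟨h1, h2⟩ := h
  rw [h'.1] at h1
  rw [h'.2] at h2
  have hy := p.im_pos.ne'
  obtain ⟨r1, hr1⟩ : ∃ r1, r1 = 1 - s * x 0 := ⟨_, rfl⟩
  obtain ⟨b, hb⟩ : ∃ b, b = q.im / p.im - q'.im / p.im := ⟨_, rfl⟩
  obtain ⟨u, hu⟩ : ∃ u, u = q.re - q'.re := ⟨_, rfl⟩
  rw [← hr1] at h1 h2
  have e1 : (u + b * p.re) * r1 + b * x 0 = 0 := by
    rw [hu, hb]; unfold ca cb at h1; linear_combination -h1
  have e2 : -(b * (p.re ^ 2 + p.im ^ 2)) * r1 + (u - b * p.re) * x 0 = 0 := by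
    rw [hu, hb]; unfold cc cd at h2; linear_combination -h2
  have hdet : u ^ 2 + (b * p.im) ^ 2 = 0 := by
    by_contra hne
    have f1 : (u ^ 2 + (b * p.im) ^ 2) * r1 = 0 := by
      linear_combination (u - b * p.re) * e1 - b * e2
    have f2 : (u ^ 2 + (b * p.im) ^ 2) * x 0 = 0 := by
      linear_combination (u + b * p.re) * e2 + b * (p.re ^ 2 + p.im ^ 2) * e1
    have g1 : r1 = 0 := by simpa [hne] using f1
    have g2 : x 0 = 0 := (mul_eq_zero.1 f2).resolve_left hne
    rw [g1, g2] at hr1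
    simp at hr1
  have hu0 : u = 0 := by nlinarith [sq_nonneg u, sq_nonneg (b * p.im)]
  have hb0 : b * p.im = 0 := by nlinarith [sq_nonneg u, sq_nonneg (b * p.im)]
  refine ext_re_im (by linarith) ?_
  rw [hb] at hb0
  field_simp at hb0
  linarith
lemma ln_meet {p p' q q' : ℍ} (h : dist p p' = dist q q') :
    ∃ s0 : ℝ, ∀ s, s ≠ s0 → ∃ x, x ∈ ln s p q ∧ x ∈ ln s p' q' := by
  have hy := p.im_pos
  have hy' := p'.im_pos
  have hv := q.im_pos
  have hv' := q'.im_pos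
  have hc : Real.cosh (dist p p') = Real.cosh (dist q q') := by rw [h]
  have hdet : (ca p q - ca p' q') * (cd p q - cd p' q') - (cb p q - cb p' q') * (cc p q - cc p' q') = 0 := by
    have h1 : ((p.re - p'.re) ^ 2 + p.im ^ 2 + p'.im ^ 2) * (q.im * q'.im) =
        ((q.re - q'.re) ^ 2 + q.im ^ 2 + q'.im ^ 2) * (p.im * p'.im) := by
      rw [UpperHalfPlane.cosh_dist', UpperHalfPlane.cosh_dist'] at hc
      field_simp at hc
      linarith
    unfold ca cb cc cd
    field_simp
    linear_combination (-1) * (p.im * p'.im) * h1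
  obtain ⟨r1, r2, hr, e1, e2⟩ : ∃ r1 r2 : ℝ, ¬ (r1 = 0 ∧ r2 = 0) ∧
      (ca p q - ca p' q') * r1 + (cb p q - cb p' q') * r2 = 0 ∧
      (cc p q - cc p' q') * r1 + (cd p q - cd p' q') * r2 = 0 := by
    generalize ca p q - ca p' q' = A at *
    generalize cb p q - cb p' q' = B at *
    generalize cc p q - cc p' q' = C at *
    generalize cd p q - cd p' q' = D at *
    by_cases h1 : A = 0 ∧ B = 0
    · by_cases h2 : C = 0 ∧ D = 0
      · exact ⟨1, 0, by simp, by simp [h1], by simp [h2]⟩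
      · exact ⟨D, -C, by simpa [and_comm] using h2, by rw [h1.1, h1.2]; ring, by ring⟩
    · exact ⟨B, -A, by simpa [and_comm] using h1, by ring, by linarith⟩
  refine ⟨-r1 / r2, fun s hs => ?_⟩
  have hw : r1 + s * r2 ≠ 0 := by
    intro h0
    by_cases h2 : r2 = 0
    · subst h2; simp at h0; exact hr ⟨h0, rfl⟩
    · apply hs; field_simp; linarith
  obtain ⟨w, hw'⟩ : ∃ w, w = r1 + s * r2 := ⟨_, rfl⟩
  rw [← hw'] at hw
  have hr1 : 1 - s * (r2 / w) = r1 / w := by field_simp; linarith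
  refine ⟨_, ln_pt s p q (r2 / w), ?_⟩
  rw [mem_ln]
  simp only [Matrix.cons_val_zero, Matrix.cons_val_one, Matrix.cons_val]
  rw [hr1]
  constructor
  · field_simp; linarith
  · field_simp; linarith
end GK
namespace GK
open MvPolynomial
open scoped Matrix
lemma quad_form (R : Poly) (hR : R.totalDegree ≤ 2) : ∃ c : Fin 10 → ℝ, ∀ x : E3, eval x R =
    c 0 + c 1 * x 0 + c 2 * x 1 + c 3 * x 2 + c 4 * x 0 ^ 2 + c 5 * (x 0 * x 1) + c 6 * (x 0 * x 2) +
    c 7 * x 1 ^ 2 + c 8 * (x 1 * x 2) + c 9 * x 2 ^ 2 := by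
  have key : ∀ m ∈ R.support, ∃ c : Fin 10 → ℝ, ∀ x : E3, eval x (monomial m (coeff m R)) =
    c 0 + c 1 * x 0 + c 2 * x 1 + c 3 * x 2 + c 4 * x 0 ^ 2 + c 5 * (x 0 * x 1) + c 6 * (x 0 * x 2) +
    c 7 * x 1 ^ 2 + c 8 * (x 1 * x 2) + c 9 * x 2 ^ 2 := by
    intro m hm
    have h1 := (le_totalDegree hm).trans hR
    rw [Finsupp.sum_fintype _ _ (by simp), Fin.sum_univ_three] at h1
    generalize coeff m R = e
    have h2 : ∀ x : E3, eval x (monomial m e) = e * (x 0 ^ m 0 * x 1 ^ m 1 * x 2 ^ m 2) := by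
      intro x
      rw [eval_monomial, Finsupp.prod_fintype _ _ (by simp), Fin.prod_univ_three]
    simp only [h2]
    generalize m 0 = a at *
    generalize m 1 = b at *
    generalize m 2 = d at *
    have ha : a ≤ 2 := by omega
    have hb : b ≤ 2 := by omega
    have hd : d ≤ 2 := by omega
    refine ⟨![if a + b + d = 0 then e else 0, if a = 1 ∧ b + d = 0 then e else 0,
      if b = 1 ∧ a + d = 0 then e else 0, if d = 1 ∧ a + b = 0 then e else 0,
      if a = 2 then e else 0, if a = 1 ∧ b = 1 then e else 0, if a = 1 ∧ d = 1 then e else 0,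
      if b = 2 then e else 0, if b = 1 ∧ d = 1 then e else 0, if d = 2 then e else 0], fun x => ?_⟩
    interval_cases a <;> interval_cases b <;> interval_cases d <;> first | omega | simp
  choose! cf hcf using key
  refine ⟨fun i => ∑ m ∈ R.support, cf m i, fun x => ?_⟩
  conv_lhs => rw [R.as_sum, map_sum]
  rw [Finset.sum_congr rfl fun m hm => hcf m hm x]
  simp only [Finset.sum_add_distrib, Finset.sum_mul]
lemma van_cplx {c : Fin 10 → ℝ} {s : ℝ} {p q : ℍ} (h : ∀ x ∈ ln s p q,
    c 0 + c 1 * x 0 + c 2 * x 1 + c 3 * x 2 + c 4 * x 0 ^ 2 + c 5 * (x 0 * x 1) + c 6 * (x 0 * x 2) +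
    c 7 * x 1 ^ 2 + c 8 * (x 1 * x 2) + c 9 * x 2 ^ 2 = 0) (w : ℂ) (hw : w = p.re - p.im * Complex.I) :
    (c 0 - ((2 * s * c 0 + c 1 : ℝ) : ℂ) * w + ((s ^ 2 * c 0 + s * c 1 + c 4 : ℝ) : ℂ) * w ^ 2) +
    (c 2 - ((c 3 + s * c 2 + c 5 : ℝ) : ℂ) * w + ((s * c 3 + c 6 : ℝ) : ℂ) * w ^ 2) * (q : ℂ) +
    (c 7 - (c 8 : ℂ) * w + c 9 * w ^ 2) * (q : ℂ) ^ 2 = 0 := by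
  have e0 := h _ (ln_pt s p q 0)
  have e1 := h _ (ln_pt s p q 1)
  have e2 := h _ (ln_pt s p q (-1))
  simp only [Matrix.cons_val_zero, Matrix.cons_val_one, Matrix.cons_val] at e0 e1 e2
  have hy : (p.im : ℂ) ≠ 0 := by exact_mod_cast p.im_pos.ne'
  have hI := Complex.I_sq
  have hq : (q : ℂ) = q.re + q.im * Complex.I := (Complex.re_add_im _).symm
  have z1 : (ca p q : ℂ) - cb p q * w = q := by
    rw [hq, hw]; unfold ca cb; push_cast; field_simp; ring
  have z2 : (cc p q : ℂ) - cd p q * w = - (q * w) := by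
    rw [hq, hw]; unfold cc cd; push_cast; field_simp; linear_combination (-q.im * p.im ^ 2 : ℂ) * hI
  have E0 := congrArg (fun r : ℝ => (r : ℂ)) e0
  have E1 := congrArg (fun r : ℝ => (r : ℂ)) e1
  have E2 := congrArg (fun r : ℝ => (r : ℂ)) e2
  push_cast at E0 E1 E2
  have H : ∀ W T Z1 Z2 : ℂ, W = 1 - s * w → T = -w → Z1 = ca p q - cb p q * w → Z2 = cc p q - cd p q * w →
      c 0 * W ^ 2 + c 1 * (W * T) + c 2 * (W * Z1) + c 3 * (W * Z2) + c 4 * T ^ 2 + c 5 * (T * Z1) +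
      c 6 * (T * Z2) + c 7 * Z1 ^ 2 + c 8 * (Z1 * Z2) + c 9 * Z2 ^ 2 = 0 := by
    rintro W T Z1 Z2 rfl rfl rfl rfl
    linear_combination ((1 - s * w) ^ 2 - w ^ 2 : ℂ) * E0 + ((-(1 - s * w) * w + w ^ 2) / 2 : ℂ) * E1 +
      (((1 - s * w) * w + w ^ 2) / 2 : ℂ) * E2
  have := H _ _ _ _ rfl rfl rfl rfl
  rw [z1, z2] at this
  push_cast
  linear_combination this
lemma quad3 {A B G q1 q2 q3 : ℂ} (h12 : q1 ≠ q2) (h13 : q1 ≠ q3) (h23 : q2 ≠ q3)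
    (h1 : A + B * q1 + G * q1 ^ 2 = 0) (h2 : A + B * q2 + G * q2 ^ 2 = 0)
    (h3 : A + B * q3 + G * q3 ^ 2 = 0) : A = 0 ∧ B = 0 ∧ G = 0 := by
  have e1 : B + G * (q1 + q2) = 0 :=
    mul_left_cancel₀ (sub_ne_zero.2 h12) (by linear_combination h1 - h2)
  have e2 : B + G * (q1 + q3) = 0 :=
    mul_left_cancel₀ (sub_ne_zero.2 h13) (by linear_combination h1 - h3)
  have e3 : G = 0 := mul_left_cancel₀ (sub_ne_zero.2 h23) (by linear_combination e1 - e2)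
  subst e3
  have e4 : B = 0 := by simpa using e1
  subst e4
  exact ⟨by simpa using h1, rfl, rfl⟩
lemma two_p {p p' : ℍ} (hp : p ≠ p') {e0 e1 e2 : ℝ}
    (h : (e0 - e1 * (p.re - p.im * Complex.I) + e2 * (p.re - p.im * Complex.I) ^ 2 : ℂ) = 0)
    (h' : (e0 - e1 * (p'.re - p'.im * Complex.I) + e2 * (p'.re - p'.im * Complex.I) ^ 2 : ℂ) = 0) :
    e0 = 0 ∧ e1 = 0 ∧ e2 = 0 := by
  have key : ∀ p : ℍ, (e0 - e1 * (p.re - p.im * Complex.I) + e2 * (p.re - p.im * Complex.I) ^ 2 : ℂ) = 0 →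
      e1 = 2 * e2 * p.re ∧ e0 = e2 * (p.re ^ 2 + p.im ^ 2) := by
    intro p h
    have hy := p.im_pos
    have hr := congrArg Complex.re h
    have hi := congrArg Complex.im h
    simp [pow_two] at hr hi
    have h1 : e1 = 2 * e2 * p.re := mul_right_cancel₀ hy.ne' (by linarith)
    exact ⟨h1, by rw [h1] at hr; linarith⟩
  obtain ⟨a1, a2⟩ := key p h
  obtain ⟨b1, b2⟩ := key p' h'
  have : e2 = 0 := by
    by_contra h0
    apply hp
    have hx : p.re = p'.re := by
      rw [a1] at b1
      exact mul_left_cancel₀ (mul_ne_zero two_ne_zero h0) b1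
    refine ext_re_im hx ((sq_eq_sq₀ p.im_pos.le p'.im_pos.le).1 ?_)
    rw [a2, hx] at b2
    linarith [mul_left_cancel₀ h0 b2]
  subst this
  exact ⟨by simpa using a2, by simpa using a1, rfl⟩
open scoped Classical in
def qs (P : Finset ℍ) (R : Poly) (s : ℝ) (p : ℍ) : Finset ℍ := P.filter fun q => Van R (ln s p q)
lemma three_q {P : Finset ℍ} {R : Poly} (h0 : R ≠ 0) (hR : R.totalDegree ≤ 2) {s : ℝ} {p p' : ℍ}
    (hp : 2 < (qs P R s p).card) (hp' : 2 < (qs P R s p').card) : p = p' := by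
  classical
  by_contra hne
  obtain ⟨c, hc⟩ := quad_form R hR
  have hv : ∀ p q, q ∈ qs P R s p → ∀ x ∈ ln s p q,
    c 0 + c 1 * x 0 + c 2 * x 1 + c 3 * x 2 + c 4 * x 0 ^ 2 + c 5 * (x 0 * x 1) + c 6 * (x 0 * x 2) +
    c 7 * x 1 ^ 2 + c 8 * (x 1 * x 2) + c 9 * x 2 ^ 2 = 0 := by
    intro p q hq x hx
    rw [← hc]
    exact (Finset.mem_filter.1 hq).2 x hx
  have key : ∀ p, 2 < (qs P R s p).card → ∀ w : ℂ, w = p.re - p.im * Complex.I →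
      (c 0 - ((2 * s * c 0 + c 1 : ℝ) : ℂ) * w + ((s ^ 2 * c 0 + s * c 1 + c 4 : ℝ) : ℂ) * w ^ 2) = 0 ∧
      (c 2 - ((c 3 + s * c 2 + c 5 : ℝ) : ℂ) * w + ((s * c 3 + c 6 : ℝ) : ℂ) * w ^ 2) = 0 ∧
      (c 7 - (c 8 : ℂ) * w + c 9 * w ^ 2) = 0 := by
    intro p hp w hw
    obtain ⟨q1, q2, q3, h1, h2, h3, h12, h13, h23⟩ := Finset.two_lt_card_iff.1 hp
    exact quad3 (fun h => h12 (UpperHalfPlane.ext h)) (fun h => h13 (UpperHalfPlane.ext h))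
      (fun h => h23 (UpperHalfPlane.ext h)) (van_cplx (hv p q1 h1) w hw) (van_cplx (hv p q2 h2) w hw)
      (van_cplx (hv p q3 h3) w hw)
  obtain ⟨a1, a2, a3⟩ := key p hp _ rfl
  obtain ⟨b1, b2, b3⟩ := key p' hp' _ rfl
  obtain ⟨x0, x1, x2⟩ := two_p hne a1 b1
  obtain ⟨y0, y1, y2⟩ := two_p hne a2 b2
  obtain ⟨z0, z1, z2⟩ := two_p hne a3 b3
  have hc1 : c 1 = 0 := by rw [x0] at x1; linarith
  have hc4 : c 4 = 0 := by rw [x0, hc1] at x2; linarith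
  have hc5 : c 5 = - c 3 := by rw [y0] at y1; linarith
  have hc6 : c 6 = - s * c 3 := by linarith
  obtain ⟨q, hq⟩ := Finset.card_pos.1 (show 0 < (qs P R s p).card by omega)
  have e0 := hv p q hq _ (ln_pt s p q 0)
  have e1 := hv p q hq _ (ln_pt s p q 1)
  have e2 := hv p q hq _ (ln_pt s p q (-1))
  simp only [x0, hc1, hc4, hc5, hc6, y0, z0, z1, z2, Matrix.cons_val_zero, Matrix.cons_val_one,
    Matrix.cons_val] at e0 e1 e2
  have hb : 0 < cb p q := div_pos q.im_pos p.im_pos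
  have e3 : c 3 * cb p q = 0 := by linear_combination (-(s+1)/2) * e1 - (1-s)/2 * e2 - (s^2-1) * e0
  have hc3 : c 3 = 0 := (mul_eq_zero.1 e3).resolve_right hb.ne'
  apply h0
  apply MvPolynomial.funext
  intro x
  rw [hc, x0, hc1, hc4, hc5, hc6, y0, z0, z1, z2, hc3]
  simp
open scoped Classical in
def LLn (P : Finset ℍ) (s : ℝ) : Finset (Set E3) := (P ×ˢ P).image fun z => ln s z.1 z.2
lemma mem_LLn {P : Finset ℍ} {s : ℝ} {l : Set E3} : l ∈ LLn P s ↔ ∃ p ∈ P, ∃ q ∈ P, ln s p q = l := by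
  classical
  simp [LLn]
  tauto
lemma QH_LLn (P : Finset ℍ) (s : ℝ) : QH (LLn P s) (3 * P.card) := by
  classical
  intro R h0 hR Λ' hs hv
  have h1 : Λ' ⊆ (P.sigma fun p => qs P R s p).image fun z => ln s z.1 z.2 := by
    intro l hl
    obtain ⟨p, hp, q, hq, rfl⟩ := mem_LLn.1 (hs hl)
    rw [Finset.mem_image]
    refine ⟨⟨p, q⟩, ?_, rfl⟩
    rw [Finset.mem_sigma]
    exact ⟨hp, Finset.mem_filter.2 ⟨hq, hv _ hl⟩⟩
  refine (Finset.card_le_card h1).trans (Finset.card_image_le.trans ?_)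
  rw [Finset.card_sigma]
  by_cases hex : ∃ p0 ∈ P, 2 < (qs P R s p0).card
  · obtain ⟨p0, hp0, h2⟩ := hex
    rw [← Finset.sum_erase_add _ _ hp0]
    have h3 : ∑ p ∈ P.erase p0, (qs P R s p).card ≤ (P.erase p0).card • 2 := by
      refine Finset.sum_le_card_nsmul _ _ _ fun p hp => ?_
      by_contra h
      exact (Finset.mem_erase.1 hp).1 (three_q h0 hR (not_le.1 h) h2)
    have h4 : (qs P R s p0).card ≤ P.card := Finset.card_filter_le _ _
    have h5 := Finset.card_erase_le (s := P) (a := p0)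
    rw [smul_eq_mul] at h3
    omega
  · have h3 : ∑ p ∈ P, (qs P R s p).card ≤ P.card • 2 := by
      refine Finset.sum_le_card_nsmul _ _ _ fun p hp => ?_
      by_contra h
      exact hex ⟨p, hp, not_le.1 h⟩
    rw [smul_eq_mul] at h3
    omega
lemma rr_LLn (P : Finset ℍ) (s : ℝ) (x : E3) : (rr (LLn P s) x).card ≤ P.card := by
  classical
  have h1 : ∀ l, ∃ p, l ∈ rr (LLn P s) x → p ∈ P ∧ ∃ q, ln s p q = l := by
    intro l
    by_cases hl : l ∈ rr (LLn P s) x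
    · obtain ⟨p, hp, q, -, h⟩ := mem_LLn.1 (mem_rr.1 hl).1
      exact ⟨p, fun _ => ⟨hp, q, h⟩⟩
    · exact ⟨UpperHalfPlane.I, fun h => absurd h hl⟩
  choose f hf using h1
  refine Finset.card_le_card_of_injOn f (fun l hl => (hf l hl).1) ?_
  intro l hl m hm hlm
  obtain ⟨-, q, hq⟩ := hf l hl
  obtain ⟨-, q', hq'⟩ := hf m hm
  have a1 := (mem_rr.1 hl).2
  have a2 := (mem_rr.1 hm).2
  rw [← hq] at a1
  rw [← hq', ← hlm] at a2
  rw [← hq, ← hq', ← hlm, ln_disj a1 a2]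
def distQ (P : Finset ℍ) : Set (ℍ × ℍ × ℍ × ℍ) :=
  {x | x.1 ∈ P ∧ x.2.1 ∈ P ∧ x.2.2.1 ∈ P ∧ x.2.2.2 ∈ P ∧
    dist x.1 x.2.1 = dist x.2.2.1 x.2.2.2 ∧ dist x.1 x.2.1 ≠ 0}
theorem main_nat : ∃ A : ℕ, ∀ P : Finset ℍ, 1 ≤ P.card →
    (distQ P).ncard ≤ A * P.card ^ 3 * (Nat.log 2 P.card + 1) := by
  classical
  obtain ⟨A, hA⟩ := gk_sum 3
  refine ⟨A, fun P hP => ?_⟩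
  obtain ⟨W, hW⟩ : ∃ W, W = P ×ˢ P ×ˢ P ×ˢ P := ⟨_, rfl⟩
  have hfin : distQ P ⊆ W := by
    intro x hx
    obtain ⟨h1, h2, h3, h4, -⟩ := hx
    rw [hW]
    simp [h1, h2, h3, h4]
  have hf : (distQ P).Finite := W.finite_toSet.subset hfin
  have h1 : ∀ x : ℍ × ℍ × ℍ × ℍ, ∃ s0 : ℝ, x ∈ distQ P → ∀ s, s ≠ s0 →
      ∃ y, y ∈ ln s x.1 x.2.2.1 ∧ y ∈ ln s x.2.1 x.2.2.2 := by
    intro x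
    by_cases hx : x ∈ distQ P
    · obtain ⟨s0, hs⟩ := ln_meet hx.2.2.2.2.1
      exact ⟨s0, fun _ => hs⟩
    · exact ⟨0, fun h => absurd h hx⟩
  choose σ hσ using h1
  obtain ⟨s, hs⟩ := (W.image σ).exists_notMem
  have hs' : ∀ x ∈ distQ P, s ≠ σ x := by
    rintro x hx rfl
    exact hs (Finset.mem_image_of_mem _ (hfin hx))
  rw [Set.ncard_eq_toFinset_card _ hf]
  have hinj : Set.InjOn (fun x : ℍ × ℍ × ℍ × ℍ => (ln s x.1 x.2.2.1, ln s x.2.1 x.2.2.2)) hf.toFinset := by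
    rintro ⟨a, b, c, d⟩ - ⟨a', b', c', d'⟩ - h
    simp only [Prod.mk.injEq] at h
    obtain ⟨rfl, rfl⟩ := ln_inj h.1
    obtain ⟨rfl, rfl⟩ := ln_inj h.2
    rfl
  rw [← Finset.card_image_of_injOn hinj]
  refine hA P.card hP (LLn P s) ?_ ?_ (QH_LLn P s) (rr_LLn P s) _ ?_
  · intro l hl
    obtain ⟨p, -, q, -, rfl⟩ := mem_LLn.1 hl
    exact isLine_ln s p q
  · refine Finset.card_image_le.trans ?_
    rw [Finset.card_product, pow_two]
  · intro z hz
    obtain ⟨x, hx, rfl⟩ := Finset.mem_image.1 hz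
    rw [Set.Finite.mem_toFinset] at hx
    obtain ⟨a1, a2, a3, a4, a5, a6⟩ := id hx
    refine ⟨mem_LLn.2 ⟨_, a1, _, a3, rfl⟩, mem_LLn.2 ⟨_, a2, _, a4, rfl⟩, fun h => a6 ?_, hσ x hx s (hs' x hx)⟩
    rw [(ln_inj h).1, dist_self]
theorem main_real : ∃ C : ℝ, 0 < C ∧ ∀ P : Finset ℍ, 2 ≤ P.card →
    ((distQ P).ncard : ℝ) ≤ C * (P.card : ℝ) ^ 3 * Real.log P.card := by
  obtain ⟨A, hA⟩ := main_nat
  refine ⟨4 * (A + 1), by positivity, fun P hP => ?_⟩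
  have h1 := hA P (by omega)
  have h1' : ((distQ P).ncard : ℝ) ≤ A * (P.card : ℝ) ^ 3 * ((Nat.log 2 P.card : ℕ) + 1) := by
    exact_mod_cast h1
  generalize P.card = N at *
  have hN : (2:ℝ) ≤ N := by exact_mod_cast hP
  have hl2 : (1:ℝ)/2 < Real.log 2 := by linarith [Real.log_two_gt_d9]
  have hl : Real.log 2 ≤ Real.log N := Real.log_le_log (by norm_num) hN
  have h2 : (Nat.log 2 N : ℝ) * Real.log 2 ≤ Real.log N := by
    rw [← Real.log_pow]
    apply Real.log_le_log (by positivity)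
    exact_mod_cast Nat.pow_log_le_self 2 (by omega)
  have h3 : (Nat.log 2 N : ℝ) + 1 ≤ 4 * Real.log N := by
    have : (0:ℝ) ≤ Nat.log 2 N := by positivity
    nlinarith
  have h4 : 0 ≤ Real.log N := by linarith
  calc _ ≤ A * (N : ℝ) ^ 3 * ((Nat.log 2 N : ℕ) + 1) := h1'
    _ ≤ A * (N : ℝ) ^ 3 * (4 * Real.log N) := by gcongr
    _ ≤ (A + 1) * (N : ℝ) ^ 3 * (4 * Real.log N) := by gcongr; linarith
    _ = _ := by ring
end GK

/-- There is an absolute constant `C > 0` such that for every finite set `P` of `N ≥ 2`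
points in the hyperbolic plane, `|Q(P)| ≤ C · N³ · log N`. -/
theorem quadruple_count_bound :
    ∃ C : ℝ, 0 < C ∧ ∀ P : Finset ℍ, 2 ≤ P.card →
      ((distQuadruples P).ncard : ℝ) ≤ C * (P.card : ℝ) ^ 3 * Real.log P.card := by
  exact GK.main_real

end
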